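/- Let 𝒩 be a nest on an infinite-dimensional separable complex Hilbert space H. Then the following are equivalent: (i) rtsr(T(𝒩)) = 2, i.e. Rg_2(T(𝒩)) is dense in T(𝒩)^2 and Rg_1(T(𝒩)) is not dense in T(𝒩); (ii) rtsr(T(𝒩)) < ∞, i.e. there exists n ≥ 1 such that Rg_n(T(𝒩)) is dense in T(𝒩)^n; (iii) β(𝒩) < ∞ — that is, there is an integer Q such that every chain N_0 ⊊ N_1 ⊊ ⋯ ⊊ N_q in 𝒩 with dim(N_j ⊖ N_{j−1}) ≥ dim(N_{j+1} ⊖ N_j) (Hilbert-space dimensions as cardinals) for all 1 ≤ j < q has q ≤ Q — and every atom of 𝒩 is finite-dimensional. -/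

import Mathlib

/-- A *nest* on a Hilbert space `H`: a family of closed subspaces, totally
ordered by inclusion, containing `{0}` and `H`, closed under arbitrary
intersections and under closed linear spans of subfamilies. -/
structure IsNest {H : Type*} [NormedAddCommGroup H] [InnerProductSpace ℂ H]
    (𝒩 : Set (Submodule ℂ H)) : Prop where
  closed : ∀ N ∈ 𝒩, IsClosed (N : Set H)
  chain : IsChain (· ≤ ·) 𝒩
  bot_mem : (⊥ : Submodule ℂ H) ∈ 𝒩
  top_mem : (⊤ : Submodule ℂ H) ∈ 𝒩
  sInf_mem : ∀ S ⊆ 𝒩, S.Nonempty → sInf S ∈ 𝒩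
  closure_sSup_mem : ∀ S ⊆ 𝒩, S.Nonempty → (sSup S).topologicalClosure ∈ 𝒩

/-- The nest algebra `T(𝒩)` of all bounded operators leaving each element of
the nest invariant. -/
def nestAlg {H : Type*} [NormedAddCommGroup H] [InnerProductSpace ℂ H]
    (𝒩 : Set (Submodule ℂ H)) : Set (H →L[ℂ] H) :=
  {T | ∀ N ∈ 𝒩, ∀ x ∈ N, T x ∈ N}

/-- `RgDenseIn S n` says that the set `Rg_n(S)` of right-invertible `n`-tuples
with entries in the (unital, closed) subalgebra `S ⊆ A` is dense in `S^n`. -/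
def RgDenseIn {A : Type*} [NormedRing A] (S : Set A) (n : ℕ) : Prop :=
  ∀ a : Fin n → A, (∀ i, a i ∈ S) → ∀ ε : ℝ, 0 < ε →
    ∃ b c : Fin n → A, (∀ i, b i ∈ S) ∧ (∀ i, c i ∈ S) ∧
      (∀ i, ‖a i - b i‖ < ε) ∧ ∑ i, b i * c i = 1

set_option linter.unusedSectionVars false

namespace NestRank

section Projections

variable {H : Type*} [NormedAddCommGroup H] [InnerProductSpace ℂ H] [CompleteSpace H]

/-- The orthogonal projection onto the closure of a subspace. -/
noncomputable def pr (K : Submodule ℂ H) : H →L[ℂ] H := K.topologicalClosure.starProjection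

/-- The orthogonal difference `K ⊖ L`. -/
noncomputable abbrev gap (L K : Submodule ℂ H) : Submodule ℂ H := K ⊓ Lᗮ

theorem pr_mem {K : Submodule ℂ H} (hK : IsClosed (K : Set H)) (x : H) : pr K x ∈ K := by
  exact hK.submodule_topologicalClosure_eq.le (K.topologicalClosure.starProjection_apply_mem x)

theorem pr_of_mem {K : Submodule ℂ H} {x : H} (hx : x ∈ K) : pr K x = x :=
  Submodule.starProjection_eq_self_iff.2 (K.le_topologicalClosure hx)

theorem pr_of_orth {K : Submodule ℂ H} {x : H} (hx : x ∈ Kᗮ) : pr K x = 0 := by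
  unfold pr
  rw [Submodule.starProjection_apply_eq_zero_iff, Submodule.orthogonal_closure]
  exact hx

theorem sub_pr_mem (K : Submodule ℂ H) (x : H) : x - pr K x ∈ Kᗮ := by
  have h := K.topologicalClosure.sub_starProjection_mem_orthogonal x
  rwa [Submodule.orthogonal_closure] at h

theorem norm_pr_apply_le (K : Submodule ℂ H) (x : H) : ‖pr K x‖ ≤ ‖x‖ :=
  Submodule.norm_starProjection_apply_le _ x

theorem norm_pr_le (K : Submodule ℂ H) : ‖pr K‖ ≤ 1 := Submodule.starProjection_norm_le _

theorem inner_pr_left (K : Submodule ℂ H) (x y : H) :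
    inner ℂ (pr K x) y = inner ℂ x (pr K y) :=
  Submodule.inner_starProjection_left_eq_right _ x y

theorem pr_pr (K : Submodule ℂ H) (x : H) : pr K (pr K x) = pr K x :=
  Submodule.starProjection_eq_self_iff.2 (Submodule.starProjection_apply_mem _ _)

theorem inner_pr_self (K : Submodule ℂ H) (x : H) :
    inner ℂ (pr K x) x = ((‖pr K x‖ ^ 2 : ℝ) : ℂ) := by
  rw [← pr_pr, inner_pr_left, pr_pr, inner_self_eq_norm_sq_to_K]
  norm_cast

theorem pr_eq_of {K : Submodule ℂ H} {x y : H} (hy : y ∈ K) (hxy : x - y ∈ Kᗮ) : pr K x = y := by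
  have h : pr K (x - y) = 0 := pr_of_orth hxy
  rw [map_sub, pr_of_mem hy, sub_eq_zero] at h
  exact h

theorem isClosed_gap {L K : Submodule ℂ H} (hK : IsClosed (K : Set H)) :
    IsClosed ((gap L K : Submodule ℂ H) : Set H) :=
  hK.inter (Submodule.isClosed_orthogonal L)

theorem pr_gap {L K : Submodule ℂ H} (hL : IsClosed (L : Set H)) (hK : IsClosed (K : Set H))
    (hLK : L ≤ K) (x : H) : pr (gap L K) x = pr K x - pr L x := by
  have h1 : pr K x - pr L x = pr K x - pr L (pr K x) := by
    have : pr L (x - pr K x) = 0 := pr_of_orth (Submodule.orthogonal_le hLK (sub_pr_mem K x))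
    rw [map_sub, sub_eq_zero] at this
    rw [this]
  refine pr_eq_of ?_ ?_
  · refine ⟨K.sub_mem (pr_mem hK x) (hLK (pr_mem hL x)), ?_⟩
    rw [h1]
    exact sub_pr_mem L _
  · have : x - (pr K x - pr L x) = (x - pr K x) + pr L x := by abel
    rw [this]
    refine Submodule.add_mem _ (Submodule.orthogonal_le inf_le_left (sub_pr_mem K x)) ?_
    exact Submodule.orthogonal_le inf_le_right
      (Submodule.le_orthogonal_orthogonal L (pr_mem hL x))

theorem isOrtho_gap {A B C D : Submodule ℂ H} (h : B ≤ C) : gap A B ⟂ gap C D :=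
  (Submodule.isOrtho_orthogonal_right C).mono (inf_le_left.trans h) inf_le_right

theorem gap_mono {A B C D : Submodule ℂ H} (h : C ≤ A) (h' : B ≤ D) : gap A B ≤ gap C D :=
  inf_le_inf h' (Submodule.orthogonal_le h)

theorem sum_norm_pr_sq_le {ι : Type*} {V : ι → Submodule ℂ H}
    (hV : ∀ s, IsClosed (V s : Set H)) (hVo : ∀ s t, s ≠ t → V s ⟂ V t) (F : Finset ι) (x : H) :
    ∑ s ∈ F, ‖pr (V s) x‖ ^ 2 ≤ ‖x‖ ^ 2 := by
  classical
  have hO : OrthogonalFamily ℂ (fun s => V s) (fun s => (V s).subtypeₗᵢ) :=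
    OrthogonalFamily.of_pairwise fun s t hst => hVo s t hst
  have h1 := hO.norm_sum (fun s => ⟨pr (V s) x, pr_mem (hV s) x⟩) F
  simp only [Submodule.coe_subtypeₗᵢ, Submodule.subtype_apply, Submodule.coe_norm] at h1
  set z := ∑ s ∈ F, pr (V s) x with hz
  have h2 : inner ℂ z x = ((‖z‖ ^ 2 : ℝ) : ℂ) := by
    rw [h1, hz, sum_inner, Complex.ofReal_sum]
    exact Finset.sum_congr rfl fun s _ => inner_pr_self _ _
  have h3 : ‖z‖ ^ 2 ≤ ‖z‖ * ‖x‖ := by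
    have := norm_inner_le_norm (𝕜 := ℂ) z x
    rwa [h2, Complex.norm_real, Real.norm_of_nonneg (by positivity)] at this
  rw [← h1]
  rcases eq_or_lt_of_le (norm_nonneg z) with h | h
  · rw [← h]
    nlinarith [sq_nonneg ‖x‖]
  · have : ‖z‖ ≤ ‖x‖ := by nlinarith
    gcongr

end Projections

section StrongSums

variable {X H : Type*} [NormedAddCommGroup X] [InnerProductSpace ℂ X] [CompleteSpace X]
  [NormedAddCommGroup H] [InnerProductSpace ℂ H] [CompleteSpace H]

/-- `T` maps into `W` and vanishes on the orthogonal complement of `V`. -/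
def Blk (V : Submodule ℂ X) (W : Submodule ℂ H) (T : X →L[ℂ] H) : Prop :=
  (∀ x, T x ∈ W) ∧ ∀ x ∈ Vᗮ, T x = 0

theorem Blk.apply_pr {V : Submodule ℂ X} {W : Submodule ℂ H} {T : X →L[ℂ] H} (h : Blk V W T)
    (x : X) : T (pr V x) = T x := by
  have := h.2 _ (sub_pr_mem V x)
  rw [map_sub, sub_eq_zero] at this
  exact this.symm

theorem Blk.mono {V V' : Submodule ℂ X} {W W' : Submodule ℂ H} {T : X →L[ℂ] H} (h : Blk V W T)
    (hV : V ≤ V') (hW : W ≤ W') : Blk V' W' T :=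
  ⟨fun x => hW (h.1 x), fun x hx => h.2 x (Submodule.orthogonal_le hV hx)⟩

theorem Blk.add {V : Submodule ℂ X} {W : Submodule ℂ H} {T S : X →L[ℂ] H} (h : Blk V W T)
    (h' : Blk V W S) : Blk V W (T + S) :=
  ⟨fun x => W.add_mem (h.1 x) (h'.1 x), fun x hx => by simp [h.2 x hx, h'.2 x hx]⟩

theorem Blk.zero (V : Submodule ℂ X) (W : Submodule ℂ H) : Blk V W 0 :=
  ⟨fun _ => W.zero_mem, fun _ _ => rfl⟩

theorem exists_strongSum {ι : Type*} {V : ι → Submodule ℂ X} {W : ι → Submodule ℂ H}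
    (hV : ∀ s, IsClosed (V s : Set X)) (hVo : ∀ s t, s ≠ t → V s ⟂ V t)
    (hWo : ∀ s t, s ≠ t → W s ⟂ W t) (T : ι → X →L[ℂ] H) {K : ℝ} (hK : 0 ≤ K)
    (hT : ∀ s, Blk (V s) (W s) (T s)) (hTK : ∀ s, ‖T s‖ ≤ K) :
    ∃ S : X →L[ℂ] H, (∀ x, HasSum (fun s => T s x) (S x)) ∧ ‖S‖ ≤ K := by
  classical
  have hO : OrthogonalFamily ℂ (fun s => W s) (fun s => (W s).subtypeₗᵢ) :=
    OrthogonalFamily.of_pairwise fun s t hst => hWo s t hst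
  have hb : ∀ s x, ‖T s x‖ ≤ K * ‖pr (V s) x‖ := fun s x => by
    rw [← (hT s).apply_pr]
    exact (T s).le_of_opNorm_le (hTK s) _
  have hbb : ∀ (F : Finset ι) x, ∑ s ∈ F, ‖T s x‖ ^ 2 ≤ K ^ 2 * ‖x‖ ^ 2 := fun F x => by
    calc ∑ s ∈ F, ‖T s x‖ ^ 2 ≤ ∑ s ∈ F, K ^ 2 * ‖pr (V s) x‖ ^ 2 := by
          refine Finset.sum_le_sum fun s _ => ?_
          rw [← mul_pow]
          exact pow_le_pow_left₀ (norm_nonneg _) (hb s x) 2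
      _ = K ^ 2 * ∑ s ∈ F, ‖pr (V s) x‖ ^ 2 := by rw [Finset.mul_sum]
      _ ≤ K ^ 2 * ‖x‖ ^ 2 := by
          gcongr
          exact sum_norm_pr_sq_le hV hVo F x
  have hsum : ∀ x, Summable (fun s => T s x) := fun x => by
    have := (hO.summable_iff_norm_sq_summable (fun s => ⟨T s x, (hT s).1 x⟩)).2
      (summable_of_sum_le (c := K ^ 2 * ‖x‖ ^ 2) (fun s => by positivity) (fun F => by
        simpa using hbb F x))
    simpa using this
  have hn : ∀ x, ‖∑' s, T s x‖ ≤ K * ‖x‖ := fun x => by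
    refine le_of_tendsto (hsum x).hasSum.norm (Filter.Eventually.of_forall fun F => ?_)
    have h1 := hO.norm_sum (fun s => ⟨T s x, (hT s).1 x⟩) F
    simp only [Submodule.coe_subtypeₗᵢ, Submodule.subtype_apply, Submodule.coe_norm] at h1
    refine le_of_sq_le_sq ?_ (by positivity)
    rw [h1, mul_pow]
    exact hbb F x
  refine ⟨LinearMap.mkContinuous
    { toFun := fun x => ∑' s, T s x
      map_add' := fun x y => by
        simp only [map_add]
        exact (hsum x).tsum_add (hsum y)
      map_smul' := fun c x => by
        simp only [map_smul, RingHom.id_apply]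
        exact (hsum x).tsum_const_smul c } K hn, fun x => (hsum x).hasSum,
    LinearMap.mkContinuous_norm_le _ hK _⟩

end StrongSums

section Embeddings

theorem countable_of_orthonormal {E : Type*} [NormedAddCommGroup E] [InnerProductSpace ℂ E]
    [TopologicalSpace.SeparableSpace E] {ι : Type*} {v : ι → E} (hv : Orthonormal ℂ v) :
    Countable ι := by
  have hd : ∀ i j, i ≠ j → 1 < dist (v i) (v j) := fun i j hij => by
    have h1 : ‖v i - v j‖ ^ 2 = 2 := by
      rw [@norm_sub_sq ℂ, hv.2 hij, hv.1 i, hv.1 j]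
      norm_num
    rw [dist_eq_norm]
    nlinarith [norm_nonneg (v i - v j)]
  have : (Set.univ : Set ι).Countable := by
    refine Set.PairwiseDisjoint.countable_of_isOpen (s := fun i => Metric.ball (v i) (1 / 2))
      ?_ (fun i _ => Metric.isOpen_ball) (fun i _ => ⟨v i, Metric.mem_ball_self (by norm_num)⟩)
    intro i _ j _ hij
    refine Metric.ball_disjoint_ball ?_
    have := hd i j hij
    linarith
  exact Set.countable_univ_iff.1 this

theorem exists_isometry_of_orthonormal {E F : Type*} [NormedAddCommGroup E]
    [InnerProductSpace ℂ E] [CompleteSpace E] [NormedAddCommGroup F] [InnerProductSpace ℂ F]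
    [CompleteSpace F] {ι : Type*} (b : HilbertBasis ι ℂ E) {v : ι → F} (hv : Orthonormal ℂ v) :
    Nonempty (E →ₗᵢ[ℂ] F) :=
  ⟨hv.orthogonalFamily.linearIsometry.comp b.repr.toLinearIsometry⟩

theorem exists_isometry_of_infinite (E F : Type*) [NormedAddCommGroup E]
    [InnerProductSpace ℂ E] [CompleteSpace E] [TopologicalSpace.SeparableSpace E]
    [NormedAddCommGroup F] [InnerProductSpace ℂ F] [CompleteSpace F]
    (hF : ¬ FiniteDimensional ℂ F) : Nonempty (E →ₗᵢ[ℂ] F) := by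
  obtain ⟨w, b, -⟩ := exists_hilbertBasis ℂ E
  obtain ⟨w', b', -⟩ := exists_hilbertBasis ℂ F
  have : Countable w := countable_of_orthonormal b.orthonormal
  have : Infinite w' := by
    by_contra h
    have : Finite w' := not_infinite_iff_finite.1 h
    have := Fintype.ofFinite w'
    exact hF (Module.Basis.finiteDimensional_of_finite b'.toOrthonormalBasis.toBasis)
  obtain ⟨f, hf⟩ := exists_injective_nat w
  have hg := (Infinite.natEmbedding w').injective
  exact exists_isometry_of_orthonormal b
    (b'.orthonormal.comp _ (hg.comp hf))

theorem exists_isometry_of_rank_le {E F : Type*} [NormedAddCommGroup E]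
    [InnerProductSpace ℂ E] [CompleteSpace E] [TopologicalSpace.SeparableSpace E]
    [NormedAddCommGroup F] [InnerProductSpace ℂ F] [CompleteSpace F]
    (h : FiniteDimensional ℂ F → FiniteDimensional ℂ E ∧
      Module.finrank ℂ E ≤ Module.finrank ℂ F) : Nonempty (E →ₗᵢ[ℂ] F) := by
  by_cases hF : FiniteDimensional ℂ F
  · obtain ⟨hE, hle⟩ := h hF
    refine exists_isometry_of_orthonormal (stdOrthonormalBasis ℂ E).toHilbertBasis
      (v := fun i => stdOrthonormalBasis ℂ F (Fin.castLE hle i)) ?_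
    exact (stdOrthonormalBasis ℂ F).orthonormal.comp _ (Fin.castLE_injective hle)
  · exact exists_isometry_of_infinite E F hF

variable {H : Type*} [NormedAddCommGroup H] [InnerProductSpace ℂ H] [CompleteSpace H]
    [TopologicalSpace.SeparableSpace H]

theorem exists_isometry_of_submodule_rank_le {I J : Submodule ℂ H} (hI : IsClosed (I : Set H))
    (hJ : IsClosed (J : Set H)) (h : Module.rank ℂ I ≤ Module.rank ℂ J) :
    Nonempty (I →ₗᵢ[ℂ] J) := by
  have := hI.completeSpace_coe
  have := hJ.completeSpace_coe
  have := UniformSpace.secondCountable_of_separable H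
  refine exists_isometry_of_rank_le fun hfin => ?_
  have hlt : Module.rank ℂ I < Cardinal.aleph0 := h.trans_lt (Module.rank_lt_aleph0_iff.2 hfin)
  have hfinI : FiniteDimensional ℂ I := Module.rank_lt_aleph0_iff.1 hlt
  refine ⟨hfinI, ?_⟩
  rw [← Module.finrank_eq_rank, ← Module.finrank_eq_rank] at h
  exact_mod_cast h

theorem rank_le_of_infinite {I J : Submodule ℂ H} (hI : IsClosed (I : Set H))
    (hJ : IsClosed (J : Set H)) (h : ¬ FiniteDimensional ℂ J) :
    Module.rank ℂ I ≤ Module.rank ℂ J := by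
  have := hI.completeSpace_coe
  have := hJ.completeSpace_coe
  have := UniformSpace.secondCountable_of_separable H
  obtain ⟨f⟩ := exists_isometry_of_infinite I J h
  exact LinearMap.rank_le_of_injective f.toLinearMap f.injective

end Embeddings

section InfiniteAtom

variable {H : Type*} [NormedAddCommGroup H] [InnerProductSpace ℂ H] [CompleteSpace H]

theorem pr_gap_apply {M N : Submodule ℂ H} (hM : IsClosed (M : Set H)) (hN : IsClosed (N : Set H))
    (hMN : M ≤ N) {T : H →L[ℂ] H} (hTM : ∀ x ∈ M, T x ∈ M) {z : H} (hz : z ∈ N) :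
    pr (gap M N) (T z) = pr (gap M N) (T (pr (gap M N) z)) := by
  have h1 : pr (gap M N) z = z - pr M z := by rw [pr_gap hM hN hMN, pr_of_mem hz]
  have h2 : pr (gap M N) (T (pr M z)) = 0 := by
    apply pr_of_orth
    exact Submodule.orthogonal_le inf_le_right
      (Submodule.le_orthogonal_orthogonal M (hTM _ (pr_mem hM z)))
  rw [h1, map_sub, map_sub, h2, sub_zero]

theorem finiteDimensional_of_atom [TopologicalSpace.SeparableSpace H]
    {𝒩 : Set (Submodule ℂ H)} (h𝒩 : IsNest 𝒩) {n : ℕ} (hn : 1 ≤ n)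
    (hd : RgDenseIn (nestAlg 𝒩) n) {M N : Submodule ℂ H} (hM : M ∈ 𝒩) (hN : N ∈ 𝒩) (hMN : M < N)
    (hatom : ∀ L ∈ 𝒩, ¬(M < L ∧ L < N)) : FiniteDimensional ℂ ↥(gap M N) := by
  classical
  by_contra hinf
  have hMc := h𝒩.closed M hM
  have hNc := h𝒩.closed N hN
  set E : Submodule ℂ H := gap M N with hE
  have hEc : IsClosed (E : Set H) := isClosed_gap hNc
  have : CompleteSpace E := hEc.completeSpace_coe
  have := UniformSpace.secondCountable_of_separable H
  have : TopologicalSpace.SeparableSpace (PiLp 2 (fun _ : Option (Fin n) => E)) :=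
    (PiLp.homeomorph 2 (fun _ : Option (Fin n) => E)).symm.surjective.denseRange.separableSpace
      (PiLp.homeomorph 2 (fun _ : Option (Fin n) => E)).symm.continuous
  obtain ⟨Φ⟩ := exists_isometry_of_infinite (PiLp 2 (fun _ : Option (Fin n) => E)) E hinf
  let S : Option (Fin n) → E →L[ℂ] PiLp 2 (fun _ : Option (Fin n) => E) := fun m =>
    ((PiLp.continuousLinearEquiv 2 ℂ (fun _ : Option (Fin n) => E)).symm :
      (Option (Fin n) → E) →L[ℂ] _).comp (ContinuousLinearMap.single ℂ (fun _ => E) m)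
  have hS : ∀ m x i, S m x i = if i = m then x else 0 := fun m x i => by
    simp [S]
  let A : Fin n → H →L[ℂ] H := fun m =>
    E.subtypeL.comp (Φ.toContinuousLinearMap.comp ((S (some m)).comp
      (E.orthogonalProjectionOnto)))
  have hAE : ∀ m x, A m x ∈ E := fun m x => Subtype.coe_prop _
  have hA0 : ∀ m, ∀ x ∈ Eᗮ, A m x = 0 := fun m x hx => by
    simp only [A, ContinuousLinearMap.comp_apply]
    rw [Submodule.orthogonalProjectionOnto_apply_of_mem_orthogonal hx]
    simp
  have hAalg : ∀ m, A m ∈ nestAlg 𝒩 := by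
    intro m L hL x hx
    by_cases hLM : L ≤ M
    · rw [hA0 m x]
      · exact L.zero_mem
      · exact Submodule.orthogonal_le inf_le_right
          (Submodule.le_orthogonal_orthogonal M (hLM hx))
    · have hML : M < L :=
        lt_of_le_of_ne ((h𝒩.chain.total hL hM).resolve_left hLM) (fun h => hLM h.ge)
      have hNL : N ≤ L := by
        rcases h𝒩.chain.total hL hN with h | h
        · rcases eq_or_lt_of_le h with h | h
          · exact h.ge
          · exact absurd ⟨hML, h⟩ (hatom L hL)
        · exact h
      exact hNL (hAE m x).1
  have hnpos : (0 : ℝ) < n := by exact_mod_cast hn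
  obtain ⟨b, c, hb, hc, hab, hbc⟩ := hd A hAalg (1 / n) (by positivity)
  have : Nontrivial E := by
    by_contra h
    rw [not_nontrivial_iff_subsingleton] at h
    exact hinf inferInstance
  obtain ⟨e, he⟩ := exists_ne (0 : E)
  set x : E := Φ (S none e) with hx
  have hx0 : x ≠ 0 := by
    intro h
    have h1 : S none e = 0 := Φ.injective (by rw [← hx, h, map_zero])
    have h2 := congrArg (fun w : PiLp 2 (fun _ : Option (Fin n) => E) => w none) h1
    simp only [hS, if_pos] at h2
    exact he h2
  let y : Fin n → H := fun m => pr E (c m x)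
  have hyE : ∀ m, y m ∈ E := fun m => pr_mem hEc _
  let w : PiLp 2 (fun _ : Option (Fin n) => E) := ∑ m, S (some m) ⟨y m, hyE m⟩
  have hw : ((Φ w : E) : H) = ∑ m, A m (y m) := by
    simp only [w, A, map_sum, Submodule.coe_sum, ContinuousLinearMap.comp_apply]
    refine Finset.sum_congr rfl fun m _ => ?_
    have : E.orthogonalProjectionOnto (y m) = ⟨y m, hyE m⟩ :=
      Submodule.orthogonalProjectionOnto_mem_subspace_eq_self (K := E) ⟨y m, hyE m⟩
    rw [this]
    rfl
  have hwnone : w none = 0 := by simp [w, hS]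
  have hwsome : ∀ m, w (some m) = ⟨y m, hyE m⟩ := fun m => by simp [w, hS]
  have hwn : ‖Φ w‖ ^ 2 = ∑ m, ‖y m‖ ^ 2 := by
    rw [Φ.norm_map, PiLp.norm_sq_eq_of_L2, Fintype.sum_option, hwnone]
    simp [hwsome]
  have horth : inner ℂ (Φ w) x = 0 := by
    rw [hx, Φ.inner_map_map, PiLp.inner_apply, Fintype.sum_option, hwnone]
    simp [hS]
  have hxN : (x : H) ∈ N := x.2.1
  have hxsum : (x : H) = pr E (∑ m, b m (y m)) := by
    have h1 : ∑ m, b m (c m x) = (x : H) := by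
      have := congrArg (fun T : H →L[ℂ] H => T x) hbc
      simpa [sum_apply] using this
    rw [← pr_of_mem x.2, ← h1, map_sum, map_sum]
    exact Finset.sum_congr rfl fun m _ =>
      pr_gap_apply hMc hNc hMN.le (fun u hu => hb m M hM u hu) (hc m N hN _ hxN)
  have hdiff : ((Φ w : E) : H) - x = pr E (∑ m, (A m - b m) (y m)) := by
    have : ∑ m, (A m - b m) (y m) = ((Φ w : E) : H) - ∑ m, b m (y m) := by
      rw [hw, ← Finset.sum_sub_distrib]
      rfl
    rw [this, map_sub, ← hxsum, pr_of_mem (Φ w).2]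
  have hle : ‖((Φ w : E) : H) - x‖ ≤ ∑ m, 1 / n * ‖y m‖ := by
    rw [hdiff]
    refine (norm_pr_apply_le _ _).trans ((norm_sum_le _ _).trans (Finset.sum_le_sum fun m _ => ?_))
    exact (A m - b m).le_of_opNorm_le (hab m).le _
  have hpyth : ‖((Φ w : E) : H) - x‖ ^ 2 = ‖Φ w‖ ^ 2 + ‖x‖ ^ 2 := by
    have h : ‖Φ w - x‖ ^ 2 = ‖Φ w‖ ^ 2 + ‖x‖ ^ 2 := by
      rw [@norm_sub_sq ℂ, horth]
      simp
    exact h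
  have hsq : (∑ m, 1 / n * ‖y m‖) ^ 2 ≤ 1 / n * ∑ m, ‖y m‖ ^ 2 := by
    rw [← Finset.mul_sum, mul_pow]
    have := sq_sum_le_card_mul_sum_sq (s := Finset.univ) (f := fun m => ‖y m‖)
    simp only [Finset.card_univ, Fintype.card_fin] at this
    calc (1 / (n : ℝ)) ^ 2 * (∑ m, ‖y m‖) ^ 2 ≤ (1 / n) ^ 2 * (n * ∑ m, ‖y m‖ ^ 2) := by gcongr
      _ = 1 / n * ∑ m, ‖y m‖ ^ 2 := by field_simp
  have h1n : 1 / (n : ℝ) ≤ 1 := by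
    rw [div_le_one hnpos]
    exact_mod_cast hn
  have hfin : ‖Φ w‖ ^ 2 + ‖x‖ ^ 2 ≤ ‖Φ w‖ ^ 2 := by
    rw [← hpyth]
    refine (pow_le_pow_left₀ (norm_nonneg _) hle 2).trans (hsq.trans ?_)
    rw [hwn]
    exact mul_le_of_le_one_left (Finset.sum_nonneg fun m _ => by positivity) h1n
  have : 0 < ‖x‖ := norm_pos_iff.2 hx0
  nlinarith

end InfiniteAtom

section LongChains

variable {H : Type*} [NormedAddCommGroup H] [InnerProductSpace ℂ H] [CompleteSpace H]

theorem norm_pr_gap_zero_sq {G : ℕ → Submodule ℂ H} (hG : Antitone G)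
    (hc : ∀ j, IsClosed (G j : Set H)) (u : H) (p : ℕ) :
    ‖pr (gap (G p) (G 0)) u‖ ^ 2 =
      ∑ j ∈ Finset.range p, ‖pr (gap (G (j + 1)) (G j)) u‖ ^ 2 := by
  induction p with
  | zero =>
    have : pr (gap (G 0) (G 0)) u = 0 := by rw [pr_gap (hc 0) (hc 0) le_rfl, sub_self]
    simp [this]
  | succ p ih =>
    rw [Finset.sum_range_succ, ← ih]
    have h1 : pr (gap (G (p + 1)) (G 0)) u =
        pr (gap (G p) (G 0)) u + pr (gap (G (p + 1)) (G p)) u := by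
      rw [pr_gap (hc _) (hc _) (hG (Nat.zero_le _)), pr_gap (hc _) (hc _) (hG (Nat.zero_le _)),
        pr_gap (hc _) (hc _) (hG (Nat.le_succ _))]
      abel
    have h2 : inner ℂ (pr (gap (G p) (G 0)) u) (pr (gap (G (p + 1)) (G p)) u) = 0 :=
      (isOrtho_gap le_rfl).symm.inner_eq (pr_mem (isClosed_gap (hc _)) _)
        (pr_mem (isClosed_gap (hc _)) _)
    rw [h1, @norm_add_sq ℂ, h2]
    simp

theorem two_pow_le_of_growth {G : ℕ → Submodule ℂ H} (hG : Antitone G)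
    (hc : ∀ j, IsClosed (G j : Set H)) {n : ℕ} (hn : 1 ≤ n) {a : ℕ → ℕ} (ha0 : a 0 = 1)
    (ha : ∀ i, a (i + 1) = n * a i + 1) {r : ℕ} {A b c : Fin n → H →L[ℂ] H}
    (hA0 : ∀ m u, pr (gap (G 1) (G 0)) (A m u) = 0)
    (hA : ∀ (u : Fin n → H) (m : Fin n) (j : ℕ), n * j + m + 1 < a r →
      ‖pr (gap (G (n * j + m + 1 + 1)) (G (n * j + m + 1))) (∑ m', A m' (u m'))‖ =
        ‖pr (gap (G (j + 1)) (G j)) (u m)‖)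
    (hb : ∀ m j, ∀ x ∈ G j, b m x ∈ G j) (hcG : ∀ m j, ∀ x ∈ G j, c m x ∈ G j)
    (hab : ∀ m, ‖A m - b m‖ ≤ 1 / (4 * n)) (hbc : ∑ m, b m * c m = 1) {x : H}
    (hx : x ∈ gap (G 1) (G 0)) (hx1 : ‖x‖ = 1) {i : ℕ} (hi : i ≤ r) :
    2 ^ (i + 1) ≤ √(∑ m, ‖pr (gap (G (a i)) (G 0)) (c m x)‖ ^ 2) := by
  have hnpos : (0 : ℝ) < n := by exact_mod_cast hn
  have hxsum : ∑ m, b m (c m x) = x := by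
    have := congrArg (fun T : H →L[ℂ] H => T x) hbc
    simpa [sum_apply] using this
  have hamono : Monotone a := monotone_nat_of_le_succ fun k => by
    rw [ha]; nlinarith
  have ha1 : ∀ k, 1 ≤ a k := fun k => by
    rw [← ha0]; exact hamono (Nat.zero_le _)
  have hxmem : ∀ k, x ∈ gap (G (a k)) (G 0) := fun k => gap_mono (hG (ha1 k)) le_rfl hx
  have hkey : ∀ k, x = pr (gap (G (a k)) (G 0))
      (∑ m, b m (pr (gap (G (a k)) (G 0)) (c m x))) := fun k => by
    conv_lhs => rw [← pr_of_mem (hxmem k), ← hxsum]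
    rw [map_sum, map_sum]
    exact Finset.sum_congr rfl fun m _ => pr_gap_apply (hc _) (hc _) (hG (Nat.zero_le _))
      (hb m _) (hcG m 0 _ hx.1)
  have herr : ∀ k, ‖pr (gap (G (a k)) (G 0))
      (∑ m, (A m - b m) (pr (gap (G (a k)) (G 0)) (c m x)))‖ ≤
      √(∑ m, ‖pr (gap (G (a k)) (G 0)) (c m x)‖ ^ 2) / 4 := fun k => by
    set y : Fin n → H := fun m => pr (gap (G (a k)) (G 0)) (c m x)
    have h1 : ‖pr (gap (G (a k)) (G 0)) (∑ m, (A m - b m) (y m))‖ ≤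
        1 / (4 * n) * ∑ m, ‖y m‖ := by
      rw [Finset.mul_sum]
      refine (norm_pr_apply_le _ _).trans ((norm_sum_le _ _).trans
        (Finset.sum_le_sum fun m _ => ?_))
      exact (A m - b m).le_of_opNorm_le (hab m) _
    refine h1.trans ?_
    have h2 : ∑ m, ‖y m‖ ≤ n * √(∑ m, ‖y m‖ ^ 2) := by
      have : ∀ m ∈ Finset.univ, ‖y m‖ ≤ √(∑ m, ‖y m‖ ^ 2) := fun m _ => by
        apply Real.le_sqrt_of_sq_le
        exact Finset.single_le_sum (f := fun m => ‖y m‖ ^ 2) (fun _ _ => by positivity)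
          (Finset.mem_univ m)
      simpa using Finset.sum_le_sum this
    calc 1 / (4 * n) * ∑ m, ‖y m‖ ≤ 1 / (4 * n) * (n * √(∑ m, ‖y m‖ ^ 2)) := by gcongr
      _ = √(∑ m, ‖y m‖ ^ 2) / 4 := by field_simp
  have hsub : ∀ k, pr (gap (G (a k)) (G 0)) (∑ m, A m (pr (gap (G (a k)) (G 0)) (c m x))) =
      x + pr (gap (G (a k)) (G 0))
      (∑ m, (A m - b m) (pr (gap (G (a k)) (G 0)) (c m x))) := fun k => by
    have h1 : ∑ m, (A m - b m) (pr (gap (G (a k)) (G 0)) (c m x)) =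
        ∑ m, A m (pr (gap (G (a k)) (G 0)) (c m x)) -
          ∑ m, b m (pr (gap (G (a k)) (G 0)) (c m x)) := by
      rw [← Finset.sum_sub_distrib]
      rfl
    rw [h1, map_sub, ← hkey k]
    abel
  induction i with
  | zero =>
    have h0 := hsub 0
    have h1 := herr 0
    rw [ha0] at h0 h1 ⊢
    have hz : pr (gap (G 1) (G 0)) (∑ m, A m (pr (gap (G 1) (G 0)) (c m x))) = 0 := by
      rw [map_sum]
      exact Finset.sum_eq_zero fun m _ => hA0 m _
    rw [hz] at h0
    have h2 := eq_neg_of_add_eq_zero_right h0.symm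
    rw [h2, norm_neg, hx1] at h1
    have := Real.sqrt_nonneg (∑ m, ‖pr (gap (G 1) (G 0)) (c m x)‖ ^ 2)
    norm_num
    linarith
  | succ i ih =>
    have hi' := ih (by omega)
    set t := √(∑ m, ‖pr (gap (G (a i)) (G 0)) (c m x)‖ ^ 2) with ht
    have h0 := hsub (i + 1)
    have h1 := herr (i + 1)
    set P := pr (gap (G (a (i + 1))) (G 0)) with hP
    set t' := √(∑ m, ‖P (c m x)‖ ^ 2) with ht'
    set v := P (∑ m, A m (P (c m x))) with hv
    have hPI : ∀ k < a (i + 1), ∀ u, pr (gap (G (k + 1)) (G k)) (P u) =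
        pr (gap (G (k + 1)) (G k)) u := fun k hk u => by
      have hle : gap (G (k + 1)) (G k) ≤ gap (G (a (i + 1))) (G 0) :=
        gap_mono (hG hk) (hG (Nat.zero_le _))
      have := pr_of_orth (Submodule.orthogonal_le hle (sub_pr_mem (gap (G (a (i + 1))) (G 0)) u))
      rw [map_sub, sub_eq_zero] at this
      exact this.symm
    have hle : t ^ 2 ≤ ‖v‖ ^ 2 := by
      rw [ht, Real.sq_sqrt (by positivity)]
      have hpair : ∀ s : Fin n × ℕ, s ∈ (Finset.univ : Finset (Fin n)) ×ˢ Finset.range (a i) →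
          n * s.2 + s.1 + 1 < a (i + 1) := fun s hs => by
        have h2 : s.2 < a i := by simpa using hs
        have h3 := s.1.2
        rw [ha]
        nlinarith
      calc ∑ m, ‖pr (gap (G (a i)) (G 0)) (c m x)‖ ^ 2
          = ∑ m, ∑ j ∈ Finset.range (a i), ‖pr (gap (G (j + 1)) (G j)) (c m x)‖ ^ 2 :=
            Finset.sum_congr rfl fun m _ => norm_pr_gap_zero_sq hG hc _ _
        _ = ∑ s ∈ (Finset.univ : Finset (Fin n)) ×ˢ Finset.range (a i),
              ‖pr (gap (G (s.2 + 1)) (G s.2)) (c s.1 x)‖ ^ 2 := by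
            rw [Finset.sum_product]
        _ = ∑ s ∈ (Finset.univ : Finset (Fin n)) ×ˢ Finset.range (a i),
              ‖pr (gap (G (n * s.2 + s.1 + 1 + 1)) (G (n * s.2 + s.1 + 1))) v‖ ^ 2 := by
            refine Finset.sum_congr rfl fun s hs => ?_
            have hlt := hpair s hs
            rw [hv, hPI _ hlt, hA _ _ _ (hlt.trans_le (hamono hi)), hPI]
            have := s.1.2
            nlinarith
        _ = ∑ k ∈ ((Finset.univ : Finset (Fin n)) ×ˢ Finset.range (a i)).image
              (fun s => n * s.2 + s.1 + 1), ‖pr (gap (G (k + 1)) (G k)) v‖ ^ 2 := by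
            rw [Finset.sum_image]
            intro s _ s' _ hss
            have h2 : n * s.2 + s.1 = n * s'.2 + s'.1 := by simpa using hss
            have h3 : s.2 = s'.2 := by
              have e1 := congrArg (· / n) h2
              simpa [Nat.mul_add_div (by omega : 0 < n), Nat.div_eq_of_lt s.1.2,
                Nat.div_eq_of_lt s'.1.2] using e1
            have h4 : s.1 = s'.1 := by
              rw [h3] at h2
              exact Fin.ext (by omega)
            exact Prod.ext h4 h3
        _ ≤ ‖v‖ ^ 2 := by
            refine sum_norm_pr_sq_le (fun k => isClosed_gap (hc k)) (fun k l hkl => ?_) _ _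
            rcases lt_or_gt_of_ne hkl with h | h
            · exact (isOrtho_gap (hG h)).symm
            · exact isOrtho_gap (hG h)
    have hle' : t ≤ ‖v‖ := by
      rw [sq_le_sq₀ (Real.sqrt_nonneg _) (norm_nonneg _)] at hle
      exact hle
    have hv2 : ‖v‖ ≤ 1 + t' / 4 := by
      rw [h0, ← hx1]
      exact (norm_add_le _ _).trans (by gcongr)
    have h12 : (1 : ℝ) ≤ 2 ^ i := one_le_pow₀ (by norm_num)
    rw [pow_succ] at hi' ⊢
    rw [pow_succ]
    linarith

end LongChains

section LongChainOperators

variable {H : Type*} [NormedAddCommGroup H] [InnerProductSpace ℂ H] [CompleteSpace H]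

theorem pr_hasSum_of_forall {ι : Type*} {f : ι → H} {y : H} (h : HasSum f y) (U : Submodule ℂ H)
    (s : ι) (hU : ∀ t, t ≠ s → pr U (f t) = 0) : pr U y = pr U (f s) :=
  ((pr U).hasSum h).unique (hasSum_single s hU)

theorem pr_hasSum_zero {ι : Type*} {f : ι → H} {y : H} (h : HasSum f y) (U : Submodule ℂ H)
    (hU : ∀ t, pr U (f t) = 0) : pr U y = 0 := by
  have h1 := (pr U).hasSum h
  have h2 : (fun t => pr U (f t)) = fun _ => 0 := funext hU
  rw [h2] at h1
  exact h1.unique hasSum_zero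

theorem exists_blk_isometry [TopologicalSpace.SeparableSpace H] {I J : Submodule ℂ H}
    (hI : IsClosed (I : Set H)) (hJ : IsClosed (J : Set H))
    (h : Module.rank ℂ I ≤ Module.rank ℂ J) :
    ∃ T : H →L[ℂ] H, Blk I J T ∧ ‖T‖ ≤ 1 ∧ ∀ x, ‖T x‖ = ‖pr I x‖ := by
  obtain ⟨f⟩ := exists_isometry_of_submodule_rank_le hI hJ h
  have := hI.completeSpace_coe
  let T : H →L[ℂ] H := J.subtypeL.comp (f.toContinuousLinearMap.comp I.orthogonalProjectionOnto)
  have hT : ∀ x, ‖T x‖ = ‖pr I x‖ := fun x => by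
    have h1 : ‖T x‖ = ‖I.orthogonalProjectionOnto x‖ := f.norm_map _
    rw [h1, pr_eq_of (K := I) (I.orthogonalProjectionOnto x).2
      (Submodule.sub_starProjection_mem_orthogonal x)]
    rfl
  refine ⟨T, ⟨fun x => Subtype.coe_prop _, fun x hx => ?_⟩, ?_, hT⟩
  · rw [← norm_eq_zero, hT, pr_of_orth hx, norm_zero]
  · refine T.opNorm_le_bound zero_le_one fun x => ?_
    rw [hT, one_mul]
    exact norm_pr_apply_le _ _

theorem false_of_blocks [TopologicalSpace.SeparableSpace H]
    {𝒩 : Set (Submodule ℂ H)} (h𝒩 : IsNest 𝒩) {n : ℕ} (hn : 1 ≤ n)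
    (hd : RgDenseIn (nestAlg 𝒩) n) {a : ℕ → ℕ} (ha0 : a 0 = 1)
    (ha : ∀ i, a (i + 1) = n * a i + 1) {G : ℕ → ℕ → Submodule ℂ H} (hG : ∀ r, Antitone (G r))
    (hmem : ∀ r j, G r j ∈ 𝒩)
    (hrank : ∀ r j k, j ≤ k → k < a r → Module.rank ℂ ↥(gap (G r (j + 1)) (G r j)) ≤
      Module.rank ℂ ↥(gap (G r (k + 1)) (G r k)))
    (hne : ∀ r, G r 1 < G r 0)
    (hdisj : ∀ r r', r ≠ r' → (∀ j, G r 0 ≤ G r' j) ∨ ∀ j, G r' 0 ≤ G r j) : False := by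
  classical
  have hcl : ∀ r j, IsClosed (G r j : Set H) := fun r j => h𝒩.closed _ (hmem r j)
  have hIc : ∀ r j, IsClosed ((gap (G r (j + 1)) (G r j) : Submodule ℂ H) : Set H) :=
    fun r j => isClosed_gap (hcl r j)
  have hIo : ∀ r j r' j', (r, j) ≠ (r', j') →
      gap (G r (j + 1)) (G r j) ⟂ gap (G r' (j' + 1)) (G r' j') := by
    intro r j r' j' hne
    by_cases hr : r = r'
    · subst hr
      have hj : j ≠ j' := fun h => hne (by rw [h])
      rcases lt_or_gt_of_ne hj with h | h
      · exact (isOrtho_gap (hG r h)).symm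
      · exact isOrtho_gap (hG r h)
    · rcases hdisj r r' hr with h | h
      · exact isOrtho_gap ((hG r (Nat.zero_le _)).trans (h _))
      · exact (isOrtho_gap ((hG r' (Nat.zero_le _)).trans (h _))).symm
  have hV : ∀ r j k : ℕ, ∃ T : H →L[ℂ] H,
      Blk (gap (G r (j + 1)) (G r j)) (gap (G r (k + 1)) (G r k)) T ∧ ‖T‖ ≤ 1 ∧
      (j ≤ k → k < a r → ∀ x, ‖T x‖ = ‖pr (gap (G r (j + 1)) (G r j)) x‖) := by
    intro r j k
    by_cases h : j ≤ k ∧ k < a r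
    · obtain ⟨T, h1, h2, h3⟩ := exists_blk_isometry (hIc r j) (hIc r k) (hrank r j k h.1 h.2)
      exact ⟨T, h1, h2, fun _ _ => h3⟩
    · exact ⟨0, Blk.zero _ _, by simp, fun h1 h2 => absurd ⟨h1, h2⟩ h⟩
  choose V hVb hVn hVi using hV
  have hidx : ∀ (m m' : Fin n) (j j' : ℕ), n * j + m + 1 = n * j' + m' + 1 → j = j' ∧ m = m' := by
    intro m m' j j' h
    have h2 : n * j + m = n * j' + m' := by simpa using h
    have h3 : j = j' := by
      have e1 := congrArg (· / n) h2
      simpa [Nat.mul_add_div (by omega : 0 < n), Nat.div_eq_of_lt m.2,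
        Nat.div_eq_of_lt m'.2] using e1
    refine ⟨h3, ?_⟩
    rw [h3] at h2
    exact Fin.ext (by omega)
  have hA : ∀ m : Fin n, ∃ A : H →L[ℂ] H,
      (∀ x, HasSum (fun s : ℕ × ℕ => V s.1 s.2 (n * s.2 + m + 1) x) (A x)) ∧ ‖A‖ ≤ 1 := by
    intro m
    refine exists_strongSum (V := fun s : ℕ × ℕ => gap (G s.1 (s.2 + 1)) (G s.1 s.2))
      (W := fun s : ℕ × ℕ => gap (G s.1 (n * s.2 + m + 1 + 1)) (G s.1 (n * s.2 + m + 1)))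
      (fun s => hIc _ _) (fun s t hst => hIo _ _ _ _ hst) (fun s t hst => hIo _ _ _ _ ?_) _
      zero_le_one (fun s => hVb _ _ _) (fun s => hVn _ _ _)
    intro h
    rw [Prod.mk.injEq] at h
    exact hst (Prod.ext h.1 (hidx m m _ _ h.2).1)
  choose A hAs _ using hA
  have hAalg : ∀ m, A m ∈ nestAlg 𝒩 := by
    intro m L hL x hx
    refine (h𝒩.closed L hL).mem_of_tendsto (hAs m x)
      (Filter.Eventually.of_forall fun F => L.sum_mem fun s _ => ?_)
    rcases h𝒩.chain.total hL (hmem s.1 (s.2 + 1)) with h | h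
    · rw [(hVb s.1 s.2 _).2 x]
      · exact L.zero_mem
      · exact Submodule.orthogonal_le inf_le_right
          (Submodule.le_orthogonal_orthogonal _ (h hx))
    · refine h (hG s.1 ?_ ((hVb s.1 s.2 (n * s.2 + m + 1)).1 x).1)
      nlinarith
  have hnpos : (0 : ℝ) < n := by exact_mod_cast hn
  obtain ⟨b, c, hb, hc, hab, hbc⟩ := hd A hAalg (1 / (4 * n)) (by positivity)
  obtain ⟨r, hr⟩ := pow_unbounded_of_one_lt (∑ m, ‖c m‖) (one_lt_two (α := ℝ))
  obtain ⟨x, hx, hx1⟩ : ∃ x ∈ gap (G r 1) (G r 0), ‖x‖ = 1 := by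
    have hne' : gap (G r 1) (G r 0) ≠ ⊥ := by
      intro h
      refine (hne r).not_ge fun z hz => ?_
      have h1 : pr (gap (G r 1) (G r 0)) z = 0 :=
        (Submodule.mem_bot ℂ).1 (h.le (pr_mem (isClosed_gap (L := G r 1) (hcl r 0)) z))
      rw [pr_gap (hcl r 1) (hcl r 0) (hne r).le, pr_of_mem hz, sub_eq_zero] at h1
      rw [h1]
      exact pr_mem (hcl r 1) z
    obtain ⟨z, hz, hz0⟩ := Submodule.exists_mem_ne_zero_of_ne_bot hne'
    refine ⟨((‖z‖⁻¹ : ℝ) : ℂ) • z, Submodule.smul_mem _ _ hz, ?_⟩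
    rw [norm_smul, Complex.norm_real, norm_inv, norm_norm,
      inv_mul_cancel₀ (norm_ne_zero_iff.2 hz0)]
  have hgrow := two_pow_le_of_growth (hG r) (hcl r) hn ha0 ha (r := r) (A := A) (b := b) (c := c)
    (fun m u => ?_) (fun u m j hj => ?_) (fun m j => hb m _ (hmem r j))
    (fun m j => hc m _ (hmem r j)) (fun m => (hab m).le) hbc hx hx1 le_rfl
  · have h1 : √(∑ m, ‖pr (gap (G r (a r)) (G r 0)) (c m x)‖ ^ 2) ≤ ∑ m, ‖c m‖ := by
      refine Real.sqrt_le_iff.2 ⟨Finset.sum_nonneg fun _ _ => norm_nonneg _, ?_⟩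
      refine le_trans ?_ (Finset.sum_sq_le_sq_sum_of_nonneg fun m _ => norm_nonneg (c m))
      refine Finset.sum_le_sum fun m _ => pow_le_pow_left₀ (norm_nonneg _) ?_ 2
      refine (norm_pr_apply_le _ _).trans ((c m).le_opNorm_of_le hx1.le |>.trans ?_)
      rw [mul_one]
    have h2 : (2 : ℝ) ^ r ≤ 2 ^ (r + 1) := pow_le_pow_right₀ (by norm_num) (Nat.le_succ r)
    linarith
  · refine pr_hasSum_zero (hAs m u) _ fun s => pr_of_orth ?_
    refine (hIo _ _ r 0 ?_).le ((hVb s.1 s.2 _).1 u)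
    intro h
    rw [Prod.mk.injEq] at h
    omega
  · rw [map_sum, Finset.sum_eq_single m]
    · rw [pr_hasSum_of_forall (hAs m (u m)) _ (r, j)]
      · rw [pr_of_mem ((hVb _ _ _).1 _)]
        refine hVi _ _ _ (by nlinarith) hj _
      · intro t ht
        refine pr_of_orth ((hIo _ _ r (n * j + m + 1) ?_).le ((hVb t.1 t.2 _).1 _))
        intro h
        rw [Prod.mk.injEq] at h
        exact ht (Prod.ext h.1 (hidx m m _ _ h.2).1)
    · intro m' _ hm'
      refine pr_hasSum_zero (hAs m' (u m')) _ fun t => pr_of_orth ?_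
      refine (hIo _ _ r (n * j + m + 1) ?_).le ((hVb t.1 t.2 _).1 _)
      intro h
      rw [Prod.mk.injEq] at h
      exact hm' (hidx m' m _ _ h.2).2
    · intro h
      exact absurd (Finset.mem_univ m) h

end LongChainOperators

section BoundedChains

variable {H : Type*} [NormedAddCommGroup H] [InnerProductSpace ℂ H] [CompleteSpace H]

/-- A chain of length `q` in `𝒩` whose gaps have decreasing dimensions. -/
def DChain (𝒩 : Set (Submodule ℂ H)) (q : ℕ) (Nc : ℕ → Submodule ℂ H) : Prop :=
  (∀ j ≤ q, Nc j ∈ 𝒩) ∧ (∀ j < q, Nc j < Nc (j + 1)) ∧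
    ∀ j, 1 ≤ j → j + 1 ≤ q →
      Module.rank ℂ ↥(gap (Nc j) (Nc (j + 1))) ≤ Module.rank ℂ ↥(gap (Nc (j - 1)) (Nc j))

theorem DChain.shift {𝒩 : Set (Submodule ℂ H)} {q : ℕ} {Nc : ℕ → Submodule ℂ H}
    (h : DChain 𝒩 q Nc) {p s : ℕ} (hps : s + p ≤ q) : DChain 𝒩 p fun j => Nc (s + j) := by
  refine ⟨fun j hj => h.1 _ (by omega), fun j hj => h.2.1 _ (by omega), fun j hj hjp => ?_⟩
  have := h.2.2 (s + j) (by omega) (by omega)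
  rwa [Nat.add_sub_assoc hj] at this

theorem DChain.trunc {𝒩 : Set (Submodule ℂ H)} {q : ℕ} {Nc : ℕ → Submodule ℂ H}
    (h : DChain 𝒩 q Nc) {p : ℕ} (hp : p ≤ q) : DChain 𝒩 p Nc :=
  ⟨fun j hj => h.1 _ (by omega), fun j hj => h.2.1 _ (by omega),
    fun j hj hjp => h.2.2 _ hj (by omega)⟩

theorem DChain.le {𝒩 : Set (Submodule ℂ H)} {q : ℕ} {Nc : ℕ → Submodule ℂ H}
    (h : DChain 𝒩 q Nc) {i j : ℕ} (hij : i ≤ j) (hj : j ≤ q) : Nc i ≤ Nc j := by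
  induction j, hij using Nat.le_induction with
  | base => exact le_rfl
  | succ j hij ih => exact (ih (by omega)).trans (h.2.1 j (by omega)).le

theorem DChain.rank_le {𝒩 : Set (Submodule ℂ H)} {q : ℕ} {Nc : ℕ → Submodule ℂ H}
    (h : DChain 𝒩 q Nc) {i j : ℕ} (hij : i ≤ j) (hj : j < q) :
    Module.rank ℂ ↥(gap (Nc j) (Nc (j + 1))) ≤ Module.rank ℂ ↥(gap (Nc i) (Nc (i + 1))) := by
  induction j, hij using Nat.le_induction with
  | base => exact le_rfl
  | succ j hij ih => exact (h.2.2 (j + 1) (by omega) (by omega)).trans (ih (by omega))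

/-- The interval between `M` and `N` contains arbitrarily long chains with decreasing gaps. -/
def Bad (𝒩 : Set (Submodule ℂ H)) (M N : Submodule ℂ H) : Prop :=
  ∀ Q, ∃ q Nc, Q ≤ q ∧ DChain 𝒩 q Nc ∧ M ≤ Nc 0 ∧ Nc q ≤ N

theorem Bad.split {𝒩 : Set (Submodule ℂ H)} (h𝒩 : IsNest 𝒩) {M N L : Submodule ℂ H}
    (h : Bad 𝒩 M N) (hL : L ∈ 𝒩) : Bad 𝒩 M L ∨ Bad 𝒩 L N := by
  by_contra! hcon
  obtain ⟨h1, h2⟩ := hcon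
  unfold Bad at h1 h2
  push Not at h1 h2
  obtain ⟨Q1, h1⟩ := h1
  obtain ⟨Q2, h2⟩ := h2
  obtain ⟨q, Nc, hq, hc, hM, hN⟩ := h (Q1 + Q2)
  rcases h𝒩.chain.total hL (hc.1 Q1 (by omega)) with h | h
  · refine h2 (q - Q1) (fun j => Nc (Q1 + j)) (by omega) (hc.shift (by omega)) h ?_
    rwa [Nat.add_sub_cancel' (by omega)]
  · exact h1 Q1 Nc le_rfl (hc.trunc (by omega)) hM h

theorem exists_disjoint_chains {𝒩 : Set (Submodule ℂ H)} (h𝒩 : IsNest 𝒩)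
    (hbad : Bad 𝒩 ⊥ ⊤) (a : ℕ → ℕ) :
    ∃ Nc : ℕ → ℕ → Submodule ℂ H, (∀ r, DChain 𝒩 (a r) (Nc r)) ∧
      ∀ r r', r < r' → Nc r' (a r') ≤ Nc r 0 ∨ Nc r (a r) ≤ Nc r' 0 := by
  have step : ∀ (p : ℕ) (s : {s : Submodule ℂ H × Submodule ℂ H // Bad 𝒩 s.1 s.2}),
      ∃ (s' : {s : Submodule ℂ H × Submodule ℂ H // Bad 𝒩 s.1 s.2}) (Nc : ℕ → Submodule ℂ H),
        DChain 𝒩 p Nc ∧ s.1.1 ≤ Nc 0 ∧ Nc p ≤ s.1.2 ∧ s.1.1 ≤ s'.1.1 ∧ s'.1.2 ≤ s.1.2 ∧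
          (s'.1.2 ≤ Nc 0 ∨ Nc p ≤ s'.1.1) := by
    intro p s
    obtain ⟨q, Nc, hq, hc, hM, hN⟩ := s.2 (p + p)
    rcases s.2.split h𝒩 (hc.1 p (by omega)) with h | h
    · exact ⟨⟨(s.1.1, Nc p), h⟩, fun j => Nc (p + j), hc.shift (by omega),
        hM.trans (hc.le (by omega) (by omega)), (hc.le hq le_rfl).trans hN, le_rfl,
        (hc.le (by omega) le_rfl).trans hN, Or.inl le_rfl⟩
    · exact ⟨⟨(Nc p, s.1.2), h⟩, Nc, hc.trunc (by omega), hM,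
        (hc.le (by omega) le_rfl).trans hN, hM.trans (hc.le (by omega) (by omega)), le_rfl,
        Or.inr le_rfl⟩
  choose f Nc h1 h2 h3 h4 h5 h6 using step
  let st : ℕ → {s : Submodule ℂ H × Submodule ℂ H // Bad 𝒩 s.1 s.2} := fun r =>
    Nat.rec ⟨(⊥, ⊤), hbad⟩ (fun k s => f (a k) s) r
  have hst : ∀ r, st (r + 1) = f (a r) (st r) := fun r => rfl
  have hmono1 : Monotone fun r => (st r).1.1 := monotone_nat_of_le_succ fun r => by
    rw [hst]; exact h4 _ _
  have hmono2 : Antitone fun r => (st r).1.2 := antitone_nat_of_succ_le fun r => by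
    rw [hst]; exact h5 _ _
  refine ⟨fun r => Nc (a r) (st r), fun r => h1 _ _, fun r r' hrr => ?_⟩
  rcases h6 (a r) (st r) with h | h
  · exact Or.inl ((h3 _ _).trans ((hmono2 (Nat.succ_le_of_lt hrr)).trans h))
  · exact Or.inr (h.trans ((hmono1 (Nat.succ_le_of_lt hrr)).trans (h2 _ _)))

theorem exists_chain_bound [TopologicalSpace.SeparableSpace H]
    {𝒩 : Set (Submodule ℂ H)} (h𝒩 : IsNest 𝒩) {n : ℕ} (hn : 1 ≤ n)
    (hd : RgDenseIn (nestAlg 𝒩) n) : ∃ Q : ℕ, ∀ q Nc, DChain 𝒩 q Nc → q ≤ Q := by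
  by_contra! hcon
  have hbad : Bad 𝒩 ⊥ ⊤ := fun Q => by
    obtain ⟨q, Nc, h1, h2⟩ := hcon Q
    exact ⟨q, Nc, h2.le, h1, bot_le, le_top⟩
  let a : ℕ → ℕ := fun i => Nat.rec 1 (fun _ k => n * k + 1) i
  have ha0 : a 0 = 1 := rfl
  have ha : ∀ i, a (i + 1) = n * a i + 1 := fun i => rfl
  have hapos : ∀ i, 1 ≤ a i := fun i => by
    cases i with
    | zero => exact ha0.ge
    | succ i => rw [ha]; exact Nat.le_add_left _ _
  obtain ⟨Nc, hch, hdis⟩ := exists_disjoint_chains h𝒩 hbad a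
  refine false_of_blocks h𝒩 hn hd ha0 ha (G := fun r j => Nc r (a r - j)) (fun r i j hij => ?_)
    (fun r j => (hch r).1 _ (by omega)) (fun r j k hjk hk => ?_) (fun r => ?_)
    (fun r r' hrr => ?_)
  · exact (hch r).le (by omega) (by omega)
  · have := (hch r).rank_le (i := a r - (k + 1)) (j := a r - (j + 1)) (by omega) (by omega)
    rwa [show a r - (k + 1) + 1 = a r - k by omega,
      show a r - (j + 1) + 1 = a r - j by omega] at this
  · have := (hch r).2.1 (a r - 1) (by have := hapos r; omega)
    rwa [Nat.sub_add_cancel (hapos r)] at this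
  · rcases lt_or_gt_of_ne hrr with h | h
    · rcases hdis r r' h with h | h
      · exact Or.inr fun j => h.trans ((hch r).le (Nat.zero_le _) (by omega))
      · exact Or.inl fun j => h.trans ((hch r').le (Nat.zero_le _) (by omega))
    · rcases hdis r' r h with h | h
      · exact Or.inl fun j => h.trans ((hch r').le (Nat.zero_le _) (by omega))
      · exact Or.inr fun j => h.trans ((hch r).le (Nat.zero_le _) (by omega))

end BoundedChains

section Gaps

variable {H : Type*} [NormedAddCommGroup H] [InnerProductSpace ℂ H] [CompleteSpace H]

theorem le_of_gap_eq_bot {L K : Submodule ℂ H} (hL : IsClosed (L : Set H))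
    (hK : IsClosed (K : Set H)) (hLK : L ≤ K) (h : gap L K = ⊥) : K ≤ L := fun z hz => by
  have h1 : pr (gap L K) z = 0 :=
    (Submodule.mem_bot ℂ).1 (h.le (pr_mem (isClosed_gap hK) z))
  rw [pr_gap hL hK hLK, pr_of_mem hz, sub_eq_zero] at h1
  rw [h1]
  exact pr_mem hL z

theorem gap_orthogonal_inf {A B C : Submodule ℂ H} (hA : IsClosed (A : Set H))
    (hAB : A ≤ B) : (gap A B)ᗮ ⊓ gap A C = gap B C := by
  apply le_antisymm
  · rintro x ⟨hx1, hx2, hx3⟩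
    refine ⟨hx2, (Submodule.mem_orthogonal _ _).2 fun b hb => ?_⟩
    have h1 : inner ℂ (pr A b) x = 0 := (Submodule.mem_orthogonal _ _).1 hx3 _ (pr_mem hA b)
    have h2 : inner ℂ (b - pr A b) x = 0 := (Submodule.mem_orthogonal _ _).1 hx1 _
      ⟨B.sub_mem hb (hAB (pr_mem hA b)), sub_pr_mem A b⟩
    rw [inner_sub_left, h1, sub_zero] at h2
    exact h2
  · exact le_inf (isOrtho_gap le_rfl).symm.le (gap_mono hAB le_rfl)

theorem finrank_gap_add {A B C : Submodule ℂ H} (hA : IsClosed (A : Set H))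
    (hAB : A ≤ B) (hBC : B ≤ C) [FiniteDimensional ℂ ↥(gap A C)] :
    Module.finrank ℂ ↥(gap A B) + Module.finrank ℂ ↥(gap B C) = Module.finrank ℂ ↥(gap A C) := by
  rw [← gap_orthogonal_inf hA hAB]
  exact Submodule.finrank_add_inf_finrank_orthogonal (gap_mono le_rfl hBC)

theorem finiteDimensional_gap_of_le {A B C D : Submodule ℂ H} (h : C ≤ A) (h' : B ≤ D)
    [FiniteDimensional ℂ ↥(gap C D)] : FiniteDimensional ℂ ↥(gap A B) :=
  Submodule.finiteDimensional_of_le (gap_mono h h')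

theorem gap_le_sup {A B C : Submodule ℂ H} (hA : IsClosed (A : Set H))
    (hB : IsClosed (B : Set H)) (hC : IsClosed (C : Set H)) (hAB : A ≤ B) (hBC : B ≤ C) :
    gap A C ≤ gap A B ⊔ gap B C := fun x hx => by
  have h1 : x = pr (gap A B) x + pr (gap B C) x := by
    have h2 : pr A x = 0 := pr_of_orth hx.2
    rw [pr_gap hA hB hAB, pr_gap hB hC hBC, pr_of_mem hx.1, h2]
    abel
  rw [h1]
  exact Submodule.add_mem_sup (pr_mem (isClosed_gap hB) _) (pr_mem (isClosed_gap hC) _)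

theorem finiteDimensional_gap_trans {A B C : Submodule ℂ H} (hA : IsClosed (A : Set H))
    (hB : IsClosed (B : Set H)) (hC : IsClosed (C : Set H)) (hAB : A ≤ B) (hBC : B ≤ C)
    [FiniteDimensional ℂ ↥(gap A B)] [FiniteDimensional ℂ ↥(gap B C)] :
    FiniteDimensional ℂ ↥(gap A C) :=
  Submodule.finiteDimensional_of_le (gap_le_sup hA hB hC hAB hBC)

end Gaps

section Pieces

variable {H : Type*} [NormedAddCommGroup H] [InnerProductSpace ℂ H] [CompleteSpace H]
  {𝒩 : Set (Submodule ℂ H)}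

theorem eq_of_finrank_gap_le (h𝒩 : IsNest 𝒩) {M N N' : Submodule ℂ H} (hM : M ∈ 𝒩) (hN : N ∈ 𝒩)
    (hN' : N' ∈ 𝒩) (hMN : M ≤ N) (hNN : N ≤ N') [FiniteDimensional ℂ ↥(gap M N')]
    (h : Module.finrank ℂ ↥(gap M N') ≤ Module.finrank ℂ ↥(gap M N)) : N' ≤ N := by
  refine le_of_gap_eq_bot (h𝒩.closed _ hN) (h𝒩.closed _ hN') hNN ?_
  have h1 := finrank_gap_add (h𝒩.closed _ hM) hMN hNN
  have : FiniteDimensional ℂ ↥(gap N N') := finiteDimensional_gap_of_le hMN le_rfl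
  exact Submodule.finrank_eq_zero.1 (by omega)

theorem exists_piece (h𝒩 : IsNest 𝒩) {M : Submodule ℂ H} (hM : M ∈ 𝒩) :
    ∃ F : ℕ → Submodule ℂ H, Monotone F ∧ F 0 = M ∧ (∀ k, F k ∈ 𝒩) ∧
      (∀ k, FiniteDimensional ℂ ↥(gap M (F k))) ∧
      (∀ L ∈ 𝒩, M ≤ L → FiniteDimensional ℂ ↥(gap M L) → ∃ k, L = F k) ∧
      ∀ L ∈ 𝒩, M ≤ L → (∃ k, L = F k) ∨ ∀ k, F k ≤ L := by
  have hex : ∀ k : ℕ, ∃ N ∈ 𝒩, (M ≤ N ∧ FiniteDimensional ℂ ↥(gap M N) ∧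
      Module.finrank ℂ ↥(gap M N) ≤ k) ∧ ∀ N' ∈ 𝒩, M ≤ N' → FiniteDimensional ℂ ↥(gap M N') →
        Module.finrank ℂ ↥(gap M N') ≤ k → N' ≤ N := by
    intro k
    have hMM : gap M M = ⊥ := Submodule.inf_orthogonal_eq_bot M
    let S : Set ℕ := {d | d ≤ k ∧ ∃ N ∈ 𝒩, M ≤ N ∧ FiniteDimensional ℂ ↥(gap M N) ∧
      Module.finrank ℂ ↥(gap M N) = d}
    have hS0 : S.Nonempty := ⟨0, Nat.zero_le _, M, hM, le_rfl, by rw [hMM]; infer_instance,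
      by rw [hMM]; exact finrank_bot ℂ H⟩
    have hSb : BddAbove S := ⟨k, fun d hd => hd.1⟩
    obtain ⟨hk, N, hN, hMN, hfin, hdim⟩ := Nat.sSup_mem hS0 hSb
    refine ⟨N, hN, ⟨hMN, hfin, hdim.trans_le hk⟩, fun N' hN' hMN' hfin' hk' => ?_⟩
    rcases h𝒩.chain.total hN' hN with h | h
    · exact h
    · refine eq_of_finrank_gap_le h𝒩 hM hN hN' hMN h ?_
      rw [hdim]
      exact le_csSup hSb ⟨hk', N', hN', hMN', hfin', rfl⟩
  choose F hF hF' hmax using hex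
  have hsurj : ∀ L ∈ 𝒩, M ≤ L → FiniteDimensional ℂ ↥(gap M L) → ∃ k, L = F k := by
    intro L hL hML hfin
    refine ⟨Module.finrank ℂ ↥(gap M L), le_antisymm (hmax _ L hL hML hfin le_rfl) ?_⟩
    have := (hF' (Module.finrank ℂ ↥(gap M L))).2.1
    exact eq_of_finrank_gap_le h𝒩 hM hL (hF _) hML (hmax _ L hL hML hfin le_rfl)
      (hF' _).2.2
  refine ⟨F, fun i j hij => hmax j _ (hF i) (hF' i).1 (hF' i).2.1 ((hF' i).2.2.trans hij), ?_,
    hF, fun k => (hF' k).2.1, hsurj, fun L hL hML => ?_⟩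
  · refine le_antisymm ?_ (hF' 0).1
    have := (hF' 0).2.1
    exact le_of_gap_eq_bot (h𝒩.closed _ hM) (h𝒩.closed _ (hF 0)) (hF' 0).1
      (Submodule.finrank_eq_zero.1 (Nat.le_zero.1 (hF' 0).2.2))
  · by_cases hfin : FiniteDimensional ℂ ↥(gap M L)
    · exact Or.inl (hsurj L hL hML hfin)
    · refine Or.inr fun k => ?_
      rcases h𝒩.chain.total hL (hF k) with h | h
      · have := (hF' k).2.1
        exact absurd (finiteDimensional_gap_of_le le_rfl h) hfin
      · exact h

theorem false_of_descending {Q : ℕ} (hQ : ∀ q Nc, DChain 𝒩 q Nc → q ≤ Q)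
    (σ : Set (Submodule ℂ H × Submodule ℂ H)) (hne : σ.Nonempty)
    (hσ : ∀ p ∈ σ, p.1 ∈ 𝒩 ∧ p.2 ∈ 𝒩 ∧ p.1 < p.2)
    (hstep : ∀ p ∈ σ, ∃ p' ∈ σ, p'.2 = p.1 ∧
      Module.rank ℂ ↥(gap p.1 p.2) ≤ Module.rank ℂ ↥(gap p'.1 p'.2)) : False := by
  have hstep' : ∀ p : σ, ∃ p' : σ, p'.1.2 = p.1.1 ∧
      Module.rank ℂ ↥(gap p.1.1 p.1.2) ≤ Module.rank ℂ ↥(gap p'.1.1 p'.1.2) := fun p => by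
    obtain ⟨p', h, h'⟩ := hstep p.1 p.2
    exact ⟨⟨p', h⟩, h'⟩
  choose f hf1 hf2 using hstep'
  obtain ⟨p0, hp0⟩ := hne
  let st : ℕ → σ := fun i => Nat.rec ⟨p0, hp0⟩ (fun _ p => f p) i
  have hst : ∀ i, st (i + 1) = f (st i) := fun i => rfl
  have := hQ (Q + 1) (fun j => (st (Q + 1 - j)).1.2) ⟨fun j _ => (hσ _ (st _).2).2.1,
    fun j hj => ?_, fun j hj hjq => ?_⟩
  · omega
  · have h1 : Q + 1 - j = Q + 1 - (j + 1) + 1 := by omega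
    beta_reduce
    rw [h1, hst, hf1]
    exact (hσ _ (st _).2).2.2
  · have h1 : Q + 1 - j = Q + 1 - (j + 1) + 1 := by omega
    have h2 : Q + 1 - (j - 1) = Q + 1 - (j + 1) + 1 + 1 := by omega
    beta_reduce
    rw [h1, h2]
    generalize Q + 1 - (j + 1) = n
    have h3 : Module.rank ℂ ↥(gap (st n).1.1 (st n).1.2) ≤
      Module.rank ℂ ↥(gap (st (n + 1)).1.1 (st (n + 1)).1.2) := hf2 (st n)
    have h4 : (st (n + 1)).1.2 = (st n).1.1 := hf1 (st n)
    have h5 : (st (n + 1 + 1)).1.2 = (st (n + 1)).1.1 := hf1 (st (n + 1))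
    rw [h5, h4]
    rw [h4] at h3
    exact h3

theorem exists_finite_above [TopologicalSpace.SeparableSpace H] (h𝒩 : IsNest 𝒩) {Q : ℕ}
    (hQ : ∀ q Nc, DChain 𝒩 q Nc → q ≤ Q)
    (hatom : ∀ M ∈ 𝒩, ∀ N ∈ 𝒩, M < N → (∀ L ∈ 𝒩, ¬(M < L ∧ L < N)) →
      FiniteDimensional ℂ ↥(gap M N)) {M : Submodule ℂ H} (hM : M ∈ 𝒩) (hMt : M ≠ ⊤) :
    ∃ N ∈ 𝒩, M < N ∧ FiniteDimensional ℂ ↥(gap M N) := by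
  by_contra! hcon
  have hbetween : ∀ N ∈ 𝒩, M < N → ∃ L ∈ 𝒩, M < L ∧ L < N := by
    intro N hN hMN
    by_contra! h
    exact hcon N hN hMN (hatom M hM N hN hMN fun L hL hh => h L hL hh.1 hh.2)
  have hlarge : ∀ N ∈ 𝒩, M < N → ∀ d : ℕ, ∃ L ∈ 𝒩, M < L ∧ L < N ∧
      (FiniteDimensional ℂ ↥(gap L N) → d ≤ Module.finrank ℂ ↥(gap L N)) := by
    intro N hN hMN d
    induction d with
    | zero =>
      obtain ⟨L, hL, h1, h2⟩ := hbetween N hN hMN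
      exact ⟨L, hL, h1, h2, fun _ => Nat.zero_le _⟩
    | succ d ih =>
      obtain ⟨L, hL, h1, h2, h3⟩ := ih
      obtain ⟨L', hL', h1', h2'⟩ := hbetween L hL h1
      refine ⟨L', hL', h1', h2'.trans h2, fun hfin => ?_⟩
      have hf := finrank_gap_add (h𝒩.closed _ hL') h2'.le h2.le
      have h4 := h3 (finiteDimensional_gap_of_le h2'.le le_rfl)
      have : FiniteDimensional ℂ ↥(gap L' L) := finiteDimensional_gap_of_le le_rfl h2.le
      have h5 : Module.finrank ℂ ↥(gap L' L) ≠ 0 := fun h0 => h2'.not_ge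
        (le_of_gap_eq_bot (h𝒩.closed _ hL') (h𝒩.closed _ hL) h2'.le
          (Submodule.finrank_eq_zero.1 h0))
      omega
  by_cases htame : ∃ N ∈ 𝒩, M < N ∧ ∀ L ∈ 𝒩, M < L → L < N → FiniteDimensional ℂ ↥(gap L N)
  · obtain ⟨N, hN, hMN, ht⟩ := htame
    refine false_of_descending hQ
      {p | p.1 ∈ 𝒩 ∧ p.2 ∈ 𝒩 ∧ M < p.1 ∧ p.1 < p.2 ∧ p.2 ≤ N} ?_
      (fun p hp => ⟨hp.1, hp.2.1, hp.2.2.2.1⟩) ?_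
    · obtain ⟨L, hL, h1, h2⟩ := hbetween N hN hMN
      exact ⟨(L, N), hL, hN, h1, h2, le_rfl⟩
    · rintro ⟨A, B⟩ ⟨hA, hB, h1, h2, h3⟩
      obtain ⟨L, hL, h4, h5, h6⟩ := hlarge A hA h1 (Module.finrank ℂ ↥(gap A B))
      refine ⟨(L, A), ⟨hL, hA, h4, h5, h2.le.trans h3⟩, rfl, ?_⟩
      have := ht L hL h4 (h5.trans (h2.trans_le h3))
      have hLA : FiniteDimensional ℂ ↥(gap L A) :=
        finiteDimensional_gap_of_le le_rfl (h2.le.trans h3)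
      have : FiniteDimensional ℂ ↥(gap A B) := finiteDimensional_gap_of_le h5.le h3
      rw [← Module.finrank_eq_rank, ← Module.finrank_eq_rank]
      exact_mod_cast h6 hLA
  · push Not at htame
    refine false_of_descending hQ {p | p.1 ∈ 𝒩 ∧ p.2 ∈ 𝒩 ∧ M < p.1 ∧ p.1 < p.2} ?_
      (fun p hp => ⟨hp.1, hp.2.1, hp.2.2.2⟩) ?_
    · obtain ⟨L, hL, h1, h2⟩ := hbetween ⊤ h𝒩.top_mem (lt_top_iff_ne_top.2 hMt)
      exact ⟨(L, ⊤), hL, h𝒩.top_mem, h1, h2⟩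
    · rintro ⟨A, B⟩ ⟨hA, hB, h1, h2⟩
      obtain ⟨L, hL, h4, h5, h6⟩ := htame A hA h1
      exact ⟨(L, A), ⟨hL, hA, h4, h5⟩, rfl,
        rank_le_of_infinite (isClosed_gap (h𝒩.closed _ hB)) (isClosed_gap (h𝒩.closed _ hA)) h6⟩

theorem exists_pieces [TopologicalSpace.SeparableSpace H] (h𝒩 : IsNest 𝒩) {Q : ℕ}
    (hQ : ∀ q Nc, DChain 𝒩 q Nc → q ≤ Q)
    (hatom : ∀ M ∈ 𝒩, ∀ N ∈ 𝒩, M < N → (∀ L ∈ 𝒩, ¬(M < L ∧ L < N)) →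
      FiniteDimensional ℂ ↥(gap M N)) :
    ∃ (p : ℕ) (F : ℕ → ℕ → Submodule ℂ H), F 0 0 = ⊥ ∧ F (p + 1) 0 = ⊤ ∧
      (∀ i, Monotone (F i)) ∧ (∀ i k, F i k ∈ 𝒩) ∧
      (∀ i k, FiniteDimensional ℂ ↥(gap (F i 0) (F i k))) ∧
      (∀ i, F (i + 1) 0 = (⨆ k, F i k).topologicalClosure) ∧
      (∀ i, ∀ L ∈ 𝒩, F i 0 ≤ L → (∃ k, L = F i k) ∨ ∀ k, F i k ≤ L) ∧
      (∀ i, ¬ FiniteDimensional ℂ ↥(gap (F i 0) (F (i + 1) 0)) ∨ F (i + 1) 0 = ⊤) := by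
  have hp : ∀ M : 𝒩, ∃ F : ℕ → Submodule ℂ H, Monotone F ∧ F 0 = M ∧ (∀ k, F k ∈ 𝒩) ∧
      (∀ k, FiniteDimensional ℂ ↥(gap M.1 (F k))) ∧
      (∀ L ∈ 𝒩, M ≤ L → FiniteDimensional ℂ ↥(gap M.1 L) → ∃ k, L = F k) ∧
      ∀ L ∈ 𝒩, M ≤ L → (∃ k, L = F k) ∨ ∀ k, F k ≤ L := fun M => exists_piece h𝒩 M.2
  choose P hP1 hP2 hP3 hP4 hP5 hP6 using hp
  have hnext : ∀ M : 𝒩, (⨆ k, P M k).topologicalClosure ∈ 𝒩 := fun M =>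
    h𝒩.closure_sSup_mem _ (Set.range_subset_iff.2 (hP3 M)) (Set.range_nonempty _)
  let st : ℕ → 𝒩 := fun i => Nat.rec ⟨⊥, h𝒩.bot_mem⟩ (fun _ M => ⟨_, hnext M⟩) i
  have hst : ∀ i, (st (i + 1)).1 = (⨆ k, P (st i) k).topologicalClosure := fun i => rfl
  have hle : ∀ i k, P (st i) k ≤ (st (i + 1)).1 := fun i k =>
    (le_iSup (P (st i)) k).trans (Submodule.le_topologicalClosure _)
  have hmono : ∀ i, (st i).1 ≤ (st (i + 1)).1 := fun i => (hP2 (st i)).ge.trans (hle i 0)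
  have halt : ∀ i, ¬ FiniteDimensional ℂ ↥(gap (st i).1 (st (i + 1)).1) ∨ (st (i + 1)).1 = ⊤ := by
    intro i
    by_contra! hcon
    obtain ⟨hfin, hne⟩ := hcon
    obtain ⟨N, hN, hlt, hfin'⟩ := exists_finite_above h𝒩 hQ hatom (st (i + 1)).2 hne
    have := finiteDimensional_gap_trans (h𝒩.closed _ (st i).2) (h𝒩.closed _ (st (i + 1)).2)
      (h𝒩.closed _ hN) (hmono i) hlt.le
    obtain ⟨k, hk⟩ := hP5 (st i) N hN ((hmono i).trans hlt.le) this
    exact hlt.not_ge (hk.le.trans (hle i k))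
  have htop : (st (Q + 1)).1 = ⊤ := by
    by_contra hne
    have hne' : ∀ j ≤ Q + 1, (st j).1 ≠ ⊤ := fun j hj h => hne (top_le_iff.1 (h.ge.trans
      (monotone_nat_of_le_succ (f := fun i => (st i).1) hmono hj)))
    have hinf : ∀ j ≤ Q, ¬ FiniteDimensional ℂ ↥(gap (st j).1 (st (j + 1)).1) := fun j hj =>
      (halt j).resolve_right (hne' (j + 1) (by omega))
    have := hQ (Q + 1) (fun j => (st j).1) ⟨fun j _ => (st j).2, fun j hj => ?_,
      fun j hj hjq => ?_⟩
    · omega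
    · refine lt_of_le_of_ne (hmono j) fun h => hinf j (by omega) ?_
      beta_reduce at h
      rw [← h, show gap (st j).1 (st j).1 = ⊥ from Submodule.inf_orthogonal_eq_bot _]
      infer_instance
    · have h1 := hinf (j - 1) (by omega)
      rw [Nat.sub_add_cancel hj] at h1
      exact rank_le_of_infinite (isClosed_gap (h𝒩.closed _ (st (j + 1)).2))
        (isClosed_gap (h𝒩.closed _ (st j).2)) h1
  refine ⟨Q, fun i => P (st i), hP2 _, (hP2 _).trans htop, fun i => hP1 _, fun i => hP3 _,
    fun i k => ?_, fun i => (hP2 _).trans (hst i), fun i L hL hle => ?_, fun i => ?_⟩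
  · beta_reduce
    rw [hP2]
    exact hP4 _ _
  · beta_reduce at hle
    rw [hP2] at hle
    exact hP6 _ L hL hle
  · beta_reduce
    rw [hP2, hP2]
    exact halt i

end Pieces

section Solving

variable {X H : Type*} [NormedAddCommGroup X] [InnerProductSpace ℂ X] [CompleteSpace X]
  [NormedAddCommGroup H] [InnerProductSpace ℂ H] [CompleteSpace H] {ι : Type*}

/-- `T` is triangular: it maps each `Y i` into `G i`. -/
def Tri (Y : ι → Submodule ℂ X) (G : ι → Submodule ℂ H) (T : X →L[ℂ] H) : Prop :=
  ∀ i, ∀ x ∈ Y i, T x ∈ G i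

theorem Tri.add {Y : ι → Submodule ℂ X} {G : ι → Submodule ℂ H} {S T : X →L[ℂ] H}
    (hS : Tri Y G S) (hT : Tri Y G T) : Tri Y G (S + T) :=
  fun i x hx => (G i).add_mem (hS i x hx) (hT i x hx)

/-- Between the levels `a` and `b`, some triangular perturbation of `A` of norm at most `ε` has a
triangular right inverse of norm at most `K`, modulo the level `a`. -/
def Solv (Y : ι → Submodule ℂ X) (G : ι → Submodule ℂ H) (A : X →L[ℂ] H) (ε K : ℝ)
    (a b : ι) : Prop :=
  ∃ (Δ : X →L[ℂ] H) (C : H →L[ℂ] X), Tri Y G Δ ∧ Tri G Y C ∧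
    Blk (gap (Y a) (Y b)) (gap (G a) (G b)) Δ ∧ Blk (gap (G a) (G b)) (gap (Y a) (Y b)) C ∧
    ‖Δ‖ ≤ ε ∧ ‖C‖ ≤ K ∧ ∀ x, (A + Δ) (C x) - pr (gap (G a) (G b)) x ∈ G a

theorem Blk.apply_eq_zero_of_isOrtho {V V' : Submodule ℂ X} {W : Submodule ℂ H} {T : X →L[ℂ] H}
    (hT : Blk V W T) (hV : V ⟂ V') {x : X} (hx : x ∈ V') : T x = 0 :=
  hT.2 x (hV.symm.le hx)

theorem Solv.mono {Y : ι → Submodule ℂ X} {G : ι → Submodule ℂ H} {A : X →L[ℂ] H}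
    {ε K ε' K' : ℝ} {a b : ι} (h : Solv Y G A ε K a b) (hε : ε ≤ ε') (hK : K ≤ K') :
    Solv Y G A ε' K' a b := by
  obtain ⟨Δ, C, h1, h2, h3, h4, h5, h6, h7⟩ := h
  exact ⟨Δ, C, h1, h2, h3, h4, h5.trans hε, h6.trans hK, h7⟩

theorem Solv.refl {Y : ι → Submodule ℂ X} {G : ι → Submodule ℂ H} {A : X →L[ℂ] H}
    {ε K : ℝ} (hε : 0 ≤ ε) (hK : 0 ≤ K) (a : ι) : Solv Y G A ε K a a := by
  refine ⟨0, 0, fun i _ _ => (G i).zero_mem, fun i _ _ => (Y i).zero_mem, Blk.zero _ _,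
    Blk.zero _ _, by simpa, by simpa, fun x => ?_⟩
  have h : gap (G a) (G a) = ⊥ := Submodule.inf_orthogonal_eq_bot _
  rw [h, pr_of_orth (by simp)]
  simp

theorem Solv.concat {Y : ι → Submodule ℂ X} {G : ι → Submodule ℂ H}
    (hG : ∀ i, IsClosed (G i : Set H)) {A : X →L[ℂ] H} (hA : Tri Y G A) {ε₁ ε₂ K₁ K₂ : ℝ}
    {a l b : ι} (hYal : Y a ≤ Y l) (hYlb : Y l ≤ Y b) (hGal : G a ≤ G l) (hGlb : G l ≤ G b)
    (h₁ : Solv Y G A ε₁ K₁ a l) (h₂ : Solv Y G A ε₂ K₂ l b) :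
    Solv Y G A (ε₁ + ε₂) (K₁ + K₂ + K₁ * (‖A‖ + (ε₁ + ε₂)) * K₂) a b := by
  obtain ⟨D₁, C₁, hD₁, hC₁, hDb₁, hCb₁, hDn₁, hCn₁, hs₁⟩ := h₁
  obtain ⟨D₂, C₂, hD₂, hC₂, hDb₂, hCb₂, hDn₂, hCn₂, hs₂⟩ := h₂
  have hgl : gap (G a) (G l) ≤ gap (G a) (G b) := gap_mono le_rfl hGlb
  have hgr : gap (G l) (G b) ≤ gap (G a) (G b) := gap_mono hGal le_rfl
  have hyl : gap (Y a) (Y l) ≤ gap (Y a) (Y b) := gap_mono le_rfl hYlb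
  have hyr : gap (Y l) (Y b) ≤ gap (Y a) (Y b) := gap_mono hYal le_rfl
  have hDn : ‖D₁ + D₂‖ ≤ ε₁ + ε₂ := (norm_add_le _ _).trans (add_le_add hDn₁ hDn₂)
  have hK₁ : 0 ≤ K₁ := (norm_nonneg _).trans hCn₁
  refine ⟨D₁ + D₂, C₁ + C₂ - C₁.comp ((A + (D₁ + D₂)).comp C₂), hD₁.add hD₂, fun i x hx => ?_,
    (hDb₁.mono hyl hgl).add (hDb₂.mono hyr hgr), ⟨fun x => ?_, fun x hx => ?_⟩, hDn, ?_,
    fun x => ?_⟩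
  · exact (Y i).sub_mem ((Y i).add_mem (hC₁ i x hx) (hC₂ i x hx))
      (hC₁ i _ ((hA.add (hD₁.add hD₂)) i _ (hC₂ i x hx)))
  · exact Submodule.sub_mem _ (Submodule.add_mem _ (hyl (hCb₁.1 _)) (hyr (hCb₂.1 _)))
      (hyl (hCb₁.1 _))
  · have h1 := hCb₁.2 x (Submodule.orthogonal_le hgl hx)
    have h2 := hCb₂.2 x (Submodule.orthogonal_le hgr hx)
    simp [h1, h2]
  · refine (norm_sub_le _ _).trans (add_le_add ((norm_add_le _ _).trans
      (add_le_add hCn₁ hCn₂)) ?_)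
    refine (ContinuousLinearMap.opNorm_comp_le _ _).trans ?_
    rw [mul_assoc]
    refine mul_le_mul hCn₁ ((ContinuousLinearMap.opNorm_comp_le _ _).trans ?_)
      (norm_nonneg _) hK₁
    exact mul_le_mul ((norm_add_le _ _).trans (by gcongr)) hCn₂ (norm_nonneg _)
      (add_nonneg (norm_nonneg _) ((norm_nonneg _).trans hDn))
  · have h1 : ∀ y, D₂ (C₁ y) = 0 := fun y =>
      hDb₂.apply_eq_zero_of_isOrtho (isOrtho_gap le_rfl).symm (hCb₁.1 y)
    have h2 : ∀ y, D₁ (C₂ y) = 0 := fun y =>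
      hDb₁.apply_eq_zero_of_isOrtho (isOrtho_gap le_rfl) (hCb₂.1 y)
    set g := (A + D₂) (C₂ x) - pr (gap (G l) (G b)) x with hg
    have hgm : g ∈ G l := hs₂ x
    have h3 := hs₁ x
    have h4 := hs₁ (g + pr (gap (G l) (G b)) x)
    have h5 : (A + D₂) (C₂ x) = g + pr (gap (G l) (G b)) x := by rw [hg]; abel
    have h6 : pr (gap (G a) (G l)) (pr (gap (G l) (G b)) x) = 0 :=
      pr_of_orth ((isOrtho_gap le_rfl).symm.le (pr_mem (isClosed_gap (hG b)) x))
    have h7 : pr (gap (G a) (G l)) g = g - pr (G a) g := by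
      rw [pr_gap (hG a) (hG l) hGal, pr_of_mem hgm]
    have h8 : (A + (D₁ + D₂)) (C₂ x) = g + pr (gap (G l) (G b)) x := by
      rw [← h5]; simp [h2]
    have h9 : ∀ y, (A + (D₁ + D₂)) (C₁ y) = (A + D₁) (C₁ y) := fun y => by simp [h1]
    have h10 : (A + (D₁ + D₂)) ((C₁ + C₂ - C₁.comp ((A + (D₁ + D₂)).comp C₂)) x) =
        (A + D₁) (C₁ x) + (g + pr (gap (G l) (G b)) x) -
          (A + D₁) (C₁ (g + pr (gap (G l) (G b)) x)) := by
      rw [← h8, ← h9, ← h9]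
      simp only [sub_apply, add_apply, ContinuousLinearMap.comp_apply, map_sub, map_add]
    rw [h10, pr_gap (hG a) (hG b) (hGal.trans hGlb)]
    rw [map_add (pr _), h6, h7, add_zero] at h4
    have h11 := pr_gap (hG a) (hG l) hGal x
    have h12 := pr_gap (hG l) (hG b) hGlb x
    have h13 := (G a).sub_mem ((G a).sub_mem h3 h4) (neg_mem (pr_mem (hG a) g))
    convert h13 using 1
    rw [h11, h12]
    abel

end Solving

section OmegaChain

variable {X H : Type*} [NormedAddCommGroup X] [InnerProductSpace ℂ X] [CompleteSpace X]
  [NormedAddCommGroup H] [InnerProductSpace ℂ H] [CompleteSpace H] {ι : Type*} [LinearOrder ι]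

theorem hasSum_pr_gap {N : ℕ → Submodule ℂ H} (hN : Monotone N)
    (hcl : ∀ s, IsClosed (N s : Set H)) {M : Submodule ℂ H} (hM : IsClosed (M : Set H))
    (hle : ∀ s, N s ≤ M) (hsup : M ≤ (⨆ s, N s).topologicalClosure) (x : H) :
    HasSum (fun s => pr (gap (N s) (N (s + 1))) x) (pr (gap (N 0) M) x) := by
  have ho : ∀ s t, s ≠ t → gap (N s) (N (s + 1)) ⟂ gap (N t) (N (t + 1)) := fun s t hst => by
    rcases lt_or_gt_of_ne hst with h | h
    · exact isOrtho_gap (hN h)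
    · exact (isOrtho_gap (hN h)).symm
  obtain ⟨S, hS, -⟩ := exists_strongSum (fun s => isClosed_gap (hcl (s + 1))) ho ho
    (fun s => pr (gap (N s) (N (s + 1)))) zero_le_one
    (fun s => ⟨pr_mem (isClosed_gap (hcl (s + 1))), fun x hx => pr_of_orth hx⟩)
    (fun s => norm_pr_le _)
  have h1 : ∀ n, ∑ s ∈ Finset.range n, pr (gap (N s) (N (s + 1))) x = pr (N n) x - pr (N 0) x := by
    intro n
    rw [Finset.sum_congr rfl fun s _ => pr_gap (hcl s) (hcl (s + 1)) (hN (Nat.le_succ s)) x]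
    exact Finset.sum_range_sub (fun s => pr (N s) x) n
  have h2 := (hS x).tendsto_sum_nat
  simp only [h1] at h2
  have h3 : M = (⨆ s, N s).topologicalClosure :=
    le_antisymm hsup (Submodule.topologicalClosure_minimal _ (iSup_le hle) hM)
  have h4 : Filter.Tendsto (fun n => pr (N n) x) Filter.atTop (nhds (pr M x)) := by
    have hc : ∀ s, (N s).topologicalClosure = N s := fun s =>
      (hcl s).submodule_topologicalClosure_eq
    have h5 := Submodule.starProjection_tendsto_closure_iSup (fun s => (N s).topologicalClosure)
      (fun i j hij => Submodule.topologicalClosure_mono (hN hij)) x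
    simp only [hc] at h5
    have h6 : pr M x = (⨆ s, N s).topologicalClosure.starProjection x := by
      subst h3
      exact pr_eq_of (Submodule.starProjection_apply_mem _ _)
        (Submodule.sub_starProjection_mem_orthogonal _)
    rw [h6]
    refine h5.congr fun n => ?_
    simp only [pr, hc]
  have h5 : S x = pr (gap (N 0) M) x := by
    rw [pr_gap (hcl 0) hM (hle 0)]
    exact tendsto_nhds_unique h2 (h4.sub_const _)
  rw [← h5]
  exact hS x

theorem exists_sum_of_gaps {N : ℕ → Submodule ℂ X} (hN : Monotone N)
    (hNc : ∀ s, IsClosed (N s : Set X)) {M : ℕ → Submodule ℂ H} (hM : Monotone M)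
    (T : ℕ → X →L[ℂ] H) {K : ℝ} (hK : 0 ≤ K)
    (hT : ∀ s, Blk (gap (N s) (N (s + 1))) (gap (M s) (M (s + 1))) (T s))
    (hTK : ∀ s, ‖T s‖ ≤ K) :
    ∃ S : X →L[ℂ] H, (∀ x, HasSum (fun s => T s x) (S x)) ∧ ‖S‖ ≤ K ∧
      ∀ s, ∀ x ∈ gap (N s) (N (s + 1)), S x = T s x := by
  have ho : ∀ s t, s ≠ t → gap (N s) (N (s + 1)) ⟂ gap (N t) (N (t + 1)) := fun s t hst => by
    rcases lt_or_gt_of_ne hst with h | h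
    · exact isOrtho_gap (hN h)
    · exact (isOrtho_gap (hN h)).symm
  obtain ⟨S, hS, hSn⟩ := exists_strongSum (fun s => isClosed_gap (hNc (s + 1))) ho
    (fun s t hst => by
      rcases lt_or_gt_of_ne hst with h | h
      · exact isOrtho_gap (hM h)
      · exact (isOrtho_gap (hM h)).symm) T hK hT hTK
  exact ⟨S, hS, hSn, fun s x hx => (hS x).unique (hasSum_single s fun t ht =>
    (hT t).apply_eq_zero_of_isOrtho (ho t s ht) hx)⟩

theorem mem_of_hasSum {N : Submodule ℂ H} (hN : IsClosed (N : Set H)) {f : ℕ → H} {y : H}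
    (h : HasSum f y) (hf : ∀ s, f s ∈ N) : y ∈ N :=
  hN.mem_of_tendsto h (Filter.Eventually.of_forall fun _ => N.sum_mem fun s _ => hf s)

theorem Solv.omega {Y : ι → Submodule ℂ X} {G : ι → Submodule ℂ H} (hYm : Monotone Y)
    (hGm : Monotone G) (hY : ∀ i, IsClosed (Y i : Set X)) (hG : ∀ i, IsClosed (G i : Set H))
    {A : X →L[ℂ] H} (hA : Tri Y G A) {ε K : ℝ} (hε : 0 ≤ ε) (hK : 0 ≤ K) {a b : ℕ → ι} {c : ι}
    (hab : ∀ j, a j ≤ b j) (hba : ∀ j, b j ≤ a (j + 1)) (hac : ∀ j, a j ≤ c)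
    (hsup : G c ≤ (⨆ j, G (a j)).topologicalClosure)
    (hgap : ∀ i j, i ≤ b j ∨ a (j + 1) ≤ i)
    (hL : ∀ j, Solv Y G A ε K (a j) (b j))
    (hR : ∀ j, ∃ (D : X →L[ℂ] H) (R : H →L[ℂ] X),
      Blk (gap (Y (b j)) (Y (a (j + 1)))) (gap (G (a j)) (G (a (j + 1)))) D ∧
      Blk (gap (G (a j)) (G (a (j + 1)))) (gap (Y (b j)) (Y (a (j + 1)))) R ∧
      ‖D‖ ≤ ε ∧ ‖R‖ ≤ K ∧
      ∀ x, (A + D) (R x) - pr (gap (G (a j)) (G (a (j + 1)))) x ∈ G (a 0)) :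
    Solv Y G A (2 * ε) (2 * K + K * (1 + (‖A‖ + 2 * ε) * (2 * K))) (a 0) c := by
  choose DL CL hDL hCL hDLb hCLb hDLn hCLn hLs using hL
  choose D R hDb hRb hDn hRn hRs using hR
  have ha : Monotone a := monotone_nat_of_le_succ fun j => (hab j).trans (hba j)
  have haY : Monotone fun j => Y (a j) := hYm.comp ha
  have haG : Monotone fun j => G (a j) := hGm.comp ha
  have hy1 : ∀ j, gap (Y (a j)) (Y (b j)) ≤ gap (Y (a j)) (Y (a (j + 1))) := fun j =>
    gap_mono le_rfl (hYm (hba j))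
  have hy2 : ∀ j, gap (Y (b j)) (Y (a (j + 1))) ≤ gap (Y (a j)) (Y (a (j + 1))) := fun j =>
    gap_mono (hYm (hab j)) le_rfl
  have hg1 : ∀ j, gap (G (a j)) (G (b j)) ≤ gap (G (a j)) (G (a (j + 1))) := fun j =>
    gap_mono le_rfl (hGm (hba j))
  have hg2 : ∀ j, gap (G (b j)) (G (a (j + 1))) ≤ gap (G (a j)) (G (a (j + 1))) := fun j =>
    gap_mono (hGm (hab j)) le_rfl
  have hgc : ∀ j, gap (G (a j)) (G (a (j + 1))) ≤ gap (G (a 0)) (G c) := fun j =>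
    gap_mono (haG (Nat.zero_le j)) (hGm (hac _))
  have hyc : ∀ j, gap (Y (a j)) (Y (a (j + 1))) ≤ gap (Y (a 0)) (Y c) := fun j =>
    gap_mono (haY (Nat.zero_le j)) (hYm (hac _))
  have hDt : ∀ j, Tri Y G (D j) := fun j i x hx => by
    rcases hgap i j with h | h
    · rw [(hDb j).2 x (Submodule.orthogonal_le inf_le_right
        (Submodule.le_orthogonal_orthogonal _ (hYm h hx)))]
      exact zero_mem _
    · exact hGm h ((hDb j).1 x).1
  have hRt : ∀ j, ∀ i, a (j + 1) ≤ i → ∀ x, R j x ∈ Y i := fun j i h x => hYm h ((hRb j).1 x).1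
  let f : ℕ → H →L[ℂ] H := fun j => pr (gap (G (b j)) (G (a (j + 1))))
  have hfz : ∀ j, ∀ x ∈ G (b j), f j x = 0 := fun j x hx => pr_of_orth
    (Submodule.orthogonal_le inf_le_right (Submodule.le_orthogonal_orthogonal _ hx))
  have hRft : ∀ j, Tri G Y ((R j).comp (f j)) := fun j i x hx => by
    rcases hgap i j with h | h
    · rw [ContinuousLinearMap.comp_apply, hfz j x (hGm h hx), map_zero]
      exact zero_mem _
    · exact hRt j i h _
  have hRfb : ∀ j, Blk (gap (G (a j)) (G (a (j + 1)))) (gap (Y (b j)) (Y (a (j + 1))))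
      ((R j).comp (f j)) := fun j =>
    ⟨fun x => (hRb j).1 _, fun x hx => by
      rw [ContinuousLinearMap.comp_apply, show f j x = 0 from
        pr_of_orth (Submodule.orthogonal_le (hg2 j) hx), map_zero]⟩
  have hfn : ∀ j, ‖(R j).comp (f j)‖ ≤ K := fun j =>
    (ContinuousLinearMap.opNorm_comp_le _ _).trans
      ((mul_le_mul (hRn j) (norm_pr_le _) (norm_nonneg _) hK).trans_eq (mul_one K))
  obtain ⟨Δ, hΔ, hΔn, hΔs⟩ := exists_sum_of_gaps haY (fun s => hY _) haG
    (fun j => DL j + D j) (K := 2 * ε) (by positivity)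
    (fun j => ((hDLb j).mono (hy1 j) (hg1 j)).add ((hDb j).mono (hy2 j) le_rfl))
    (fun j => (norm_add_le _ _).trans (by linarith [hDLn j, hDn j]))
  obtain ⟨C₀, hC₀, hC₀n, -⟩ := exists_sum_of_gaps haG (fun s => hG _) haY
    (fun j => CL j + (R j).comp (f j)) (K := 2 * K) (by positivity)
    (fun j => ((hCLb j).mono (hg1 j) (hy1 j)).add ((hRfb j).mono le_rfl (hy2 j)))
    (fun j => (norm_add_le _ _).trans (by linarith [hCLn j, hfn j]))
  obtain ⟨S, hS, hSn, -⟩ := exists_sum_of_gaps haG (fun s => hG _) haY R hK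
    (fun j => (hRb j).mono le_rfl (hy2 j)) hRn
  let q := pr (gap (G (a 0)) (G c))
  have hqs := hasSum_pr_gap haG (fun s => hG _) (hG c) (fun s => hGm (hac s)) hsup
  have hΔt : Tri Y G Δ := fun i x hx => mem_of_hasSum (hG i) (hΔ x) fun s =>
    (hDL s).add (hDt s) i x hx
  have hC₀t : Tri G Y C₀ := fun i x hx => mem_of_hasSum (hY i) (hC₀ x) fun s =>
    (hCL s).add (hRft s) i x hx
  have hATt : Tri Y G (A + Δ) := hA.add hΔt
  have hqe : ∀ x, q x = pr (G c) x - pr (G (a 0)) x := pr_gap (hG _) (hG c) (hGm (hac 0))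
  have hq0 : ∀ x ∈ G (a 0), q x = 0 := fun x hx => pr_of_orth
    (Submodule.orthogonal_le inf_le_right (Submodule.le_orthogonal_orthogonal _ hx))
  have hAS : ∀ x, q ((A + Δ) (S x)) = q x := fun x => by
    have h1 := (q.comp (A + Δ)).hasSum (hS x)
    refine h1.unique ?_
    convert hqs x using 2 with s
    have h2 : (A + Δ) (R s x) = (A + D s) (R s x) := by
      rw [add_apply, add_apply, hΔs s _ (hy2 s ((hRb s).1 x)), add_apply,
        (hDLb s).apply_eq_zero_of_isOrtho (isOrtho_gap le_rfl) ((hRb s).1 x), zero_add]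
    have h3 := hq0 _ (hRs s x)
    rw [map_sub, sub_eq_zero] at h3
    rw [ContinuousLinearMap.comp_apply, h2, h3]
    exact pr_of_mem (hgc s (pr_mem (isClosed_gap (hG _)) x))
  let J : H →L[ℂ] H := q - q.comp ((A + Δ).comp C₀)
  have hJs : ∀ x, HasSum (fun s => pr (gap (G (a s)) (G (a (s + 1)))) x -
      q ((A + Δ) (CL s x + R s (f s x)))) (J x) := fun x =>
    (hqs x).sub ((q.comp (A + Δ)).hasSum (hC₀ x))
  have hJm : ∀ s x, pr (gap (G (a s)) (G (a (s + 1)))) x -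
      q ((A + Δ) (CL s x + R s (f s x))) ∈ G (a s) := fun s x => by
    have h1 : (A + Δ) (CL s x) = (A + DL s) (CL s x) := by
      rw [add_apply, add_apply, hΔs s _ (hy1 s ((hCLb s).1 x)), add_apply,
        (hDb s).apply_eq_zero_of_isOrtho (isOrtho_gap le_rfl).symm ((hCLb s).1 x), add_zero]
    have h2 : (A + Δ) (R s (f s x)) = (A + D s) (R s (f s x)) := by
      rw [add_apply, add_apply, hΔs s _ (hy2 s ((hRb s).1 _)), add_apply,
        (hDLb s).apply_eq_zero_of_isOrtho (isOrtho_gap le_rfl) ((hRb s).1 _), zero_add]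
    have h3 : pr (gap (G (a s)) (G (a (s + 1)))) (f s x) = f s x :=
      pr_of_mem (hg2 s (pr_mem (isClosed_gap (hG _)) x))
    have h4 := hLs s x
    have h5 := haG (Nat.zero_le s) (hRs s (f s x))
    rw [h3] at h5
    have h6 := (G (a s)).add_mem h4 h5
    have h7 : pr (gap (G (a s)) (G (a (s + 1)))) x = pr (gap (G (a s)) (G (b s))) x + f s x := by
      rw [pr_gap (hG _) (hG _) (haG (Nat.le_succ s)), pr_gap (hG _) (hG _) (hGm (hab s)),
        show f s x = _ from pr_gap (hG _) (hG _) (hGm (hba s)) x]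
      abel
    have h8 : (A + Δ) (CL s x + R s (f s x)) - pr (gap (G (a s)) (G (a (s + 1)))) x ∈
        G (a s) := by
      rw [map_add, h1, h2, h7]
      convert h6 using 1
      abel
    have h9 : ∀ y ∈ G (a s), q y ∈ G (a s) := fun y hy => by
      rw [hqe, pr_of_mem (hGm (hac s) hy)]
      exact Submodule.sub_mem _ hy (haG (Nat.zero_le s) (pr_mem (hG _) y))
    have h10 := neg_mem (h9 _ h8)
    rw [map_sub, neg_sub, show q (pr (gap (G (a s)) (G (a (s + 1)))) x) = _ from
      pr_of_mem (hgc s (pr_mem (isClosed_gap (hG _)) x))] at h10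
    exact h10
  have hJz : ∀ s, ∀ x ∈ G (a s), pr (gap (G (a s)) (G (a (s + 1)))) x -
      q ((A + Δ) (CL s x + R s (f s x))) = 0 := fun s x hx => by
    have ho : x ∈ (gap (G (a s)) (G (a (s + 1))))ᗮ :=
      Submodule.orthogonal_le inf_le_right (Submodule.le_orthogonal_orthogonal _ hx)
    rw [pr_of_orth ho, hfz s x (hGm (hab s) hx), (hCLb s).2 x (Submodule.orthogonal_le (hg1 s) ho)]
    simp
  have hJ : ∀ j, ∀ x ∈ G (a (j + 1)), J x ∈ G (a j) := fun j x hx =>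
    mem_of_hasSum (hG _) (hJs x) fun s => by
      rcases le_or_gt s j with h | h
      · exact haG h (hJm s x)
      · rw [hJz s x (haG h hx)]
        exact zero_mem _
  have hJ0 : ∀ x ∈ G (a 0), J x = 0 := fun x hx => by
    refine (hJs x).unique ?_
    convert hasSum_zero using 2 with s
    exact hJz s x (haG (Nat.zero_le s) hx)
  have hSj : ∀ j, ∀ x ∈ G (a j), S x ∈ Y (a j) := fun j x hx =>
    mem_of_hasSum (hY _) (hS x) fun s => by
      rcases lt_or_ge s j with h | h
      · exact haY h ((hRb s).1 x).1
      · rw [(hRb s).2 x (Submodule.orthogonal_le inf_le_right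
          (Submodule.le_orthogonal_orthogonal _ (haG h hx)))]
        exact zero_mem _
  have hSJt : Tri G Y (S.comp J) := fun i x hx => by
    rw [ContinuousLinearMap.comp_apply]
    by_cases h0 : i ≤ a 0
    · rw [hJ0 x (hGm h0 hx), map_zero]
      exact zero_mem _
    · by_cases hall : ∀ j, a j ≤ i
      · exact mem_of_hasSum (hY i) (hS _) fun s => hRt s i (hall _) _
      · push Not at hall
        classical
        obtain ⟨j, hj⟩ : ∃ j, Nat.find hall = j + 1 := Nat.exists_eq_succ_of_ne_zero fun h =>
          h0 ((Nat.find_spec hall).le.trans_eq (by rw [h]))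
        have h1 : i < a (j + 1) := hj ▸ Nat.find_spec hall
        have h2 : a j ≤ i := not_lt.1 (Nat.find_min hall (by omega))
        exact hYm h2 (hSj j _ (hJ j x (hGm h1.le hx)))
  refine ⟨Δ, C₀ + S.comp J, hΔt, hC₀t.add hSJt, ⟨fun x => ?_, fun x hx => ?_⟩,
    Blk.add ⟨fun x => ?_, fun x hx => ?_⟩ ⟨fun x => ?_, fun x hx => ?_⟩, hΔn, ?_, fun x => ?_⟩
  · exact mem_of_hasSum (isClosed_gap (hG c)) (hΔ x) fun s =>
      hgc s ((((hDLb s).mono (hy1 s) (hg1 s)).add ((hDb s).mono (hy2 s) le_rfl)).1 x)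
  · refine (hΔ x).unique ?_
    convert hasSum_zero using 2 with s
    exact (((hDLb s).mono (hy1 s) (hg1 s)).add ((hDb s).mono (hy2 s) le_rfl)).2 x
      (Submodule.orthogonal_le (hyc s) hx)
  · exact mem_of_hasSum (isClosed_gap (hY c)) (hC₀ x) fun s =>
      hyc s ((((hCLb s).mono (hg1 s) (hy1 s)).add ((hRfb s).mono le_rfl (hy2 s))).1 x)
  · refine (hC₀ x).unique ?_
    convert hasSum_zero using 2 with s
    exact (((hCLb s).mono (hg1 s) (hy1 s)).add ((hRfb s).mono le_rfl (hy2 s))).2 x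
      (Submodule.orthogonal_le (hgc s) hx)
  · exact mem_of_hasSum (isClosed_gap (hY c)) (hS _) fun s => hyc s (hy2 s ((hRb s).1 _))
  · have h1 : J x = 0 := by
      refine (hJs x).unique ?_
      convert hasSum_zero using 2 with s
      have h2 := Submodule.orthogonal_le (hgc s) hx
      rw [pr_of_orth h2, (hCLb s).2 x (Submodule.orthogonal_le (hg1 s) h2),
        show f s x = 0 from pr_of_orth (Submodule.orthogonal_le (hg2 s) h2)]
      simp
    rw [ContinuousLinearMap.comp_apply, h1, map_zero]
  · refine (norm_add_le _ _).trans (add_le_add hC₀n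
      ((ContinuousLinearMap.opNorm_comp_le _ _).trans ?_))
    refine mul_le_mul hSn ((norm_sub_le _ _).trans (add_le_add (norm_pr_le _) ?_))
      (norm_nonneg _) hK
    refine (ContinuousLinearMap.opNorm_comp_le _ _).trans ?_
    refine (mul_le_mul (norm_pr_le _) (ContinuousLinearMap.opNorm_comp_le _ _)
      (norm_nonneg _) zero_le_one).trans ?_
    rw [one_mul]
    exact mul_le_mul ((norm_add_le _ _).trans (by linarith)) hC₀n (norm_nonneg _)
      (by positivity)
  · have hCc : (C₀ + S.comp J) x ∈ Y c := Submodule.add_mem _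
      (mem_of_hasSum (hY c) (hC₀ x) fun s => (hyc s ((((hCLb s).mono (hg1 s) (hy1 s)).add
        ((hRfb s).mono le_rfl (hy2 s))).1 x)).1)
      (mem_of_hasSum (hY c) (hS _) fun s => (hyc s (hy2 s ((hRb s).1 _))).1)
    have h1 : q ((A + Δ) ((C₀ + S.comp J) x)) = q x := by
      have h3 : ∀ y, q (q y) = q y := pr_pr _
      rw [show (C₀ + S.comp J) x = C₀ x + S (J x) from rfl, map_add, map_add, hAS]
      change q ((A + Δ) (C₀ x)) + q (q x - q ((A + Δ) (C₀ x))) = q x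
      rw [map_sub, h3, h3]
      abel
    rw [← h1, hqe, pr_of_mem (hATt c _ hCc), sub_sub_cancel]
    exact pr_mem (hG _) _

end OmegaChain

section SingularValues

variable {X H : Type*} [NormedAddCommGroup X] [InnerProductSpace ℂ X] [CompleteSpace X]
  [NormedAddCommGroup H] [InnerProductSpace ℂ H] [CompleteSpace H]

theorem inner_self_eq_ofReal (x : H) : inner ℂ x x = ((‖x‖ ^ 2 : ℝ) : ℂ) := by
  rw [inner_self_eq_norm_sq_to_K]
  norm_cast

theorem norm_sum_smul_sq {n : ℕ} {w : Fin n → H} (hw : Orthonormal ℂ w) (c : Fin n → ℂ) :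
    ‖∑ i, c i • w i‖ ^ 2 = ∑ i, ‖c i‖ ^ 2 := by
  have h := hw.inner_sum c c Finset.univ
  rw [inner_self_eq_ofReal] at h
  have h2 : ∀ i, (starRingEnd ℂ) (c i) * c i = ((‖c i‖ ^ 2 : ℝ) : ℂ) := fun i => by
    rw [mul_comm, Complex.mul_conj, Complex.normSq_eq_norm_sq]
  simp only [h2] at h
  rw [← Complex.ofReal_sum] at h
  exact Complex.ofReal_injective h

theorem exists_diagonal {n : ℕ} {u : Fin n → X} (hu : Orthonormal ℂ u) {w : Fin n → H}
    (hw : Orthonormal ℂ w) (c : Fin n → ℂ) {K : ℝ} (hK : 0 ≤ K) (hc : ∀ i, ‖c i‖ ≤ K) :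
    ∃ T : X →L[ℂ] H, (∀ x, T x = ∑ i, (c i * inner ℂ (u i) x) • w i) ∧ ‖T‖ ≤ K := by
  have hT : ∀ x, (∑ i, c i • (innerSL ℂ (u i)).smulRight (w i)) x =
      ∑ i, (c i * inner ℂ (u i) x) • w i := fun x => by
    rw [sum_apply]
    exact Finset.sum_congr rfl fun i _ => by simp [mul_smul]
  refine ⟨∑ i, c i • (innerSL ℂ (u i)).smulRight (w i), hT,
    ContinuousLinearMap.opNorm_le_bound _ hK fun x => ?_⟩
  rw [hT]
  refine le_of_sq_le_sq ?_ (by positivity)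
  rw [norm_sum_smul_sq hw, mul_pow]
  calc ∑ i, ‖c i * inner ℂ (u i) x‖ ^ 2 ≤ ∑ i, K ^ 2 * ‖inner ℂ (u i) x‖ ^ 2 := by
        refine Finset.sum_le_sum fun i _ => ?_
        rw [norm_mul, mul_pow]
        gcongr
        exact hc i
    _ = K ^ 2 * ∑ i, ‖inner ℂ (u i) x‖ ^ 2 := by rw [Finset.mul_sum]
    _ ≤ K ^ 2 * ‖x‖ ^ 2 := by
        gcongr
        exact hu.sum_inner_products_le x

theorem exists_singular_pairs (A : X →L[ℂ] H) (W : Submodule ℂ X) (S : Submodule ℂ H)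
    [FiniteDimensional ℂ W] [FiniteDimensional ℂ S]
    (hWS : Module.finrank ℂ S ≤ Module.finrank ℂ W) :
    ∃ (s : Fin (Module.finrank ℂ S) → H) (w : Fin (Module.finrank ℂ S) → X)
      (σ : Fin (Module.finrank ℂ S) → ℝ), Orthonormal ℂ s ∧ Orthonormal ℂ w ∧ (∀ i, s i ∈ S) ∧
      (∀ i, w i ∈ W) ∧ (∀ i, 0 ≤ σ i) ∧ (∀ i, pr S (A (w i)) = (σ i : ℂ) • s i) ∧
      ∀ x, pr S x = ∑ i, inner ℂ (s i) x • s i := by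
  have hSc : IsClosed (S : Set H) := Submodule.closed_of_finiteDimensional S
  have hWc : IsClosed (W : Set X) := Submodule.closed_of_finiteDimensional W
  have hprS : ∀ x, pr S x = S.starProjection x := fun x =>
    pr_eq_of (Submodule.starProjection_apply_mem _ _) (Submodule.sub_starProjection_mem_orthogonal _)
  let B : S →ₗ[ℂ] X := ((pr W).comp ((ContinuousLinearMap.adjoint A).comp S.subtypeL)).toLinearMap
  have hBW : ∀ y, B y ∈ W := fun y => pr_mem hWc _
  have hBi : ∀ (y : S) (x : X), x ∈ W → inner ℂ (B y) x = inner ℂ (y : H) (A x) := fun y x hx => by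
    have h1 : inner ℂ (B y) x = inner ℂ (ContinuousLinearMap.adjoint A (y : H)) (pr W x) :=
      inner_pr_left _ _ _
    rw [h1, pr_of_mem hx, ContinuousLinearMap.adjoint_inner_left]
  let T : S →ₗ[ℂ] S := (S.orthogonalProjectionOnto.comp A).toLinearMap.comp B
  have hTi : ∀ x y : S, inner ℂ x (T y) = inner ℂ (B x) (B y) := fun x y => by
    rw [hBi x _ (hBW y)]
    change inner ℂ (x : H) ((S.orthogonalProjectionOnto (A (B y)) : S) : H) = _
    have h1 := Submodule.sub_starProjection_mem_orthogonal (K := S) (A (B y))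
    have h2 := (Submodule.mem_orthogonal _ _).1 h1 x x.2
    rw [inner_sub_right, sub_eq_zero] at h2
    exact h2.symm
  have hT : T.IsSymmetric := fun x y => by
    rw [← inner_conj_symm, hTi, hTi, inner_conj_symm]
  let e := hT.eigenvectorBasis rfl
  let ev := hT.eigenvalues rfl
  have hBB : ∀ i j, inner ℂ (B (e i)) (B (e j)) = if i = j then (ev i : ℂ) else 0 := fun i j => by
    rw [← hTi, hT.apply_eigenvectorBasis, inner_smul_right, orthonormal_iff_ite.1 e.orthonormal]
    split_ifs with h
    · rw [h, mul_one]; rfl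
    · rw [mul_zero]
  have hev : ∀ i, ev i = ‖B (e i)‖ ^ 2 := fun i => by
    have h1 := hBB i i
    rw [if_pos rfl, inner_self_eq_ofReal] at h1
    exact (Complex.ofReal_injective h1).symm
  let v : Fin (Module.finrank ℂ W) → W := fun k =>
    if h : k.1 < Module.finrank ℂ S then
      (((‖B (e ⟨k, h⟩)‖)⁻¹ : ℝ) : ℂ) • ⟨B (e ⟨k, h⟩), hBW _⟩ else 0
  let t : Set (Fin (Module.finrank ℂ W)) :=
    {k | ∃ h : k.1 < Module.finrank ℂ S, B (e ⟨k, h⟩) ≠ 0}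
  have hv : Orthonormal ℂ (t.domRestrict v) := by
    classical
    rw [orthonormal_iff_ite]
    rintro ⟨k, hk, hk0⟩ ⟨l, hl, hl0⟩
    have h1 : inner ℂ (v k) (v l) = (((‖B (e ⟨k, hk⟩)‖)⁻¹ : ℝ) : ℂ) *
        ((((‖B (e ⟨l, hl⟩)‖)⁻¹ : ℝ) : ℂ) * inner ℂ (B (e ⟨k, hk⟩)) (B (e ⟨l, hl⟩))) := by
      simp only [v, dif_pos hk, dif_pos hl, inner_smul_left, inner_smul_right, Complex.conj_ofReal]
      rw [mul_left_comm]
      rfl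
    change inner ℂ (v k) (v l) = _
    rw [h1, hBB]
    by_cases hkl : k = l
    · subst hkl
      rw [if_pos rfl, if_pos rfl, hev]
      have h2 := norm_ne_zero_iff.2 hk0
      rw [← Complex.ofReal_mul, ← Complex.ofReal_mul, ← Complex.ofReal_one]
      congr 1
      field_simp
    · rw [if_neg, if_neg]
      · simp
      · simpa using hkl
      · simpa [Fin.ext_iff] using hkl
  obtain ⟨b, hb⟩ := hv.exists_orthonormalBasis_extension_of_card_eq (by simp)
  have hw : ∀ i : Fin (Module.finrank ℂ S),
      B (e i) = ((‖B (e i)‖ : ℝ) : ℂ) • (b (Fin.castLE hWS i) : X) := fun i => by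
    by_cases h0 : B (e i) = 0
    · simp [h0]
    · have h1 : Fin.castLE hWS i ∈ t := ⟨i.2, h0⟩
      have h2 : v (Fin.castLE hWS i) = (((‖B (e i)‖)⁻¹ : ℝ) : ℂ) • ⟨B (e i), hBW _⟩ :=
        dif_pos i.2
      rw [hb _ h1, h2, Submodule.coe_smul, smul_smul, ← Complex.ofReal_mul,
        mul_inv_cancel₀ (norm_ne_zero_iff.2 h0)]
      simp
  have hpr : ∀ x, pr S x = ∑ i, inner ℂ (e i : H) x • (e i : H) := fun x => by
    have h1 := e.sum_repr' (S.orthogonalProjectionOnto x)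
    have h2 := congrArg (Subtype.val) h1
    rw [hprS, Submodule.starProjection_apply, ← h2]
    simp only [Submodule.coe_sum, Submodule.coe_smul]
    refine Finset.sum_congr rfl fun i _ => ?_
    congr 1
    exact Submodule.inner_orthogonalProjectionOnto_eq_of_mem_left _ _
  have hbo : Orthonormal ℂ fun i => (b (Fin.castLE hWS i) : X) :=
    (b.orthonormal.comp_linearIsometry W.subtypeₗᵢ).comp _ (Fin.castLE_injective hWS)
  refine ⟨fun i => (e i : H), fun i => (b (Fin.castLE hWS i) : X), fun i => ‖B (e i)‖,
    e.orthonormal.comp_linearIsometry S.subtypeₗᵢ, hbo,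
    fun i => (e i).2, fun i => (b _).2, fun i => norm_nonneg _, fun i => ?_, hpr⟩
  rw [hpr, Finset.sum_eq_single i]
  · rw [← hBi _ _ (b _).2]
    nth_rewrite 1 [hw i]
    have h1 : ‖(b (Fin.castLE hWS i) : X)‖ = 1 := hbo.1 i
    rw [inner_smul_left, Complex.conj_ofReal, inner_self_eq_ofReal, h1]
    simp
  · intro j _ hji
    rw [← hBi _ _ (b _).2, hw j, inner_smul_left, hbo.2 hji, mul_zero, zero_smul]
  · simp

theorem exists_perturbed_inverse (A : X →L[ℂ] H) (W : Submodule ℂ X) (S : Submodule ℂ H)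
    [FiniteDimensional ℂ W] [FiniteDimensional ℂ S]
    (hWS : Module.finrank ℂ S ≤ Module.finrank ℂ W) {ε : ℝ} (hε : 0 < ε) :
    ∃ (D : X →L[ℂ] H) (R : H →L[ℂ] X), Blk W S D ∧ Blk S W R ∧ ‖D‖ ≤ ε ∧ ‖R‖ ≤ ε⁻¹ ∧
      ∀ x, pr S ((A + D) (R x)) = pr S x := by
  obtain ⟨s, w, σ, hs, hw, hsS, hwW, hσ, hA, hpr⟩ := exists_singular_pairs A W S hWS
  obtain ⟨D, hD, hDn⟩ := exists_diagonal hw hs (fun _ => (ε : ℂ)) hε.le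
    (fun _ => by simp [abs_of_pos hε])
  obtain ⟨R, hR, hRn⟩ := exists_diagonal hs hw (fun i => (((σ i + ε)⁻¹ : ℝ) : ℂ))
    (inv_pos.2 hε).le (fun i => by
      rw [Complex.norm_real, Real.norm_of_nonneg (by have := hσ i; positivity)]
      exact inv_anti₀ hε (by linarith [hσ i]))
  have hDw : ∀ i, D (w i) = (ε : ℂ) • s i := fun i => by
    classical
    rw [hD, Finset.sum_eq_single i]
    · rw [inner_self_eq_norm_sq_to_K, hw.1 i]; simp
    · intro j _ hji
      rw [hw.2 hji, mul_zero, zero_smul]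
    · simp
  refine ⟨D, R, ⟨fun x => ?_, fun x hx => ?_⟩, ⟨fun x => ?_, fun x hx => ?_⟩, hDn, hRn,
    fun x => ?_⟩
  · rw [hD]
    exact S.sum_mem fun i _ => S.smul_mem _ (hsS i)
  · rw [hD]
    refine Finset.sum_eq_zero fun i _ => ?_
    rw [(Submodule.mem_orthogonal _ _).1 hx _ (hwW i), mul_zero, zero_smul]
  · rw [hR]
    exact W.sum_mem fun i _ => W.smul_mem _ (hwW i)
  · rw [hR]
    refine Finset.sum_eq_zero fun i _ => ?_
    rw [(Submodule.mem_orthogonal _ _).1 hx _ (hsS i), mul_zero, zero_smul]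
  · rw [hR, map_sum, map_sum, hpr x]
    refine Finset.sum_congr rfl fun i _ => ?_
    have h1 : σ i + ε ≠ 0 := by have := hσ i; positivity
    have h2 : ((σ i : ℂ) + (ε : ℂ)) ≠ 0 := by exact_mod_cast h1
    rw [map_smul, map_smul, add_apply, map_add, hA, hDw, map_smul, pr_of_mem (hsS i), ← add_smul,
      smul_smul]
    congr 1
    push_cast
    field_simp

theorem exists_surplus_inverse (A : X →L[ℂ] H) (V : Submodule ℂ X) {M L N : Submodule ℂ H}
    (hM : IsClosed (M : Set H)) (hL : IsClosed (L : Set H)) (hN : IsClosed (N : Set H))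
    (hML : M ≤ L) (hLN : L ≤ N) (hA : ∀ x ∈ V, A x ∈ N) [FiniteDimensional ℂ V]
    [FiniteDimensional ℂ ↥(gap M N)]
    (hdim : Module.finrank ℂ ↥(gap M N) ≤ Module.finrank ℂ V) {ε : ℝ} (hε : 0 < ε) :
    ∃ (D : X →L[ℂ] H) (R : H →L[ℂ] X), Blk V (gap L N) D ∧ Blk (gap L N) V R ∧ ‖D‖ ≤ ε ∧
      ‖R‖ ≤ ε⁻¹ ∧ ∀ x, (A + D) (R x) - pr (gap L N) x ∈ M := by
  have : FiniteDimensional ℂ ↥(gap M L) := finiteDimensional_gap_of_le le_rfl hLN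
  have : FiniteDimensional ℂ ↥(gap L N) := finiteDimensional_gap_of_le hML le_rfl
  have hadd := finrank_gap_add hM hML hLN
  let f : V →ₗ[ℂ] ↥(gap M L) :=
    LinearMap.codRestrict (gap M L) (((pr (gap M L)).comp A).toLinearMap.comp V.subtype)
      fun x => pr_mem (isClosed_gap hL) _
  let W : Submodule ℂ X := (LinearMap.ker f).map V.subtype
  have hW : Module.finrank ℂ W = Module.finrank ℂ (LinearMap.ker f) :=
    Submodule.finrank_map_subtype_eq V _
  have hrn := f.finrank_range_add_finrank_ker
  have hr := Submodule.finrank_le (LinearMap.range f)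
  have hWV : W ≤ V := Submodule.map_subtype_le _ _
  have hWz : ∀ x ∈ W, pr (gap M L) (A x) = 0 := by
    rintro _ ⟨x, hx, rfl⟩
    exact congrArg Subtype.val (LinearMap.mem_ker.1 hx)
  have : FiniteDimensional ℂ W := Submodule.finiteDimensional_of_le hWV
  obtain ⟨D, R, hD, hR, hDn, hRn, hs⟩ := exists_perturbed_inverse A W (gap L N) (by omega) hε
  refine ⟨D, R, hD.mono hWV le_rfl, hR.mono le_rfl hWV, hDn, hRn, fun x => ?_⟩
  have h1 : (A + D) (R x) ∈ N := N.add_mem (hA _ (hWV (hR.1 x))) (hD.1 _).1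
  have h2 : pr (gap M L) ((A + D) (R x)) = 0 := by
    rw [add_apply, map_add, hWz _ (hR.1 x), zero_add]
    exact pr_of_orth ((isOrtho_gap le_rfl).symm.le (hD.1 _))
  have h3 := hs x
  rw [pr_gap hM hL hML, sub_eq_zero] at h2
  rw [pr_gap hL hN hLN, pr_of_mem h1, h2] at h3
  rw [← h3, sub_sub_cancel]
  exact pr_mem hM _

end SingularValues

section DecreasingChains

/-- There are `q + 1` indices between `a` and `b` along which `d` increases strictly, by weakly
decreasing amounts. -/
def DecChain (d : ℕ → ℕ) (q a : ℕ) (b : ℕ∞) : Prop :=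
  ∃ c : ℕ → ℕ, (∀ j ≤ q, a ≤ c j ∧ (c j : ℕ∞) ≤ b) ∧ (∀ j < q, d (c j) < d (c (j + 1))) ∧
    ∀ j, j + 2 ≤ q → d (c (j + 2)) + d (c j) ≤ 2 * d (c (j + 1))

theorem DecChain.mono {d : ℕ → ℕ} {q a a' : ℕ} {b b' : ℕ∞} (h : DecChain d q a b) (ha : a' ≤ a)
    (hb : b ≤ b') : DecChain d q a' b' := by
  obtain ⟨c, h1, h2, h3⟩ := h
  exact ⟨c, fun j hj => ⟨ha.trans (h1 j hj).1, (h1 j hj).2.trans hb⟩, h2, h3⟩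

theorem decChain_of_run {d : ℕ → ℕ} (hd : Monotone d) {m q a n : ℕ} {b : ℕ∞} (hq : 1 ≤ q)
    (hm : 4 * ((q + 1) * (q + 2)) ≤ m) (han : a ≤ n)
    (hrun : ∀ k, n ≤ k → ((k + 1 : ℕ) : ℕ∞) ≤ b → m * d (k + 1) + d a < d k + m * d k)
    (h : DecChain d q n b) : DecChain d (q + 1) a b := by
  classical
  obtain ⟨c, h1, h2, h3⟩ := h
  have hdan := hd han
  by_cases hA : d (c 1) + d a ≤ 2 * d n
  · have hn0 : d n ≤ d (c 0) := hd (h1 0 (Nat.zero_le _)).1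
    have h01 := h2 0 (by omega)
    refine ⟨fun j => Nat.casesOn j a c, fun j hj => ?_, fun j hj => ?_, fun j hj => ?_⟩
    · cases j with
      | zero => exact ⟨le_rfl, le_trans (by exact_mod_cast han.trans (h1 0 (by omega)).1)
          (h1 0 (by omega)).2⟩
      | succ j => exact ⟨han.trans (h1 j (by omega)).1, (h1 j (by omega)).2⟩
    · cases j with
      | zero =>
        change d a < d (c 0)
        simp only [zero_add] at h01
        omega
      | succ j => exact h2 j (by omega)
    · cases j with
      | zero =>
        change d (c 1) + d a ≤ 2 * d (c 0)
        omega
      | succ j => exact h3 j (by omega)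
  · push Not at hA
    set s := d n - d a with hs
    obtain ⟨η, hη⟩ : ∃ η, η = 2 * s / m := ⟨_, rfl⟩
    have hm0 : 0 < m := lt_of_lt_of_le (by positivity) hm
    have hb1 : ∀ k ≤ c 1, (k : ℕ∞) ≤ b := fun k hk =>
      le_trans (by exact_mod_cast hk) (h1 1 hq).2
    have hjump : ∀ k, n ≤ k → k + 1 ≤ c 1 → d k ≤ d n + s → d (k + 1) ≤ d k + η := by
      intro k hk hk1 hds
      have h4 := hrun k hk (hb1 _ hk1)
      obtain ⟨j, hj⟩ := Nat.exists_eq_add_of_le (hd (Nat.le_succ k))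
      rw [Nat.succ_eq_add_one] at hj
      rw [hj, Nat.mul_add] at h4
      have h5 : j ≤ η := hη ▸ (Nat.le_div_iff_mul_le hm0).2 (by rw [mul_comm]; omega)
      omega
    have hη0 : 0 < η := by
      by_contra h0
      have h0' : η = 0 := Nat.eq_zero_of_not_pos h0
      have h4 : ∀ k, n ≤ k → k ≤ c 1 → d k = d n := by
        intro k hk
        induction k, hk using Nat.le_induction with
        | base => exact fun _ => rfl
        | succ k hk ih =>
          intro hk1
          have h5 := ih (by omega)
          have h6 := hjump k hk hk1 (by omega)
          have h7 := hd (Nat.le_succ k)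
          rw [Nat.succ_eq_add_one] at h7
          omega
      have h5 := h4 (c 1) (h1 1 hq).1 le_rfl
      omega
    have hms : m * η ≤ 2 * s := hη ▸ Nat.mul_div_le _ _
    let t : ℕ → ℕ := fun i => ∑ l ∈ Finset.range i, 2 * (q + 2 - l) * η
    have ht1 : ∀ i, t (i + 1) = t i + 2 * (q + 2 - i) * η := fun i => Finset.sum_range_succ _ _
    have htm : Monotone t := monotone_nat_of_le_succ fun i => by rw [ht1]; omega
    have htq : t (q + 1) ≤ s := by
      have h4 : t (q + 1) ≤ (q + 1) * (2 * (q + 2) * η) := by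
        refine (Finset.sum_le_card_nsmul _ _ (2 * (q + 2) * η) fun l _ => ?_).trans_eq (by simp)
        gcongr
        omega
      have h5 : 4 * ((q + 1) * (q + 2)) * η ≤ m * η := Nat.mul_le_mul_right _ hm
      nlinarith
    have hex : ∀ i, i ≤ q + 1 → ∃ k, n ≤ k ∧ k ≤ c 1 ∧ d n + t i ≤ d k ∧ d k ≤ d n + t i + η := by
      intro i hi
      have hti := (htm hi).trans htq
      have hex' : ∃ k, n ≤ k ∧ d n + t i ≤ d k := ⟨c 1, (h1 1 hq).1, by omega⟩
      obtain ⟨hk1, hk2⟩ := Nat.find_spec hex'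
      have hk3 : Nat.find hex' ≤ c 1 := Nat.find_min' hex' ⟨(h1 1 hq).1, by omega⟩
      refine ⟨Nat.find hex', hk1, hk3, hk2, ?_⟩
      rcases hk1.eq_or_lt with h4 | h4
      · rw [← h4]; omega
      · obtain ⟨k, hk⟩ : ∃ k, Nat.find hex' = k + 1 := Nat.exists_eq_succ_of_ne_zero (by omega)
        have h5 := Nat.find_min hex' (m := k) (by omega)
        push Not at h5
        have h6 := h5 (by omega)
        rw [hk] at hk3 ⊢
        have h7 := hjump k (by omega) hk3 (by omega)
        omega
    choose! κ hκ1 hκ2 hκ3 hκ4 using hex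
    have hstep : ∀ i, i ≤ q → ∃ p, q + 2 - i = p + 2 ∧ 2 * (q + 2 - i) * η = 2 * (p * η) + 4 * η := by
      intro i hi
      refine ⟨q - i, by omega, ?_⟩
      rw [show q + 2 - i = q - i + 2 by omega]
      ring
    refine ⟨κ, fun j hj => ⟨han.trans (hκ1 j hj), hb1 _ (hκ2 j hj)⟩, fun j hj => ?_, fun j hj => ?_⟩
    · have h4 := hκ4 j (by omega)
      have h5 := hκ3 (j + 1) (by omega)
      obtain ⟨p, -, hp⟩ := hstep j (by omega)
      rw [ht1, hp] at h5
      omega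
    · have h4 := hκ4 (j + 2) (by omega)
      have h5 := hκ3 (j + 1) (by omega)
      have h6 := hκ4 j (by omega)
      have h7 := ht1 j
      have h8 := ht1 (j + 1)
      obtain ⟨p, hp1, hp⟩ := hstep j (by omega)
      obtain ⟨p', hp1', hp'⟩ := hstep (j + 1) (by omega)
      have h9 : p = p' + 1 := by omega
      rw [hp] at h7
      rw [hp'] at h8
      subst h9
      have h10 : (p' + 1) * η = p' * η + η := by ring
      rw [h10] at h7
      have h11 : t (j + 2) = t (j + 1 + 1) := rfl
      omega

end DecreasingChains

section ChainInduction

theorem exists_run_step (d : ℕ → ℕ) (m a : ℕ) {b : ℕ∞} {n : ℕ} (hn : (n : ℕ∞) ≤ b) :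
    ∃ u v : ℕ, n ≤ u ∧ u ≤ v ∧ (v : ℕ∞) ≤ b ∧
      (∀ k, n ≤ k → k + 1 ≤ u → m * d (k + 1) + d a < d k + m * d k) ∧
      ((v = u + 1 ∧ d u + m * d u ≤ m * d (u + 1) + d a) ∨
        (u = n ∧ v = n ∧
          ∀ k, n ≤ k → ((k + 1 : ℕ) : ℕ∞) ≤ b → m * d (k + 1) + d a < d k + m * d k)) := by
  classical
  by_cases h : ∃ k, n ≤ k ∧ ((k + 1 : ℕ) : ℕ∞) ≤ b ∧ d k + m * d k ≤ m * d (k + 1) + d a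
  · obtain ⟨h1, h2, h3⟩ := Nat.find_spec h
    refine ⟨Nat.find h, Nat.find h + 1, h1, Nat.le_succ _, h2, fun k hk hk1 => ?_,
      Or.inl ⟨rfl, h3⟩⟩
    have h4 := Nat.find_min h (m := k) (by omega)
    push Not at h4
    exact h4 hk (le_trans (by exact_mod_cast hk1.trans (Nat.le_succ _)) h2)
  · push Not at h
    exact ⟨n, n, le_rfl, le_rfl, hn, fun k hk hk1 => absurd hk1 (by omega),
      Or.inr ⟨rfl, rfl, h⟩⟩

variable {X H : Type*} [NormedAddCommGroup X] [InnerProductSpace ℂ X] [CompleteSpace X]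
  [NormedAddCommGroup H] [InnerProductSpace ℂ H] [CompleteSpace H]

theorem exists_solv_of_not_decChain {Y : ℕ∞ → Submodule ℂ X} {G : ℕ∞ → Submodule ℂ H}
    (hYm : Monotone Y) (hGm : Monotone G) (hY : ∀ i, IsClosed (Y i : Set X))
    (hG : ∀ i, IsClosed (G i : Set H)) (hYf : ∀ k : ℕ, FiniteDimensional ℂ (Y k))
    (hGf : ∀ k : ℕ, FiniteDimensional ℂ (G k))
    (hGtop : G ⊤ ≤ (⨆ k : ℕ, G k).topologicalClosure) {A : X →L[ℂ] H} (hA : Tri Y G A)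
    {d : ℕ → ℕ} (hd : Monotone d) {m : ℕ}
    (hGd : ∀ a b : ℕ, a ≤ b → m * Module.finrank ℂ (gap (G a) (G b)) + d a + 1 ≤ d b + m)
    (hYd : ∀ k : ℕ, Module.finrank ℂ (gap (G k) (G (k + 1 : ℕ))) + d (k + 1) ≤
      Module.finrank ℂ (gap (Y k) (Y (k + 1 : ℕ))) + d k)
    {q : ℕ} (hq : 1 ≤ q) (hm : 4 * (q * (q + 1)) ≤ m) {ε : ℝ} (hε : 0 < ε) :
    ∃ K : ℝ, 0 ≤ K ∧ ∀ (a : ℕ) (b : ℕ∞), (a : ℕ∞) ≤ b → ¬ DecChain d q a b →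
      Solv Y G A ε K a b := by
  induction q, hq using Nat.le_induction generalizing ε with
  | base =>
    refine ⟨0, le_rfl, fun a b hab h => ?_⟩
    have hda : ∀ k : ℕ, a ≤ k → (k : ℕ∞) ≤ b → d k = d a := fun k hk hkb => by
      by_contra hne
      refine h ⟨fun j => if j = 0 then a else k, fun j hj => ?_, fun j hj => ?_, fun j hj => ?_⟩
      · by_cases hj0 : j = 0
        · simp [hj0, hab]
        · simp [hj0, hk, hkb]
      · obtain rfl : j = 0 := by omega
        have := hd hk
        simp
        omega
      · omega
    have hGk : ∀ k : ℕ, a ≤ k → (k : ℕ∞) ≤ b → G k ≤ G a := fun k hk hkb => by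
      have h1 := hGd a k hk
      rw [hda k hk hkb] at h1
      have h2 : Module.finrank ℂ (gap (G a) (G k)) = 0 := by
        by_contra h3
        have h4 := Nat.mul_le_mul_left m (Nat.pos_of_ne_zero h3)
        omega
      have := hGf k
      have h3 : FiniteDimensional ℂ (gap (G a) (G k)) :=
        Submodule.finiteDimensional_of_le inf_le_left
      exact le_of_gap_eq_bot (hG _) (hG _) (hGm (by exact_mod_cast hk))
        (Submodule.finrank_eq_zero.1 h2)
    have hGb : G b ≤ G a := by
      induction b using ENat.recTopCoe with
      | top =>
        refine hGtop.trans (Submodule.topologicalClosure_minimal _ (iSup_le fun k => ?_) (hG _))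
        rcases le_total a k with hk | hk
        · exact hGk k hk le_top
        · exact hGm (by exact_mod_cast hk)
      | coe k => exact hGk k (by exact_mod_cast hab) le_rfl
    have hgap : gap (G a) (G b) = ⊥ := by
      refine eq_bot_iff.2 ((inf_le_inf_right _ hGb).trans ?_)
      rw [Submodule.inf_orthogonal_eq_bot]
    refine ⟨0, 0, fun i _ _ => (G i).zero_mem, fun i _ _ => (Y i).zero_mem, Blk.zero _ _,
      Blk.zero _ _, by simpa using hε.le, by simp, fun x => ?_⟩
    rw [hgap, pr_of_orth (by simp)]
    simp
  | succ q hq ih =>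
    obtain ⟨K₁, hK₁, ih⟩ := ih (le_trans (by gcongr <;> omega) hm) (ε := ε / 4) (by positivity)
    set K := max K₁ (ε / 4)⁻¹ with hK
    have hK0 : 0 ≤ K := hK₁.trans (le_max_left _ _)
    have hmpos : 0 < m := lt_of_lt_of_le (by positivity) hm
    set K₂ := 2 * K + K * (1 + (‖A‖ + 2 * (ε / 4)) * (2 * K)) with hK₂
    have hK₂0 : 0 ≤ K₂ := by positivity
    refine ⟨K₂ + K + K₂ * (‖A‖ + (2 * (ε / 4) + ε / 4)) * K, by positivity, fun a b hab hch => ?_⟩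
    have hstep := fun (n : ℕ) (hn : (n : ℕ∞) ≤ b) => exists_run_step d m a hn
    choose! nb nx h1 h2 h3 h4 h5 using hstep
    set α : ℕ → ℕ := fun j => nx^[j] a with hα
    have hα0 : α 0 = a := rfl
    have hαs : ∀ j, α (j + 1) = nx (α j) := fun j => Function.iterate_succ_apply' nx j a
    have hαb : ∀ j, (α j : ℕ∞) ≤ b := by
      intro j
      induction j with
      | zero => exact hab
      | succ j ih => rw [hαs]; exact h3 _ ih
    have hαm : Monotone α := monotone_nat_of_le_succ fun j => by
      rw [hαs]; exact (h1 _ (hαb j)).trans (h2 _ (hαb j))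
    have hrun : ∀ (j : ℕ) (e : ℕ∞), (α j : ℕ∞) ≤ e → e ≤ b →
        (∀ k, α j ≤ k → ((k + 1 : ℕ) : ℕ∞) ≤ e → m * d (k + 1) + d a < d k + m * d k) →
        Solv Y G A (ε / 4) K (α j) e := fun j e he heb hr =>
      (ih _ _ he fun hc => hch ((decChain_of_run hd hq hm (hαm (Nat.zero_le j)) hr hc).mono
        le_rfl heb)).mono le_rfl (le_max_left _ _)
    have hL : ∀ j, Solv Y G A (ε / 4) K (α j) (nb (α j)) := fun j =>
      hrun j _ (by exact_mod_cast h1 _ (hαb j))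
        (le_trans (by exact_mod_cast h2 _ (hαb j)) (h3 _ (hαb j)))
        fun k hk hk1 => h4 _ (hαb j) k hk (by exact_mod_cast hk1)
    have hom : ∀ c : ℕ∞, (∀ j, (α j : ℕ∞) ≤ c) →
        (G c ≤ (⨆ j, G (α j)).topologicalClosure) → Solv Y G A (2 * (ε / 4)) K₂ a c := by
      intro c hc hcs
      refine Solv.omega (a := fun j => (α j : ℕ∞)) (b := fun j => (nb (α j) : ℕ∞)) hYm hGm hY hG
        hA (by positivity) hK0 (fun j => by exact_mod_cast h1 _ (hαb j))
        (fun j => by rw [hαs]; exact_mod_cast h2 _ (hαb j)) hc hcs (fun i j => ?_) hL fun j => ?_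
      · rcases h5 _ (hαb j) with ⟨hv, -⟩ | ⟨hu, hv, -⟩
        · rcases le_or_gt i (nb (α j)) with h | h
          · exact Or.inl h
          · refine Or.inr ?_
            rw [hαs, hv]
            push_cast
            exact Order.add_one_le_of_lt h
        · rw [hαs, hu, hv]
          exact le_total _ _
      · rcases h5 _ (hαb j) with ⟨hv, hl⟩ | ⟨hu, hv, -⟩
        · rw [hαs, hv, hα0]
          set u := nb (α j) with hu
          have hau : a ≤ u := (hαm (Nat.zero_le j)).trans (h1 _ (hαb j))
          have hau1 : G a ≤ G u := hGm (by exact_mod_cast hau)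
          have huu : G u ≤ G (u + 1 : ℕ) := hGm (by exact_mod_cast Nat.le_succ u)
          have hf1 := hGf (u + 1)
          have hf2 := hYf (u + 1)
          have hf3 : FiniteDimensional ℂ (gap (G a) (G (u + 1 : ℕ))) :=
            Submodule.finiteDimensional_of_le inf_le_left
          have hf4 : FiniteDimensional ℂ (gap (Y u) (Y (u + 1 : ℕ))) :=
            Submodule.finiteDimensional_of_le inf_le_left
          have hdim : Module.finrank ℂ (gap (G a) (G (u + 1 : ℕ))) ≤
              Module.finrank ℂ (gap (Y u) (Y (u + 1 : ℕ))) := by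
            rw [← finrank_gap_add (hG _) hau1 huu]
            have e1 := hGd a u hau
            have e2 := hYd u
            have e3 := hd (Nat.le_succ u)
            rw [Nat.succ_eq_add_one] at e3
            obtain ⟨w, hw⟩ := Nat.exists_eq_add_of_le e3
            rw [hw, Nat.mul_add] at hl
            have e4 : Module.finrank ℂ (gap (G a) (G u)) < w + 1 :=
              Nat.lt_of_mul_lt_mul_left (a := m) (by rw [Nat.mul_add]; omega)
            omega
          obtain ⟨D, R, hD, hR, hDn, hRn, hs⟩ := exists_surplus_inverse A
            (gap (Y u) (Y (u + 1 : ℕ))) (M := G a) (L := G (α j)) (N := G (u + 1 : ℕ)) (hG _)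
            (hG _) (hG _) (hGm (by exact_mod_cast hαm (Nat.zero_le j)))
            (hGm (by exact_mod_cast (h1 _ (hαb j)).trans (Nat.le_succ u)))
            (fun x hx => hA _ x hx.1) hdim (ε := ε / 4) (by positivity)
          exact ⟨D, R, hD, hR, hDn, hRn.trans (le_max_right _ _), hs⟩
        · rw [hαs, hu, hv, hα0]
          refine ⟨0, 0, Blk.zero _ _, Blk.zero _ _, by rw [norm_zero]; positivity, by simpa using hK0,
            fun x => ?_⟩
          rw [show gap (G (α j)) (G (α j)) = ⊥ from Submodule.inf_orthogonal_eq_bot _,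
            pr_of_orth (by simp)]
          simp
    by_cases hst : ∃ J, ∀ k, α J ≤ k → ((k + 1 : ℕ) : ℕ∞) ≤ b →
        m * d (k + 1) + d a < d k + m * d k
    · obtain ⟨J, hJ⟩ := hst
      have hJc : ∀ i, α (J + i) = α J := by
        intro i
        induction i with
        | zero => rfl
        | succ i ih =>
          rw [← add_assoc, hαs, ih]
          rcases h5 _ (hαb J) with ⟨hv, hl⟩ | ⟨hu, hv, -⟩
          · have e1 := h3 _ (hαb J)
            rw [hv] at e1
            have e2 := hJ _ (h1 _ (hαb J)) e1
            omega
          · exact hv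
      have e1 := hom (α J) (fun j => by
        rcases le_total j J with h | h
        · exact_mod_cast hαm h
        · obtain ⟨i, rfl⟩ := Nat.exists_eq_add_of_le h
          rw [hJc]) ((le_iSup (fun j => G (α j)) J).trans (Submodule.le_topologicalClosure _))
      have e2 := hrun J b (hαb J) le_rfl hJ
      refine (Solv.concat hG hA (hYm ?_) (hYm (hαb J)) (hGm ?_) (hGm (hαb J)) e1 e2).mono
        (by linarith) le_rfl
      all_goals exact_mod_cast hαm (Nat.zero_le J)
    · have hsm : StrictMono α := strictMono_nat_of_lt_succ fun j => by
        rcases h5 _ (hαb j) with ⟨hv, -⟩ | ⟨-, -, hl⟩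
        · rw [hαs, hv]
          exact Nat.lt_succ_of_le (h1 _ (hαb j))
        · exact absurd ⟨j, hl⟩ hst
      obtain rfl : b = ⊤ := ENat.eq_top_iff_forall_ge.2 fun j =>
        le_trans (by exact_mod_cast hsm.le_apply) (hαb j)
      refine (hom ⊤ (fun _ => le_top) (hGtop.trans (Submodule.topologicalClosure_mono
        (iSup_le fun k => le_trans (hGm ?_) (le_iSup (fun j => G (α j)) k))))).mono
        (by linarith) ?_
      · exact_mod_cast hsm.le_apply
      · have : 0 ≤ K₂ * (‖A‖ + (2 * (ε / 4) + ε / 4)) * K := by positivity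
        linarith

end ChainInduction

section OneColor

variable {X H : Type*} [NormedAddCommGroup X] [InnerProductSpace ℂ X] [CompleteSpace X]
  [NormedAddCommGroup H] [InnerProductSpace ℂ H] [CompleteSpace H]

/-- Extends a sequence of subspaces by a subspace at infinity. -/
def extTop (Z : ℕ → Submodule ℂ H) (T : Submodule ℂ H) : ℕ∞ → Submodule ℂ H :=
  ENat.recTopCoe T Z

@[simp] theorem extTop_top (Z : ℕ → Submodule ℂ H) (T : Submodule ℂ H) : extTop Z T ⊤ = T := rfl

theorem extTop_mono {Z : ℕ → Submodule ℂ H} {T : Submodule ℂ H} (hZ : Monotone Z)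
    (hT : ∀ k, Z k ≤ T) : Monotone (extTop Z T) := by
  intro a b hab
  induction b using ENat.recTopCoe with
  | top =>
    induction a using ENat.recTopCoe with
    | top => exact le_rfl
    | coe k => exact hT k
  | coe l =>
    induction a using ENat.recTopCoe with
    | top => exact absurd hab (by simp)
    | coe k => exact hZ (by exact_mod_cast hab)

theorem extTop_forall {Z : ℕ → Submodule ℂ H} {T : Submodule ℂ H} {p : Submodule ℂ H → Prop}
    (hZ : ∀ k, p (Z k)) (hT : p T) (i : ℕ∞) : p (extTop Z T i) := by
  induction i using ENat.recTopCoe with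
  | top => exact hT
  | coe k => exact hZ k

theorem pr_closure (K : Submodule ℂ H) (x : H) : pr K.topologicalClosure x = pr K x := by
  refine pr_eq_of ?_ ?_
  · exact Submodule.starProjection_apply_mem _ x
  · rw [Submodule.orthogonal_closure]
    exact sub_pr_mem K x

theorem pr_mem_closure (K : Submodule ℂ H) (x : H) : pr K x ∈ K.topologicalClosure :=
  Submodule.starProjection_apply_mem _ x

theorem finrank_gap {A B : Submodule ℂ H} (h : A ≤ B) [FiniteDimensional ℂ B] :
    Module.finrank ℂ (gap A B) + Module.finrank ℂ A = Module.finrank ℂ B := by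
  rw [gap, inf_comm, add_comm]
  exact Submodule.finrank_add_inf_finrank_orthogonal h

theorem finrank_inf_ker {V : Submodule ℂ X} {W : Submodule ℂ H} [FiniteDimensional ℂ V]
    (T : X →ₗ[ℂ] H) (h : V.map T = W) :
    Module.finrank ℂ (V ⊓ LinearMap.ker T : Submodule ℂ X) + Module.finrank ℂ W =
      Module.finrank ℂ V := by
  have h1 := LinearMap.finrank_range_add_finrank_ker (T.domRestrict V)
  have h2 : LinearMap.range (T.domRestrict V) = W := by
    rw [← h, LinearMap.range_domRestrict]
  have h3 : (LinearMap.ker (T.domRestrict V)).map V.subtype = V ⊓ LinearMap.ker T := by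
    rw [LinearMap.ker_domRestrict]
    exact Submodule.map_comap_subtype _ _
  rw [h2, ← Submodule.finrank_map_subtype_eq, h3] at h1
  rw [add_comm]
  exact h1

theorem exists_next_color {Xf : ℕ → Submodule ℂ X} {Hf Uf Gf : ℕ → Submodule ℂ H}
    (hXm : Monotone Xf) (hGm : Monotone Gf) [∀ k, FiniteDimensional ℂ (Xf k)]
    [∀ k, FiniteDimensional ℂ (Hf k)] (hUH : ∀ k, Uf k ≤ Hf k) (hGH : ∀ k, Gf k ≤ Hf k)
    (hUG : ∀ i j, Uf i ⟂ Gf j)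
    (hpU : ∀ k, ∀ x ∈ Hf k, pr (⨆ k, Uf k) x ∈ Uf k)
    (hpG : ∀ k, ∀ x ∈ Hf k, pr (⨆ k, Gf k) x ∈ Gf k) (hG0 : Gf 0 = ⊥)
    {d : ℕ → ℕ} (hd : Monotone d) {m : ℕ} (hXd : ∀ k, Module.finrank ℂ (Xf k) = 2 * d k)
    (hGd : ∀ a b : ℕ, a ≤ b → m * Module.finrank ℂ (Gf b) + d a + 1 ≤
      d b + m + m * Module.finrank ℂ (Gf a))
    (hUd : ∀ k, Module.finrank ℂ (Uf (k + 1)) + Module.finrank ℂ (Gf (k + 1)) + d k ≤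
      Module.finrank ℂ (Uf k) + Module.finrank ℂ (Gf k) + d (k + 1))
    {q : ℕ} (hq : 1 ≤ q) (hm : 4 * (q * (q + 1)) ≤ m) (hch : ¬ DecChain d q 0 ⊤)
    {A : X →L[ℂ] H} (hA : Tri Xf Hf A) {C : H →L[ℂ] X} (hC : Tri Hf Xf C)
    (hs : ∀ x, pr (⨆ k, Uf k) (A (C x)) = pr (⨆ k, Uf k) x) {ε : ℝ} (hε : 0 < ε) :
    ∃ (Δ : X →L[ℂ] H) (C' : H →L[ℂ] X), Tri Xf Hf Δ ∧ Tri Hf Xf C' ∧ ‖Δ‖ ≤ ε ∧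
      ∀ x, pr (⨆ k, Uf k) ((A + Δ) (C' x)) = pr (⨆ k, Uf k) x ∧
        pr (⨆ k, Gf k) ((A + Δ) (C' x)) = pr (⨆ k, Gf k) x := by
  set U := ⨆ k, Uf k with hU
  set W := ⨆ k, Gf k with hW
  have hWU : ∀ x ∈ W.topologicalClosure, pr U x = 0 := fun x hx => by
    refine pr_of_orth ?_
    have h1 : W ≤ Uᗮ := iSup_le fun j => by
      rw [← Submodule.isOrtho_iff_le, Submodule.isOrtho_comm]
      exact Submodule.isOrtho_iSup_left.2 fun i => hUG i j
    exact Submodule.topologicalClosure_minimal _ h1 (Submodule.isClosed_orthogonal _) hx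
  have hUft : ∀ k, ∀ x ∈ Uf k, pr U x = x := fun k x hx => pr_of_mem (le_iSup Uf k hx)
  have hGft : ∀ k, ∀ x ∈ Gf k, pr W x = x := fun k x hx => pr_of_mem (le_iSup Gf k hx)
  let A' : X →L[ℂ] H := (pr U).comp A
  let C₁ : H →L[ℂ] X := C.comp (pr U)
  have hA'C : ∀ x, A' (C₁ x) = pr U x := fun x => by
    change pr U (A (C (pr U x))) = _
    rw [hs, pr_pr]
  have hA'U : ∀ k, ∀ x ∈ Xf k, A' x ∈ Uf k := fun k x hx => hpU k _ (hA k x hx)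
  have hC₁X : ∀ k, ∀ x ∈ Hf k, C₁ x ∈ Xf k := fun k x hx => hC k _ (hUH k (hpU k x hx))
  let Z : Submodule ℂ X := LinearMap.ker A'.toLinearMap
  have hZ : ∀ x, x ∈ Z ↔ A' x = 0 := fun x => LinearMap.mem_ker
  have hZc : IsClosed (Z : Set X) := A'.isClosed_ker
  let E : X →L[ℂ] X := ContinuousLinearMap.id ℂ X - C₁.comp A'
  have hE : ∀ x, E x = x - C₁ (A' x) := fun x => rfl
  have hEZ : ∀ x, E x ∈ Z := fun x => by
    rw [hZ, hE, map_sub, hA'C]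
    change A' x - pr U (pr U (A x)) = 0
    rw [pr_pr]
    exact sub_self _
  have hEX : ∀ k, ∀ x ∈ Xf k, E x ∈ Xf k := fun k x hx =>
    (Xf k).sub_mem hx (hC₁X k _ (hUH k (hA'U k x hx)))
  have hE1 : ∀ x ∈ Z, E x = x := fun x hx => by
    rw [hE, (hZ x).1 hx, map_zero, sub_zero]
  have hYk : ∀ k, Module.finrank ℂ (Xf k ⊓ Z : Submodule ℂ X) + Module.finrank ℂ (Uf k) =
      2 * d k := fun k => by
    rw [← hXd k]
    refine finrank_inf_ker A'.toLinearMap (le_antisymm ?_ fun x hx => ?_)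
    · rintro _ ⟨x, hx, rfl⟩
      exact hA'U k x hx
    · exact ⟨C₁ x, hC₁X k x (hUH k hx), (hA'C x).trans (hUft k x hx)⟩
  have hYfd : ∀ k, FiniteDimensional ℂ (Xf k ⊓ Z : Submodule ℂ X) := fun k =>
    Submodule.finiteDimensional_of_le inf_le_left
  have hGfd : ∀ k, FiniteDimensional ℂ (Gf k) := fun k =>
    Submodule.finiteDimensional_of_le (hGH k)
  have hYm : Monotone fun k => Xf k ⊓ Z := fun i j hij => inf_le_inf_right _ (hXm hij)
  let B : X →L[ℂ] H := (pr W).comp A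
  have hB : Tri (extTop (fun k => Xf k ⊓ Z) Z) (extTop Gf W.topologicalClosure) B := by
    intro i x hx
    induction i using ENat.recTopCoe with
    | top => exact pr_mem_closure _ _
    | coe k => exact hpG k _ (hA k x hx.1)
  have hgG : ∀ a b : ℕ, a ≤ b → Module.finrank ℂ (gap (Gf a) (Gf b)) +
      Module.finrank ℂ (Gf a) = Module.finrank ℂ (Gf b) := fun a b hab => finrank_gap (hGm hab)
  set δ := ε / (‖E‖ + 1) with hδ
  have hδ0 : 0 < δ := by positivity
  obtain ⟨K, -, hK⟩ := exists_solv_of_not_decChain (extTop_mono hYm fun k => inf_le_right)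
    (extTop_mono hGm fun k => (le_iSup Gf k).trans W.le_topologicalClosure)
    (extTop_forall (p := fun V : Submodule ℂ X => IsClosed (V : Set X))
      (fun k => Submodule.closed_of_finiteDimensional _) hZc)
    (extTop_forall (p := fun V : Submodule ℂ H => IsClosed (V : Set H))
      (fun k => Submodule.closed_of_finiteDimensional _) W.isClosed_topologicalClosure)
    hYfd hGfd le_rfl hB hd (m := m)
    (fun a b hab => by
      have h1 := hGd a b hab
      rw [← hgG a b hab, Nat.mul_add] at h1
      change m * Module.finrank ℂ (gap (Gf a) (Gf b)) + d a + 1 ≤ d b + m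
      omega)
    (fun k => by
      have h1 := finrank_gap (hYm (Nat.le_succ k))
      have h2 := hYk k
      have h3 := hYk (k + 1)
      have h4 := hgG k (k + 1) (Nat.le_succ k)
      have h5 := hUd k
      have h6 := hd (Nat.le_succ k)
      change Module.finrank ℂ (gap (Gf k) (Gf (k + 1))) + d (k + 1) ≤
        Module.finrank ℂ (gap (Xf k ⊓ Z) (Xf (k + 1) ⊓ Z)) + d k
      simp only [Nat.succ_eq_add_one] at h1 h6
      omega) hq hm hδ0
  obtain ⟨Δ, D, hΔt, hDt, hΔb, hDb, hΔn, -, hsol⟩ := hK 0 ⊤ (by simp) hch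
  have hG00 : extTop Gf W.topologicalClosure ((0 : ℕ) : ℕ∞) = ⊥ := hG0
  have hsol' : ∀ x, (B + Δ) (D x) = pr W x := fun x => by
    have h1 := hsol x
    rw [hG00, Submodule.mem_bot, sub_eq_zero, extTop_top,
      pr_gap (Submodule.closed_of_finiteDimensional _) W.isClosed_topologicalClosure bot_le,
      pr_closure, pr_of_orth (K := ⊥) (by simp),
      sub_zero] at h1
    exact h1
  have hΔW : ∀ x, Δ x ∈ W.topologicalClosure := fun x => (hΔb.1 x).1
  have hDZ : ∀ x, D x ∈ Z := fun x => (hDb.1 x).1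
  have hΔk : ∀ k, ∀ x ∈ Xf k, Δ (E x) ∈ Gf k := fun k x hx => hΔt k _ ⟨hEX k x hx, hEZ x⟩
  let T : X →L[ℂ] H := A + Δ.comp E
  have hT : Tri Xf Hf T := fun k x hx =>
    (Hf k).add_mem (hA k x hx) (hGH k (hΔk k x hx))
  have hDk : ∀ k, ∀ x ∈ Hf k, D (pr W x) ∈ Xf k := fun k x hx => (hDt k _ (hpG k x hx)).1
  have hUT : ∀ x, pr U (T x) = A' x := fun x => by
    change pr U (A x + Δ (E x)) = pr U (A x)
    rw [map_add, hWU _ (hΔW _), add_zero]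
  have hWT : ∀ x, pr W (T (D (pr W x))) = pr W x := fun x => by
    have h1 := hsol' (pr W x)
    rw [pr_pr] at h1
    change pr W (A (D (pr W x)) + Δ (E (D (pr W x)))) = pr W x
    rw [hE1 _ (hDZ _), map_add, show pr W (Δ (D (pr W x))) = Δ (D (pr W x)) by
      rw [← pr_closure]; exact pr_of_mem (hΔW _)]
    exact h1
  refine ⟨Δ.comp E, D.comp (pr W) + C₁ - (D.comp (pr W)).comp (T.comp C₁), fun k x hx =>
    hGH k (hΔk k x hx), fun k x hx => ?_, ?_, fun x => ?_⟩
  · exact (Xf k).sub_mem ((Xf k).add_mem (hDk k x hx) (hC₁X k x hx))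
      (hDk k _ (hT k _ (hC₁X k x hx)))
  · refine (ContinuousLinearMap.opNorm_comp_le _ _).trans ?_
    calc ‖Δ‖ * ‖E‖ ≤ δ * (‖E‖ + 1) := by gcongr; linarith
      _ = ε := by rw [hδ]; field_simp
  · have h1 : (D.comp (pr W) + C₁ - (D.comp (pr W)).comp (T.comp C₁)) x =
        D (pr W x) + C₁ x - D (pr W (T (C₁ x))) := rfl
    change pr U (T _) = _ ∧ pr W (T _) = _
    rw [h1]
    constructor
    · rw [hUT, map_sub, map_add, (hZ _).1 (hDZ _), (hZ _).1 (hDZ _), hA'C]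
      abel
    · rw [map_sub T, map_add T, map_sub (pr W), map_add (pr W), hWT, hWT]
      abel

end OneColor

section Coloring

theorem mul_count_mod_le {m t a b : ℕ} (ht : t < m) (hab : a ≤ b) :
    m * Nat.count (fun l => l % m = t) b + a + 1 ≤
      b + m + m * Nat.count (fun l => l % m = t) a := by
  have hc : ∀ n, m * Nat.count (fun l => l % m = t) n =
      m * (n / m) + if t < n % m then m else 0 := by
    intro n
    have h1 := Nat.count_modEq_card n (by omega : 0 < m) t
    have h2 : (fun l => l % m = t) = fun l => l ≡ t [MOD m] := by
      ext l
      rw [Nat.ModEq, Nat.mod_eq_of_lt ht]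
    simp only [h2]
    rw [h1, Nat.mod_eq_of_lt ht, Nat.mul_add]
    split_ifs <;> simp
  rw [hc, hc]
  have h1 := Nat.div_add_mod a m
  have h2 := Nat.div_add_mod b m
  have h3 := Nat.mod_lt a (by omega : m > 0)
  have h4 := Nat.mul_le_mul_left m (Nat.div_le_div_right (c := m) hab)
  split_ifs <;> omega

theorem count_add_le {p q : ℕ → Prop} [DecidablePred p] [DecidablePred q]
    (hpq : ∀ l, p l → ¬ q l) {a b : ℕ} (hab : a ≤ b) :
    Nat.count p b + Nat.count q b + a ≤ Nat.count p a + Nat.count q a + b := by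
  induction b, hab using Nat.le_induction with
  | base => exact le_rfl
  | succ b hb ih =>
    rw [Nat.count_succ, Nat.count_succ]
    have := hpq b
    split_ifs <;> first | omega | (exfalso; tauto)

variable {X H : Type*} [NormedAddCommGroup X] [InnerProductSpace ℂ X] [CompleteSpace X]
  [NormedAddCommGroup H] [InnerProductSpace ℂ H] [CompleteSpace H]

theorem pr_sup_of_isOrtho {U W : Submodule ℂ H} (h : U ⟂ W) (x : H) :
    pr (U ⊔ W) x = pr U x + pr W x := by
  have h1 : W.topologicalClosure ≤ Uᗮ :=
    Submodule.topologicalClosure_minimal _ h.symm.le (Submodule.isClosed_orthogonal _)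
  have h2 : U.topologicalClosure ≤ Wᗮ :=
    Submodule.topologicalClosure_minimal _ h.le (Submodule.isClosed_orthogonal _)
  rw [← pr_closure]
  refine pr_eq_of (Submodule.add_mem _ (Submodule.topologicalClosure_mono le_sup_left
    (pr_mem_closure U x)) (Submodule.topologicalClosure_mono le_sup_right
    (pr_mem_closure W x))) ?_
  rw [Submodule.orthogonal_closure, ← Submodule.inf_orthogonal]
  constructor
  · rw [← sub_sub]
    exact Submodule.sub_mem _ (sub_pr_mem U x) (h1 (pr_mem_closure W x))
  · rw [add_comm, ← sub_sub]
    exact Submodule.sub_mem _ (sub_pr_mem W x) (h2 (pr_mem_closure U x))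

theorem finrank_span_image_eq_count {e : ℕ → H} {n : ℕ}
    (he : ∀ l l', l < n → l' < n → inner ℂ (e l) (e l') = if l = l' then (1 : ℂ) else 0)
    (p : ℕ → Prop) [DecidablePred p] :
    Module.finrank ℂ (Submodule.span ℂ (e '' {l | l < n ∧ p l})) = Nat.count p n := by
  let := Nat.CountSet.fintype p n
  rw [Nat.count_eq_card_fintype]
  have h1 : e '' {l | l < n ∧ p l} = Set.range fun l : {l // l < n ∧ p l} => e l :=
    Set.image_eq_range _ _
  rw [h1]
  refine finrank_span_eq_card (Orthonormal.linearIndependent (𝕜 := ℂ) ?_)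
  rw [orthonormal_iff_ite]
  intro i j
  rw [he _ _ i.2.1 j.2.1]
  simp only [Subtype.ext_iff]

theorem exists_adapted_sequence {V : ℕ → Submodule ℂ H} (hV : Monotone V)
    [∀ k, FiniteDimensional ℂ (V k)] (hV0 : V 0 = ⊥) :
    ∃ e : ℕ → H, (∀ l l', (∃ k, l < Module.finrank ℂ (V k)) → (∃ k, l' < Module.finrank ℂ (V k)) →
      inner ℂ (e l) (e l') = if l = l' then (1 : ℂ) else 0) ∧
      ∀ k, V k = Submodule.span ℂ (e '' {l | l < Module.finrank ℂ (V k)}) := by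
  classical
  set d : ℕ → ℕ := fun k => Module.finrank ℂ (V k) with hd
  have hdm : Monotone d := fun i j hij => Submodule.finrank_mono (hV hij)
  have hd0 : d 0 = 0 := by simp [hd, hV0]
  have hgap : ∀ k, Module.finrank ℂ (gap (V k) (V (k + 1))) + d k = d (k + 1) := fun k =>
    finrank_gap (hV (Nat.le_succ k))
  have : ∀ k, FiniteDimensional ℂ (gap (V k) (V (k + 1))) := fun k =>
    Submodule.finiteDimensional_of_le inf_le_left
  have hbas : ∀ k, ∃ u : ℕ → H, (∀ j, j + d k < d (k + 1) → u j ∈ gap (V k) (V (k + 1))) ∧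
      ∀ j j', j + d k < d (k + 1) → j' + d k < d (k + 1) →
        inner ℂ (u j) (u j') = if j = j' then (1 : ℂ) else 0 := by
    intro k
    let b := stdOrthonormalBasis ℂ (gap (V k) (V (k + 1)))
    have hk := hgap k
    refine ⟨fun j => if h : j < Module.finrank ℂ (gap (V k) (V (k + 1))) then (b ⟨j, h⟩ : H) else 0,
      fun j hj => ?_, fun j j' hj hj' => ?_⟩
    · beta_reduce
      rw [dif_pos (by omega)]
      exact (b _).2
    · beta_reduce
      rw [dif_pos (by omega), dif_pos (by omega), ← Submodule.coe_inner,
        orthonormal_iff_ite.1 b.orthonormal]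
      simp
  choose u hu1 hu2 using hbas
  have hlev : ∀ l, (∃ k, l < d k) → ∃ k, d k ≤ l ∧ l < d (k + 1) := by
    intro l h
    have h1 : Nat.find h ≠ 0 := fun h2 => by
      have := Nat.find_spec h
      rw [h2] at this
      omega
    obtain ⟨k, hk⟩ := Nat.exists_eq_succ_of_ne_zero h1
    refine ⟨k, not_lt.1 (Nat.find_min h (by omega)), ?_⟩
    have := Nat.find_spec h
    rwa [hk] at this
  choose! κ hκ1 hκ2 using hlev
  let e : ℕ → H := fun l => u (κ l) (l - d (κ l))
  have heg : ∀ l, (∃ k, l < d k) → e l ∈ gap (V (κ l)) (V (κ l + 1)) := fun l hl =>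
    hu1 _ _ (by have := hκ1 l hl; have := hκ2 l hl; omega)
  have hlt : ∀ l l', (∃ k, l < d k) → (∃ k, l' < d k) → κ l < κ l' →
      inner ℂ (e l) (e l') = (0 : ℂ) := fun l l' hl hl' h =>
    (isOrtho_gap (hV h)).inner_eq (heg l hl) (heg l' hl')
  have hon : ∀ l l', (∃ k, l < d k) → (∃ k, l' < d k) →
      inner ℂ (e l) (e l') = if l = l' then (1 : ℂ) else 0 := by
    intro l l' hl hl'
    have h1 := hκ1 l hl
    have h2 := hκ2 l hl
    have h3 := hκ1 l' hl'
    have h4 := hκ2 l' hl'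
    rcases lt_trichotomy (κ l) (κ l') with h | h | h
    · rw [hlt l l' hl hl' h, if_neg]
      rintro rfl
      exact lt_irrefl _ h
    · rw [show e l = u (κ l') (l - d (κ l')) by simp only [e, h], hu2]
      · refine if_congr ?_ rfl rfl
        rw [h] at h1
        omega
      · rw [h] at h1 h2
        omega
      · omega
    · rw [← inner_conj_symm, hlt l' l hl' hl h, if_neg, map_zero]
      rintro rfl
      exact lt_irrefl _ h
  refine ⟨e, hon, fun k => ?_⟩
  symm
  refine Submodule.eq_of_le_of_finrank_eq (Submodule.span_le.2 ?_) ?_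
  · rintro _ ⟨l, hl, rfl⟩
    refine hV ?_ (heg l ⟨k, hl⟩).1
    by_contra h
    have h1 := hκ1 l ⟨k, hl⟩
    have h2 := hdm (show k ≤ κ l by omega)
    have h3 : l < d k := hl
    omega
  · have h1 := finrank_span_image_eq_count (e := e) (n := d k)
      (fun l l' hl hl' => hon l l' ⟨k, hl⟩ ⟨k, hl'⟩) (fun _ => True)
    have h2 : {l | l < d k ∧ (fun _ => True) l} = {l | l < d k} := by simp
    rw [h2] at h1
    rw [h1, Nat.count_true]

theorem pr_iSup_span_mem {e : ℕ → H} {d : ℕ → ℕ}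
    (he : ∀ l l', (∃ k, l < d k) → (∃ k, l' < d k) →
      inner ℂ (e l) (e l') = if l = l' then (1 : ℂ) else 0) (p : ℕ → Prop) {k : ℕ} {x : H}
    (hx : x ∈ Submodule.span ℂ (e '' {l | l < d k})) :
    pr (⨆ k, Submodule.span ℂ (e '' {l | l < d k ∧ p l})) x ∈
      Submodule.span ℂ (e '' {l | l < d k ∧ p l}) := by
  set V := ⨆ k, Submodule.span ℂ (e '' {l | l < d k ∧ p l}) with hV
  have h1 : Submodule.span ℂ (e '' {l | l < d k}) ≤
      (Submodule.span ℂ (e '' {l | l < d k ∧ p l})).comap (pr V).toLinearMap := by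
    refine Submodule.span_le.2 ?_
    rintro _ ⟨l, hl, rfl⟩
    change pr V (e l) ∈ Submodule.span ℂ (e '' {l | l < d k ∧ p l})
    by_cases hp : p l
    · have h2 : e l ∈ Submodule.span ℂ (e '' {l | l < d k ∧ p l}) :=
        Submodule.subset_span ⟨l, ⟨hl, hp⟩, rfl⟩
      rw [pr_of_mem (Submodule.mem_iSup_of_mem k h2)]
      exact h2
    · have h2 : V ⟂ Submodule.span ℂ {e l} := by
        refine Submodule.isOrtho_iSup_left.2 fun j => Submodule.isOrtho_span.2 ?_
        rintro _ ⟨l', ⟨hl', hp'⟩, rfl⟩ _ rfl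
        rw [he l' l ⟨j, hl'⟩ ⟨k, hl⟩, if_neg]
        rintro rfl
        exact hp hp'
      rw [pr_of_orth (h2.symm.le (Submodule.mem_span_singleton_self _))]
      exact zero_mem _
  exact h1 hx

theorem exists_perturbed_right_inverse {Xf : ℕ → Submodule ℂ X} {Hf : ℕ → Submodule ℂ H}
    (hXm : Monotone Xf) (hHm : Monotone Hf) [∀ k, FiniteDimensional ℂ (Xf k)]
    [∀ k, FiniteDimensional ℂ (Hf k)] (hH0 : Hf 0 = ⊥)
    (hXd : ∀ k, Module.finrank ℂ (Xf k) = 2 * Module.finrank ℂ (Hf k)) {q : ℕ} (hq : 1 ≤ q)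
    (hch : ¬ DecChain (fun k => Module.finrank ℂ (Hf k)) q 0 ⊤) {A : X →L[ℂ] H}
    (hA : Tri Xf Hf A) {ε : ℝ} (hε : 0 < ε) :
    ∃ (Δ : X →L[ℂ] H) (C : H →L[ℂ] X), Tri Xf Hf Δ ∧ Tri Hf Xf C ∧ ‖Δ‖ ≤ ε ∧
      ∀ x ∈ (⨆ k, Hf k).topologicalClosure, (A + Δ) (C x) = x := by
  obtain ⟨e, he, hes⟩ := exists_adapted_sequence hHm hH0
  set d : ℕ → ℕ := fun k => Module.finrank ℂ (Hf k) with hd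
  have hdm : Monotone d := fun i j hij => Submodule.finrank_mono (hHm hij)
  have hd0 : d 0 = 0 := by simp [hd, hH0]
  set m := 4 * (q * (q + 1)) with hm
  have hm0 : 0 < m := by positivity
  have hcount : ∀ (p : ℕ → Prop) [DecidablePred p] (k : ℕ),
      Module.finrank ℂ (Submodule.span ℂ (e '' {l | l < d k ∧ p l})) = Nat.count p (d k) :=
    fun p _ k => finrank_span_image_eq_count
      (fun l l' hl hl' => he l l' ⟨k, hl⟩ ⟨k, hl'⟩) p
  have hle : ∀ (p : ℕ → Prop) (k : ℕ), Submodule.span ℂ (e '' {l | l < d k ∧ p l}) ≤ Hf k :=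
    fun p k => by
      rw [hes k]
      exact Submodule.span_mono (Set.image_mono fun l hl => hl.1)
  have hpr : ∀ (p : ℕ → Prop) (k : ℕ), ∀ x ∈ Hf k,
      pr (⨆ k, Submodule.span ℂ (e '' {l | l < d k ∧ p l})) x ∈
        Submodule.span ℂ (e '' {l | l < d k ∧ p l}) := fun p k x hx =>
    pr_iSup_span_mem he p (by rw [hes k] at hx; exact hx)
  have key : ∀ t ≤ m, ∀ ε : ℝ, 0 < ε → ∃ (Δ : X →L[ℂ] H) (C : H →L[ℂ] X), Tri Xf Hf Δ ∧
      Tri Hf Xf C ∧ ‖Δ‖ ≤ ε ∧ ∀ x,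
      pr (⨆ k, Submodule.span ℂ (e '' {l | l < d k ∧ l % m < t})) ((A + Δ) (C x)) =
        pr (⨆ k, Submodule.span ℂ (e '' {l | l < d k ∧ l % m < t})) x := by
    intro t
    induction t with
    | zero =>
      intro _ ε hε
      refine ⟨0, 0, fun i _ _ => (Hf i).zero_mem, fun i _ _ => (Xf i).zero_mem, by simpa using hε.le,
        fun x => ?_⟩
      rw [pr_of_orth (x := x) (by simp)]
      simp
    | succ t ih =>
      intro ht ε hε
      obtain ⟨Δ, C, hΔ, hC, hΔn, hs⟩ := ih (by omega) (ε / 2) (by positivity)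
      have hUG : ∀ i j, Submodule.span ℂ (e '' {l | l < d i ∧ l % m < t}) ⟂
          Submodule.span ℂ (e '' {l | l < d j ∧ l % m = t}) := by
        intro i j
        refine Submodule.isOrtho_span.2 ?_
        rintro _ ⟨l, ⟨hl, hp⟩, rfl⟩ _ ⟨l', ⟨hl', hp'⟩, rfl⟩
        rw [he l l' ⟨i, hl⟩ ⟨j, hl'⟩, if_neg]
        rintro rfl
        omega
      obtain ⟨Δ', C', hΔ', hC', hΔn', hs'⟩ := exists_next_color
        (Uf := fun k => Submodule.span ℂ (e '' {l | l < d k ∧ l % m < t}))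
        (Gf := fun k => Submodule.span ℂ (e '' {l | l < d k ∧ l % m = t})) hXm
        (fun i j hij => Submodule.span_mono (Set.image_mono fun l hl =>
          ⟨hl.1.trans_le (hdm hij), hl.2⟩)) (hle _) (hle _) hUG (hpr _) (hpr _)
        (by simp [hd0]) hdm hXd
        (fun a b hab => by
          simp only [hcount]
          exact mul_count_mod_le (by omega) (hdm hab))
        (fun k => by
          simp only [hcount]
          exact count_add_le (fun l h1 h2 => by omega) (hdm (Nat.le_succ k)))
        hq hm.symm.le hch (hA.add hΔ) hC hs (ε := ε / 2) (by positivity)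
      refine ⟨Δ + Δ', C', hΔ.add hΔ', hC', (norm_add_le _ _).trans (by linarith), fun x => ?_⟩
      have h1 : (⨆ k, Submodule.span ℂ (e '' {l | l < d k ∧ l % m < t + 1})) =
          (⨆ k, Submodule.span ℂ (e '' {l | l < d k ∧ l % m < t})) ⊔
            ⨆ k, Submodule.span ℂ (e '' {l | l < d k ∧ l % m = t}) := by
        rw [← iSup_sup_eq]
        refine iSup_congr fun k => ?_
        rw [← Submodule.span_union, ← Set.image_union]
        congr 2
        ext l
        simp only [Set.mem_ofPred_eq, Set.mem_union]
        omega
      have h2 := pr_sup_of_isOrtho (Submodule.isOrtho_iSup_left.2 fun i =>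
        Submodule.isOrtho_iSup_right.2 fun j => hUG i j)
      rw [h1, h2, h2, ← add_assoc, (hs' x).1, (hs' x).2]
  obtain ⟨Δ, C, hΔ, hC, hΔn, hs⟩ := key m le_rfl ε hε
  refine ⟨Δ, C, hΔ, hC, hΔn, ?_⟩
  have h1 : (⨆ k, Submodule.span ℂ (e '' {l | l < d k ∧ l % m < m})) = ⨆ k, Hf k := by
    refine iSup_congr fun k => ?_
    rw [hes k]
    simp [Nat.mod_lt _ hm0, hd]
  rw [h1] at hs
  have h2 : (⨆ k, Hf k).topologicalClosure ≤
      LinearMap.ker ((A + Δ).comp C - ContinuousLinearMap.id ℂ H).toLinearMap := by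
    refine Submodule.topologicalClosure_minimal _ (iSup_le fun k x hx => ?_)
      (ContinuousLinearMap.isClosed_ker _)
    have h3 := hs x
    rw [pr_of_mem (le_iSup Hf k hx),
      pr_of_mem (le_iSup Hf k ((hA.add hΔ) k _ (hC k x hx)))] at h3
    exact LinearMap.mem_ker.2 (sub_eq_zero.2 h3)
  exact fun x hx => sub_eq_zero.1 (LinearMap.mem_ker.1 (h2 hx))

end Coloring

section Compress

variable {ι X H : Type*} [NormedAddCommGroup X] [InnerProductSpace ℂ X] [CompleteSpace X]
  [NormedAddCommGroup H] [InnerProductSpace ℂ H] [CompleteSpace H]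

theorem pr_gap_mem_of_mem {L M K : Submodule ℂ H} (hL : IsClosed (L : Set H))
    (hK : IsClosed (K : Set H)) (hLM : L ≤ M) (hMK : M ≤ K) {x : H} (hx : x ∈ M) :
    pr (gap L K) x ∈ gap L M := by
  rw [pr_gap hL hK (hLM.trans hMK), pr_of_mem (hMK hx)]
  exact ⟨M.sub_mem hx (hLM (pr_mem hL x)), sub_pr_mem L x⟩

theorem Tri.compress {Y : ι → Submodule ℂ X} {G : ι → Submodule ℂ H}
    (hYc : ∀ i, IsClosed (Y i : Set X)) (hGc : ∀ i, IsClosed (G i : Set H)) {f : ℕ → ι} {b : ι}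
    (hY : Monotone fun k => Y (f k)) (hYb : ∀ k, Y (f k) ≤ Y b) (hGb : ∀ k, G (f k) ≤ G b)
    (hcut : ∀ i, Y i ≤ Y (f 0) ∨ (∃ k, i = f k) ∨ G b ≤ G i) {T : X →L[ℂ] H}
    (hT : Tri (fun k => gap (Y (f 0)) (Y (f k))) (fun k => gap (G (f 0)) (G (f k))) T) :
    Tri Y G ((pr (gap (G (f 0)) (G b))).comp (T.comp (pr (gap (Y (f 0)) (Y b))))) := by
  intro i x hx
  simp only [ContinuousLinearMap.comp_apply]
  rcases hcut i with h | ⟨k, rfl⟩ | h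
  · rw [pr_of_orth (x := x) (Submodule.orthogonal_le inf_le_right
      (Submodule.le_orthogonal_orthogonal _ (h hx)))]
    simp
  · have h1 := hT k _ (pr_gap_mem_of_mem (hYc _) (hYc _) (hY (Nat.zero_le k)) (hYb k) hx)
    rw [pr_of_mem (gap_mono le_rfl (hGb k) h1)]
    exact h1.1
  · exact h (pr_mem (isClosed_gap (hGc b)) _).1

theorem exists_solv_piece {Y : ι → Submodule ℂ X} {G : ι → Submodule ℂ H}
    (hYc : ∀ i, IsClosed (Y i : Set X)) (hGc : ∀ i, IsClosed (G i : Set H)) {f : ℕ → ι} {b : ι}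
    (hY : Monotone fun k => Y (f k)) (hG : Monotone fun k => G (f k))
    (hYb : ∀ k, Y (f k) ≤ Y b) (hGb : ∀ k, G (f k) ≤ G b)
    (hsup : G b ≤ (⨆ k, G (f k)).topologicalClosure)
    (hcut : ∀ i, (Y i ≤ Y (f 0) ∧ G i ≤ G (f 0)) ∨ (∃ k, i = f k) ∨ (Y b ≤ Y i ∧ G b ≤ G i))
    [∀ k, FiniteDimensional ℂ (gap (Y (f 0)) (Y (f k)))]
    [∀ k, FiniteDimensional ℂ (gap (G (f 0)) (G (f k)))]
    (hd : ∀ k, Module.finrank ℂ (gap (Y (f 0)) (Y (f k))) =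
      2 * Module.finrank ℂ (gap (G (f 0)) (G (f k)))) {q : ℕ} (hq : 1 ≤ q)
    (hch : ¬ DecChain (fun k => Module.finrank ℂ (gap (G (f 0)) (G (f k)))) q 0 ⊤)
    {A : X →L[ℂ] H} (hA : Tri Y G A) {ε : ℝ} (hε : 0 < ε) :
    ∃ K, 0 ≤ K ∧ Solv Y G A ε K (f 0) b := by
  set PH := pr (gap (G (f 0)) (G b)) with hPH
  set PX := pr (gap (Y (f 0)) (Y b)) with hPX
  have hAc : Tri (fun k => gap (Y (f 0)) (Y (f k))) (fun k => gap (G (f 0)) (G (f k)))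
      (PH.comp A) := fun k x hx =>
    pr_gap_mem_of_mem (hGc _) (hGc _) (hG (Nat.zero_le k)) (hGb k) (hA _ x hx.1)
  obtain ⟨Δ, C, hΔ, hC, hΔn, hs⟩ := exists_perturbed_right_inverse
    (fun k l hkl => gap_mono le_rfl (hY hkl)) (fun k l hkl => gap_mono le_rfl (hG hkl))
    (Submodule.inf_orthogonal_eq_bot _) hd hq hch hAc hε
  have hsup' : ∀ x, PH x ∈ (⨆ k, gap (G (f 0)) (G (f k))).topologicalClosure := by
    intro x
    have h1 : (⨆ k, G (f k)).topologicalClosure ≤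
        ((⨆ k, gap (G (f 0)) (G (f k))).topologicalClosure).comap PH.toLinearMap := by
      refine Submodule.topologicalClosure_minimal _ (iSup_le fun k y hy => ?_)
        ((Submodule.isClosed_topologicalClosure _).preimage PH.continuous)
      exact Submodule.le_topologicalClosure _ (Submodule.mem_iSup_of_mem k
        (pr_gap_mem_of_mem (hGc _) (hGc _) (hG (Nat.zero_le k)) (hGb k) hy))
    have h2 := h1 (hsup (pr_mem (isClosed_gap (L := G (f 0)) (hGc b)) x).1)
    have h3 : PH (PH x) = PH x := pr_pr _ x
    rw [← h3]
    exact h2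
  have hCm : ∀ x, C (PH x) ∈ gap (Y (f 0)) (Y b) := by
    intro x
    have h1 : (⨆ k, gap (G (f 0)) (G (f k))).topologicalClosure ≤
        (gap (Y (f 0)) (Y b)).comap C.toLinearMap := by
      refine Submodule.topologicalClosure_minimal _ (iSup_le fun k y hy => ?_)
        ((isClosed_gap (hYc b)).preimage C.continuous)
      exact gap_mono le_rfl (hYb k) (hC k y hy)
    exact h1 (hsup' x)
  have hPHn : ‖PH‖ ≤ 1 := norm_pr_le _
  have hPXn : ‖PX‖ ≤ 1 := norm_pr_le _
  refine ⟨‖PX.comp (C.comp PH)‖, norm_nonneg _, PH.comp (Δ.comp PX), PX.comp (C.comp PH),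
    hΔ.compress hYc hGc hY hYb hGb fun i => ?_, hC.compress hGc hYc hG hGb hYb fun i => ?_,
    ⟨fun x => pr_mem (isClosed_gap (hGc b)) _, fun x hx => ?_⟩,
    ⟨fun x => pr_mem (isClosed_gap (hYc b)) _, fun x hx => ?_⟩, ?_, le_rfl, fun x => ?_⟩
  · rcases hcut i with h | h | h
    exacts [Or.inl h.1, Or.inr (Or.inl h), Or.inr (Or.inr h.2)]
  · rcases hcut i with h | h | h
    exacts [Or.inl h.2, Or.inr (Or.inl h), Or.inr (Or.inr h.1)]
  · simp [hPX, pr_of_orth hx]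
  · simp [hPH, pr_of_orth hx]
  · calc ‖PH.comp (Δ.comp PX)‖ ≤ ‖PH‖ * (‖Δ‖ * ‖PX‖) :=
          (ContinuousLinearMap.opNorm_comp_le _ _).trans (by
            gcongr
            exact ContinuousLinearMap.opNorm_comp_le _ _)
      _ ≤ 1 * (ε * 1) := by gcongr
      _ = ε := by ring
  · have h1 : PX (C (PH x)) = C (PH x) := pr_of_mem (hCm x)
    have h2 := hs (PH x) (hsup' x)
    simp only [ContinuousLinearMap.comp_apply, add_apply] at h2 ⊢
    rw [h1, h1]
    have h3 : PH (PH x) = PH x := pr_pr _ x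
    have h4 : A (C (PH x)) ∈ G b := hA b _ (hCm x).1
    have h5 : PH (A (C (PH x))) = A (C (PH x)) - pr (G (f 0)) (A (C (PH x))) := by
      rw [hPH, pr_gap (hGc _) (hGc _) (hGb 0), pr_of_mem h4]
    have h6 : PH (A (C (PH x))) + PH (Δ (C (PH x))) = PH x := by
      have h := congrArg PH h2
      have h' : PH (PH (A (C (PH x)))) = PH (A (C (PH x))) := pr_pr _ _
      rwa [map_add, h', h3] at h
    rw [eq_sub_of_add_eq' h6, h5]
    have h7 : A (C (PH x)) + (PH x - (A (C (PH x)) - pr (G (f 0)) (A (C (PH x))))) - PH x =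
      pr (G (f 0)) (A (C (PH x))) := by abel
    rw [h7]
    exact pr_mem (hGc _) _

end Compress

section Pairs

variable {H : Type*} [NormedAddCommGroup H] [InnerProductSpace ℂ H] [CompleteSpace H]

/-- The pairs of vectors with both entries in `N`, in the Hilbert space `H ⊕ H`. -/
def pairs (N : Submodule ℂ H) : Submodule ℂ (PiLp 2 fun _ : Fin 2 => H) where
  carrier := {x | ∀ i, x i ∈ N}
  add_mem' hx hy i := N.add_mem (hx i) (hy i)
  zero_mem' _ := N.zero_mem
  smul_mem' c _ hx i := N.smul_mem c (hx i)

theorem mem_pairs {N : Submodule ℂ H} {x : PiLp 2 fun _ : Fin 2 => H} :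
    x ∈ pairs N ↔ ∀ i, x i ∈ N := Iff.rfl

theorem pairs_mono {L N : Submodule ℂ H} (h : L ≤ N) : pairs L ≤ pairs N := fun _ hx i => h (hx i)

theorem isClosed_pairs {N : Submodule ℂ H} (hN : IsClosed (N : Set H)) :
    IsClosed (pairs N : Set (PiLp 2 fun _ : Fin 2 => H)) := by
  have h : (pairs N : Set (PiLp 2 fun _ : Fin 2 => H)) =
      ⋂ i, (fun x : PiLp 2 fun _ : Fin 2 => H => x i) ⁻¹' N := by
    ext x
    simp [mem_pairs]
  rw [h]
  exact isClosed_iInter fun i => hN.preimage (PiLp.continuous_apply 2 _ i)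

theorem pairs_orthogonal (N : Submodule ℂ H) : (pairs N)ᗮ = pairs Nᗮ := by
  ext x
  constructor
  · intro hx i u hu
    have h := hx (PiLp.single 2 i u) fun j => by
      by_cases hj : j = i
      · subst hj
        simpa using hu
      · simp [hj]
    rw [PiLp.inner_apply, Fin.sum_univ_two] at h
    fin_cases i <;> simpa [PiLp.single_apply, Pi.single_apply, apply_ite, ite_apply] using h
  · intro hx u hu
    rw [PiLp.inner_apply]
    exact Finset.sum_eq_zero fun i _ => hx i _ (hu i)

theorem gap_pairs (L N : Submodule ℂ H) : gap (pairs L) (pairs N) = pairs (gap L N) := by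
  rw [gap, pairs_orthogonal]
  ext x
  exact forall_and.symm

/-- The pairs with entries in `N` are the `N`-valued functions on two points. -/
def pairsEquiv (N : Submodule ℂ H) : pairs N ≃ₗ[ℂ] (Fin 2 → N) where
  toFun x i := ⟨x.1 i, x.2 i⟩
  invFun y := ⟨WithLp.toLp 2 fun i => (y i : H), fun i => (y i).2⟩
  map_add' _ _ := rfl
  map_smul' _ _ := rfl
  left_inv _ := rfl
  right_inv _ := rfl

theorem finiteDimensional_pairs (N : Submodule ℂ H) [FiniteDimensional ℂ N] :
    FiniteDimensional ℂ (pairs N) :=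
  (pairsEquiv N).symm.finiteDimensional

theorem finrank_pairs (N : Submodule ℂ H) [FiniteDimensional ℂ N] :
    Module.finrank ℂ (pairs N) = 2 * Module.finrank ℂ N := by
  rw [(pairsEquiv N).finrank_eq, Module.finrank_pi_fintype]
  simp [two_mul]

theorem sum_single_apply (y : PiLp 2 fun _ : Fin 2 => H) :
    ∑ i, (PiLp.single 2 i (y i) : PiLp 2 fun _ : Fin 2 => H) = y := by
  ext j
  rw [Fin.sum_univ_two]
  fin_cases j <;> simp

theorem not_decChain_of_bound {𝒩 : Set (Submodule ℂ H)} (h𝒩 : IsNest 𝒩) {Q : ℕ}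
    (hQ : ∀ q Nc, DChain 𝒩 q Nc → q ≤ Q) {f : ℕ → Submodule ℂ H} (hf : Monotone f)
    (hmem : ∀ k, f k ∈ 𝒩) (hfin : ∀ k, FiniteDimensional ℂ (gap (f 0) (f k))) :
    ¬ DecChain (fun k => Module.finrank ℂ (gap (f 0) (f k))) (Q + 1) 0 ⊤ := by
  rintro ⟨c, -, h2, h3⟩
  beta_reduce at h2 h3
  have hc : ∀ j < Q + 1, c j < c (j + 1) := fun j hj => by
    by_contra h
    have := Submodule.finrank_mono (gap_mono (le_refl (f 0)) (hf (not_lt.1 h)))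
    exact absurd (h2 j hj) (not_lt.2 this)
  have hadd : ∀ j < Q + 1, Module.finrank ℂ (gap (f 0) (f (c j))) +
      Module.finrank ℂ (gap (f (c j)) (f (c (j + 1)))) =
        Module.finrank ℂ (gap (f 0) (f (c (j + 1)))) := fun j hj =>
    finrank_gap_add (h𝒩.closed _ (hmem _)) (hf (Nat.zero_le _)) (hf (hc j hj).le)
  have hfd : ∀ j, FiniteDimensional ℂ (gap (f (c j)) (f (c (j + 1)))) := fun j =>
    finiteDimensional_gap_of_le (hf (Nat.zero_le _)) le_rfl
  have h := hQ (Q + 1) (fun j => f (c j)) ⟨fun j _ => hmem _, fun j hj => ?_, fun j hj1 hj => ?_⟩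
  · omega
  · refine lt_of_le_of_ne (hf (hc j hj).le) fun h => ?_
    have := h2 j hj
    beta_reduce at h
    rw [h] at this
    exact lt_irrefl _ this
  · obtain ⟨j, rfl⟩ := Nat.exists_eq_add_of_le' hj1
    have h4 := hadd j (by omega)
    have h5 := hadd (j + 1) (by omega)
    have h6 := h3 j (by omega)
    have := hfd j
    have := hfd (j + 1)
    change Module.rank ℂ ↥(gap (f (c (j + 1))) (f (c (j + 1 + 1)))) ≤
      Module.rank ℂ ↥(gap (f (c j)) (f (c (j + 1))))
    rw [← Module.finrank_eq_rank, ← Module.finrank_eq_rank]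
    rw [show j + 2 = j + 1 + 1 from rfl] at h6
    exact_mod_cast (by omega)

theorem rgDenseIn_two [TopologicalSpace.SeparableSpace H] {𝒩 : Set (Submodule ℂ H)}
    (h𝒩 : IsNest 𝒩) {Q : ℕ} (hQ : ∀ q Nc, DChain 𝒩 q Nc → q ≤ Q)
    (hatom : ∀ M ∈ 𝒩, ∀ N ∈ 𝒩, M < N → (∀ L ∈ 𝒩, ¬(M < L ∧ L < N)) →
      FiniteDimensional ℂ ↥(gap M N)) : RgDenseIn (nestAlg 𝒩) 2 := by
  obtain ⟨p, F, hF0, hFp, hFm, hF𝒩, hFd, hFs, hFc, -⟩ := exists_pieces h𝒩 hQ hatom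
  intro a ha ε hε
  let X := PiLp 2 fun _ : Fin 2 => H
  let A : X →L[ℂ] H := ∑ i, (a i).comp (PiLp.proj 2 (fun _ : Fin 2 => H) i)
  have hAx : ∀ x : X, A x = ∑ i, a i (x i) := fun x => by
    simp only [A, sum_apply, ContinuousLinearMap.comp_apply]
    rfl
  let Y : 𝒩 → Submodule ℂ X := fun N => pairs N.1
  let G : 𝒩 → Submodule ℂ H := fun N => N.1
  have hA : Tri Y G A := fun N x hx => by
    rw [hAx]
    exact Submodule.sum_mem _ fun i _ => ha i N.1 N.2 _ (hx i)
  have hGc : ∀ N, IsClosed (G N : Set H) := fun N => h𝒩.closed N.1 N.2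
  have hYc : ∀ N, IsClosed (Y N : Set X) := fun N => isClosed_pairs (hGc N)
  let f : ℕ → ℕ → 𝒩 := fun i k => ⟨F i k, hF𝒩 i k⟩
  have hle : ∀ i k, F i k ≤ F (i + 1) 0 := fun i k => by
    rw [hFs]
    exact (le_iSup (F i) k).trans (Submodule.le_topologicalClosure _)
  set δ : ℝ := ε / (2 * (p + 1)) with hδ
  have hδ0 : 0 < δ := by positivity
  have hstep : ∀ i, ∃ K, 0 ≤ K ∧ Solv Y G A δ K (f i 0) (f (i + 1) 0) := by
    intro i
    have hfd : ∀ k, FiniteDimensional ℂ (gap (G (f i 0)) (G (f i k))) := hFd i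
    have hYd : ∀ k, gap (Y (f i 0)) (Y (f i k)) = pairs (gap (F i 0) (F i k)) := fun k =>
      gap_pairs _ _
    have : ∀ k, FiniteDimensional ℂ (gap (Y (f i 0)) (Y (f i k))) := fun k => by
      rw [hYd]
      have := hFd i k
      exact finiteDimensional_pairs _
    refine exists_solv_piece hYc hGc (fun k l hkl => pairs_mono (hFm i hkl)) (hFm i)
      (fun k => pairs_mono (hle i k)) (hle i) (hFs i).le (fun N => ?_) (fun k => ?_)
      (Nat.le_add_left 1 Q) (not_decChain_of_bound h𝒩 hQ (hFm i) (hF𝒩 i) (hFd i)) hA hδ0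
    · rcases h𝒩.chain.total N.2 (hF𝒩 i 0) with h | h
      · exact Or.inl ⟨pairs_mono h, h⟩
      · rcases hFc i N.1 N.2 h with ⟨k, hk⟩ | hk
        · exact Or.inr (Or.inl ⟨k, Subtype.ext hk⟩)
        · have h1 : F (i + 1) 0 ≤ N.1 := by
            rw [hFs]
            exact Submodule.topologicalClosure_minimal _ (iSup_le hk) (hGc N)
          exact Or.inr (Or.inr ⟨pairs_mono h1, h1⟩)
    · rw [hYd]
      have := hFd i k
      exact finrank_pairs _
  have hm : Monotone fun i => F i 0 := monotone_nat_of_le_succ fun i => hle i 0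
  have hall : ∀ i : ℕ, ∃ K, 0 ≤ K ∧ Solv Y G A (i * δ) K (f 0 0) (f i 0) := by
    intro i
    induction i with
    | zero => exact ⟨0, le_rfl, Solv.refl (by simp) le_rfl _⟩
    | succ i ih =>
      obtain ⟨K, hK, h⟩ := ih
      obtain ⟨K', hK', h'⟩ := hstep i
      refine ⟨_, ?_, (Solv.concat hGc hA (pairs_mono (hm (Nat.zero_le i)))
        (pairs_mono (hm (Nat.le_succ i))) (hm (Nat.zero_le i)) (hm (Nat.le_succ i)) h h').mono
        (by push_cast; linarith) le_rfl⟩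
      positivity
  obtain ⟨K, -, Δ, C, hΔ, hC, -, -, hΔn, -, hs⟩ := hall (p + 1)
  have hone : ∀ x, (A + Δ) (C x) = x := fun x => by
    have h := hs x
    have h1 : gap (G (f 0 0)) (G (f (p + 1) 0)) = ⊤ := by
      change gap (F 0 0) (F (p + 1) 0) = ⊤
      rw [hF0, hFp]
      simp
    have h2 : G (f 0 0) = ⊥ := hF0
    rw [h1, pr_of_mem Submodule.mem_top, h2, Submodule.mem_bot, sub_eq_zero] at h
    exact h
  let ι : Fin 2 → H →L[ℂ] X := fun i => (PiLp.continuousLinearEquiv 2 ℂ fun _ : Fin 2 => H).symm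
    |>.toContinuousLinearMap.comp (ContinuousLinearMap.single ℂ (fun _ : Fin 2 => H) i)
  refine ⟨fun i => a i + Δ.comp (ι i), fun i => (PiLp.proj 2 (fun _ : Fin 2 => H) i).comp C,
    fun i N hN x hx => ?_, fun i N hN x hx => hC ⟨N, hN⟩ x hx i, fun i => ?_, ?_⟩
  · refine N.add_mem (ha i N hN x hx) (hΔ ⟨N, hN⟩ _ fun j => ?_)
    change (PiLp.single 2 i x : PiLp 2 fun _ : Fin 2 => H) j ∈ N
    by_cases hj : j = i
    · subst hj
      simpa using hx
    · simp [hj]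
  · have h1 : ‖Δ.comp (ι i)‖ ≤ ε / 2 := by
      refine ContinuousLinearMap.opNorm_le_bound _ (by positivity) fun x => ?_
      have h2 : ‖Δ‖ ≤ ε / 2 := hΔn.trans (le_of_eq (by rw [hδ]; push_cast; field_simp))
      refine (Δ.le_of_opNorm_le h2 _).trans (le_of_eq ?_)
      exact congrArg (ε / 2 * ·) (PiLp.norm_single 2 (fun _ : Fin 2 => H) i x)
    rw [sub_add_cancel_left, norm_neg]
    linarith
  · ext x
    have h1 := hone x
    have h2 : ∑ i, ι i ((C x) i) = C x := sum_single_apply (C x)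
    rw [add_apply, hAx, ← h2, map_sum, h2, ← Finset.sum_add_distrib] at h1
    rw [sum_apply]
    exact h1

end Pairs

section RankOne

variable {H : Type*} [NormedAddCommGroup H] [InnerProductSpace ℂ H] [CompleteSpace H]

theorem exists_isometry_single {e : ℕ → H} (he : Orthonormal ℂ e) :
    ∃ J : lp (fun _ : ℕ => ℂ) 2 →ₗᵢ[ℂ] H, (∀ l, J (lp.single 2 l 1) = e l) ∧
      ∀ K : Submodule ℂ H, IsClosed (K : Set H) → (∀ l, e l ∈ K) → ∀ y, J y ∈ K := by
  refine ⟨he.orthogonalFamily.linearIsometry, fun l => ?_, fun K hK heK y => ?_⟩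
  · rw [OrthogonalFamily.linearIsometry_apply_single]
    simp
  · refine mem_of_hasSum hK (he.orthogonalFamily.hasSum_linearIsometry y) fun l => ?_
    simpa using K.smul_mem _ (heK l)

theorem mul_apply_of_mul_eq_one {b c : H →L[ℂ] H} (hbc : b * c = 1) {N : Submodule ℂ H}
    [FiniteDimensional ℂ N] (hc : ∀ x ∈ N, c x ∈ N) {x : H} (hx : x ∈ N) : c (b x) = x := by
  have h : ∀ y, b (c y) = y := fun y => congrArg (fun T : H →L[ℂ] H => T y) hbc
  have hinj : Function.Injective (c.toLinearMap.restrict hc) := fun y z hyz => by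
    have h1 : c y = c z := congrArg Subtype.val hyz
    exact Subtype.ext (by rw [← h y, h1, h])
  obtain ⟨y, hy⟩ := LinearMap.injective_iff_surjective.1 hinj ⟨x, hx⟩
  have h1 : c y = x := congrArg Subtype.val hy
  rw [← h1, h]

theorem not_rgDenseIn_one_of_flag {𝒩 : Set (Submodule ℂ H)} {V : ℕ → Submodule ℂ H}
    (hV : Monotone V) [∀ k, FiniteDimensional ℂ (V k)] (hV0 : V 0 = ⊥) (hmem : ∀ k, V k ∈ 𝒩)
    {M : Submodule ℂ H} (hM𝒩 : M ∈ 𝒩) (hM : M = (⨆ k, V k).topologicalClosure)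
    (hcut : ∀ L ∈ 𝒩, (∃ k, L = V k) ∨ ∀ k, V k ≤ L) (hcl : ∀ N ∈ 𝒩, IsClosed (N : Set H))
    (hMi : ¬ FiniteDimensional ℂ M) : ¬ RgDenseIn (nestAlg 𝒩) 1 := by
  have hun : ∀ l, ∃ k, l < Module.finrank ℂ (V k) := by
    by_contra! hcon
    obtain ⟨B, hB⟩ := hcon
    have hbdd : BddAbove (Set.range fun k => Module.finrank ℂ (V k)) :=
      ⟨B, Set.forall_mem_range.2 hB⟩
    obtain ⟨k, hk⟩ := Nat.sSup_mem (Set.range_nonempty _) hbdd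
    have hle : ∀ j, V j ≤ V k := fun j => by
      have h1 : Module.finrank ℂ (V (max j k)) ≤ Module.finrank ℂ (V k) := by
        beta_reduce at hk
        rw [hk]
        exact le_csSup hbdd ⟨_, rfl⟩
      rw [Submodule.eq_of_le_of_finrank_le (hV (le_max_right j k)) h1]
      exact hV (le_max_left j k)
    refine hMi (Submodule.finiteDimensional_of_le (S₂ := V k) ?_)
    rw [hM]
    exact Submodule.topologicalClosure_minimal _ (iSup_le hle) (Submodule.closed_of_finiteDimensional _)
  obtain ⟨e, he, hes⟩ := exists_adapted_sequence hV hV0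
  have heo : ∀ l l', inner ℂ (e l) (e l') = if l = l' then (1 : ℂ) else 0 := fun l l' =>
    he l l' (hun l) (hun l')
  have hVM : ∀ k, V k ≤ M := fun k => by
    rw [hM]
    exact (le_iSup V k).trans (Submodule.le_topologicalClosure _)
  have hMle : ∀ K : Submodule ℂ H, IsClosed (K : Set H) → (∀ l, e l ∈ K) → M ≤ K := by
    intro K hK heK
    rw [hM]
    refine Submodule.topologicalClosure_minimal _ (iSup_le fun k => ?_) hK
    rw [hes k, Submodule.span_le]
    rintro _ ⟨l, -, rfl⟩
    exact heK l
  have heV : ∀ k l, l < Module.finrank ℂ (V k) → e l ∈ V k := fun k l hl => by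
    have := Submodule.subset_span (R := ℂ) (Set.mem_image_of_mem e
      (show l ∈ {l | l < Module.finrank ℂ (V k)} from hl))
    rwa [← hes k] at this
  have heM : ∀ l, e l ∈ M := fun l => by
    obtain ⟨k, hk⟩ := hun l
    exact hVM k (heV k l hk)
  have hMc := hcl M hM𝒩
  obtain ⟨J, hJ1, hJ2⟩ := exists_isometry_single (orthonormal_iff_ite.2 heo)
  obtain ⟨J', hJ1', hJ2'⟩ := exists_isometry_single (e := fun l => e (l + 1))
    (orthonormal_iff_ite.2 fun l l' => by simp [heo])
  have hJ'0 : ∀ y, inner ℂ (e 0) (J' y) = (0 : ℂ) := fun y =>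
    Submodule.mem_orthogonal_singleton_iff_inner_right.1
      (hJ2' (ℂ ∙ e 0)ᗮ (Submodule.isClosed_orthogonal _) (fun l =>
        Submodule.mem_orthogonal_singleton_iff_inner_right.2 (by simp [heo])) y)
  set j := J.toContinuousLinearMap
  set j' := J'.toContinuousLinearMap
  have hjj : ∀ y, j.adjoint (j y) = y := fun y => ext_inner_left ℂ fun z => by
    rw [ContinuousLinearMap.adjoint_inner_right]
    exact J.inner_map_map z y
  have hjj' : ∀ y, j'.adjoint (j' y) = y := fun y => ext_inner_left ℂ fun z => by
    rw [ContinuousLinearMap.adjoint_inner_right]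
    exact J'.inner_map_map z y
  have ha0 : j'.adjoint (e 0) = 0 := ext_inner_left ℂ fun z => by
    rw [ContinuousLinearMap.adjoint_inner_right, inner_zero_right, ← inner_conj_symm]
    simp [j', hJ'0]
  intro hd
  have ha : j.comp j'.adjoint ∈ nestAlg 𝒩 := by
    intro N hN x hx
    rcases hcut N hN with ⟨k, rfl⟩ | h
    · have h1 : V k ≤ (V k).comap (j.comp j'.adjoint).toLinearMap := by
        conv_lhs => rw [hes k]
        rw [Submodule.span_le]
        rintro _ ⟨l, hl, rfl⟩
        change j (j'.adjoint (e l)) ∈ V k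
        rcases l with _ | l
        · rw [ha0, map_zero]
          exact zero_mem _
        · rw [show e (l + 1) = j' (lp.single 2 l 1) from (hJ1' l).symm, hjj']
          rw [show j (lp.single 2 l 1) = e l from hJ1 l]
          exact heV k l ((Nat.lt_succ_self l).trans hl)
      exact h1 hx
    · refine hJ2 N (hcl N hN) (fun l => ?_) _
      obtain ⟨k, hk⟩ := hun l
      exact h k (heV k l hk)
  obtain ⟨b, c, hb, hc, hab, hbc⟩ := hd (fun _ => j.comp j'.adjoint) (fun _ => ha) 1 one_pos
  have hbc : b 0 * c 0 = 1 := by simpa using hbc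
  have hcb : ∀ x ∈ M, c 0 (b 0 x) = x := by
    have h1 : M ≤ LinearMap.ker (c 0 * b 0 - 1).toLinearMap := by
      rw [hM]
      refine Submodule.topologicalClosure_minimal _ (iSup_le fun k x hx => ?_)
        (ContinuousLinearMap.isClosed_ker _)
      exact LinearMap.mem_ker.2 (sub_eq_zero.2
        (mul_apply_of_mul_eq_one hbc (hc 0 _ (hmem k)) hx))
    exact fun x hx => sub_eq_zero.1 (LinearMap.mem_ker.1 (h1 hx))
  have hB : IsUnit ((j.adjoint.comp ((b 0).comp j') : _ →L[ℂ] _)) := by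
    have h1 : (j.adjoint.comp ((b 0).comp j') : _ →L[ℂ] _) =
        1 - j.adjoint.comp ((j.comp j'.adjoint - b 0).comp j') := by
      ext1 y
      simp [hjj, hjj']
    rw [h1]
    refine isUnit_one_sub_of_norm_lt_one ?_
    have h2 : ‖j‖ ≤ 1 := J.norm_toContinuousLinearMap_le
    have h3 : ‖j'‖ ≤ 1 := J'.norm_toContinuousLinearMap_le
    calc _ ≤ ‖j.adjoint‖ * (‖j.comp j'.adjoint - b 0‖ * ‖j'‖) :=
          (ContinuousLinearMap.opNorm_comp_le _ _).trans (by
            gcongr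
            exact ContinuousLinearMap.opNorm_comp_le _ _)
      _ ≤ 1 * (‖j.comp j'.adjoint - b 0‖ * 1) := by
          rw [LinearIsometryEquiv.norm_map]
          gcongr
      _ < 1 := by simpa using hab 0
  obtain ⟨w, hw⟩ := hB.exists_right_inv
  set y := w (j.adjoint (b 0 (e 0)))
  have hy1 : j.adjoint (b 0 (j' y)) = j.adjoint (b 0 (e 0)) :=
    DFunLike.congr_fun hw (j.adjoint (b 0 (e 0)))
  have hJM : j' y ∈ M := hJ2' M hMc (fun l => heM _) y
  have hz : b 0 (j' y) - b 0 (e 0) = 0 := by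
    have hzM : b 0 (j' y) - b 0 (e 0) ∈ M :=
      M.sub_mem (hb 0 M hM𝒩 _ hJM) (hb 0 M hM𝒩 _ (heM 0))
    have h1 : M ≤ (ℂ ∙ (b 0 (j' y) - b 0 (e 0)))ᗮ := by
      refine hMle _ (Submodule.isClosed_orthogonal _) fun l => ?_
      rw [Submodule.mem_orthogonal_singleton_iff_inner_left, ← hJ1 l]
      change inner ℂ (j (lp.single 2 l 1)) _ = _
      rw [← ContinuousLinearMap.adjoint_inner_right, map_sub, hy1, sub_self, inner_zero_right]
    exact inner_self_eq_zero.1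
      (Submodule.mem_orthogonal_singleton_iff_inner_right.1 (h1 hzM))
  have h1 : j' y = e 0 := by
    rw [← hcb _ hJM, sub_eq_zero.1 hz, hcb _ (heM 0)]
  have h2 := hJ'0 y
  rw [show J' y = e 0 from h1, heo] at h2
  simp at h2

end RankOne

section RankOneFailure

variable {H : Type*} [NormedAddCommGroup H] [InnerProductSpace ℂ H] [CompleteSpace H]

theorem not_rgDenseIn_one [TopologicalSpace.SeparableSpace H] (hinf : ¬ FiniteDimensional ℂ H)
    {𝒩 : Set (Submodule ℂ H)} (h𝒩 : IsNest 𝒩) {Q : ℕ}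
    (hQ : ∀ q Nc, DChain 𝒩 q Nc → q ≤ Q)
    (hatom : ∀ M ∈ 𝒩, ∀ N ∈ 𝒩, M < N → (∀ L ∈ 𝒩, ¬(M < L ∧ L < N)) →
      FiniteDimensional ℂ ↥(gap M N)) : ¬ RgDenseIn (nestAlg 𝒩) 1 := by
  obtain ⟨p, F, hF0, -, hmono, hmem, hfd, hnext, hcut, hlast⟩ := exists_pieces h𝒩 hQ hatom
  have hg : ∀ K : Submodule ℂ H, gap (F 0 0) K = K := fun K => by simp [hF0]
  have : ∀ k, FiniteDimensional ℂ (F 0 k) := fun k => hg (F 0 k) ▸ hfd 0 k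
  refine not_rgDenseIn_one_of_flag (hmono 0) hF0 (hmem 0) (hmem 1 0) (hnext 0)
    (fun L hL => hcut 0 L hL (hF0 ▸ bot_le)) h𝒩.closed fun hfin => ?_
  rcases hlast 0 with h | h
  · exact h ((hg (F (0 + 1) 0)).symm ▸ hfin)
  · exact hinf (Module.finite_def.2 (Submodule.fg_iff_finiteDimensional _ |>.2 (h ▸ hfin)))

end RankOneFailure

end NestRank

/-- **Theorem (characterization of rtsr for nest algebras).**  For a nest `𝒩`
on an infinite-dimensional separable complex Hilbert space, the following are
equivalent: (i) `rtsr(T(𝒩)) = 2`; (ii) `rtsr(T(𝒩)) < ∞`; (iii) `β(𝒩) < ∞`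
(the lengths of chains in `𝒩` with decreasing interval dimensions are uniformly
bounded) and every atom of `𝒩` is finite dimensional. -/
theorem rtsr_nestAlgebra_characterization
    {H : Type*} [NormedAddCommGroup H] [InnerProductSpace ℂ H]
    [CompleteSpace H] [TopologicalSpace.SeparableSpace H]
    (hinf : ¬ FiniteDimensional ℂ H)
    {𝒩 : Set (Submodule ℂ H)} (h𝒩 : IsNest 𝒩) :
    List.TFAE
      [ RgDenseIn (nestAlg 𝒩) 2 ∧ ¬ RgDenseIn (nestAlg 𝒩) 1,
        ∃ n : ℕ, 1 ≤ n ∧ RgDenseIn (nestAlg 𝒩) n,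
        (∃ Q : ℕ, ∀ (q : ℕ) (Nc : ℕ → Submodule ℂ H),
            (∀ j ≤ q, Nc j ∈ 𝒩) → (∀ j < q, Nc j < Nc (j + 1)) →
            (∀ j, 1 ≤ j → j + 1 ≤ q →
              Module.rank ℂ ↥(Nc (j + 1) ⊓ (Nc j)ᗮ) ≤
                Module.rank ℂ ↥(Nc j ⊓ (Nc (j - 1))ᗮ)) →
            q ≤ Q) ∧
          (∀ M ∈ 𝒩, ∀ N ∈ 𝒩, M < N → (∀ L ∈ 𝒩, ¬(M < L ∧ L < N)) →
            FiniteDimensional ℂ ↥(N ⊓ Mᗮ)) ] := by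
  tfae_have 1 → 2 := fun h => ⟨2, by norm_num, h.1⟩
  tfae_have 2 → 3 := by
    rintro ⟨n, hn, hd⟩
    obtain ⟨Q, hQ⟩ := NestRank.exists_chain_bound h𝒩 hn hd
    exact ⟨⟨Q, fun q Nc h1 h2 h3 => hQ q Nc ⟨h1, h2, h3⟩⟩, fun M hM N hN hMN hatom =>
      NestRank.finiteDimensional_of_atom h𝒩 hn hd hM hN hMN hatom⟩
  tfae_have 3 → 1 := by
    rintro ⟨⟨Q, hQ⟩, hatom⟩
    have hQ' : ∀ q Nc, NestRank.DChain 𝒩 q Nc → q ≤ Q := fun q Nc h => hQ q Nc h.1 h.2.1 h.2.2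
    exact ⟨NestRank.rgDenseIn_two h𝒩 hQ' hatom, NestRank.not_rgDenseIn_one hinf h𝒩 hQ' hatom⟩
  tfae_finish
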